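/- Unique continuation of local conformal flatness for Bach-flat metrics in dimension four (Theorem 3.10, dimension-4 coordinate version): Let U ⊆ ℝ⁴ be a connected open set and let g be a metric of class C^{k+α} on U with k ∈ ℕ, k ≥ 4, and α ∈ (0,1). Suppose the Bach tensor of g vanishes identically on U, i.e. B_{ab}(g) = 0 on U for all a, b (in dimension four the Fefferman–Graham obstruction tensor equals the Bach tensor). If the Weyl tensor of g vanishes on some nonempty open subset of U, then the Weyl tensor of g vanishes on all of U. -/

import Mathlib

noncomputable section

open Set Matrix Matrix

/-- Points of `ℝⁿ`. -/
abbrev Pt (n : ℕ) := Fin n → ℝ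

/-- A metric in coordinates: a matrix-valued map. -/
abbrev Met (n : ℕ) := Pt n → Matrix (Fin n) (Fin n) ℝ

/-- Partial derivative of `f` in the `a`-th coordinate direction. -/
def pd {n : ℕ} (a : Fin n) (f : Pt n → ℝ) (x : Pt n) : ℝ :=
  fderiv ℝ f x (Pi.single a 1)

/-- `g` is a metric (pointwise symmetric positive definite) on `U`. -/
def IsMetricOn {n : ℕ} (g : Met n) (U : Set (Pt n)) : Prop :=
  ∀ x ∈ U, (g x).IsSymm ∧ (g x).PosDef

/-- Christoffel symbols `Γ^c_{ab}` of `g`. -/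
def christoffel {n : ℕ} (g : Met n) (c a b : Fin n) (x : Pt n) : ℝ :=
  (1 / 2) * ∑ d, (g x)⁻¹ c d *
    (pd a (fun y => g y b d) x + pd b (fun y => g y a d) x - pd d (fun y => g y a b) x)

/-- Ricci tensor `R_{ab}` of `g`. -/
def ricci {n : ℕ} (g : Met n) (a b : Fin n) (x : Pt n) : ℝ :=
  (∑ c, pd c (christoffel g c a b) x) - (∑ c, pd a (christoffel g c c b) x)
    + (∑ c, ∑ d, christoffel g c a b x * christoffel g d d c x)
    - (∑ c, ∑ d, christoffel g d c b x * christoffel g c a d x)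

/-- Scalar curvature `R(g)`. -/
def scalarCurv {n : ℕ} (g : Met n) (x : Pt n) : ℝ :=
  ∑ a, ∑ b, (g x)⁻¹ a b * ricci g a b x

/-- Laplace–Beltrami operator `Δ_g`. -/
def laplaceBeltrami {n : ℕ} (g : Met n) (u : Pt n → ℝ) (x : Pt n) : ℝ :=
  -(Real.sqrt (g x).det)⁻¹ *
    ∑ a, pd a (fun y => Real.sqrt (g y).det * ∑ b, (g y)⁻¹ a b * pd b u y) x

/-- Conformal Laplacian `L_g`. -/
def confLap {n : ℕ} (g : Met n) (u : Pt n → ℝ) (x : Pt n) : ℝ :=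
  laplaceBeltrami g u x + (((n : ℝ) - 2) / (4 * ((n : ℝ) - 1))) * scalarCurv g x * u x

/-- `f` is of class `C^{k+α}` on `s`: it is `C^k` there and its `k`-th order derivatives are
locally `α`-Hölder continuous. -/
def CHolderOn {n : ℕ} (k : ℕ) (α : ℝ) (s : Set (Pt n)) (f : Pt n → ℝ) : Prop :=
  ContDiffOn ℝ k f s ∧
    ∀ x ∈ s, ∃ C : NNReal, ∃ t ∈ nhdsWithin x s,
      HolderOnWith C (Real.toNNReal α) (iteratedFDerivWithin ℝ k f s) t

/-- All entries of `g` are of class `C^{k+α}` on `s`. -/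
def MetCHolderOn {n : ℕ} (k : ℕ) (α : ℝ) (s : Set (Pt n)) (g : Met n) : Prop :=
  ∀ a b, CHolderOn k α s fun x => g x a b

/-- Contracted Christoffel symbol `Γ^a = g^{bc} Γ^a_{bc}`. -/
def gammaUp {n : ℕ} (g : Met n) (a : Fin n) (x : Pt n) : ℝ :=
  ∑ b, ∑ c, (g x)⁻¹ b c * christoffel g a b c x

/-- Contracted Christoffel symbol `Γ_a = g_{ab} Γ^b`. -/
def gammaLow {n : ℕ} (g : Met n) (a : Fin n) (x : Pt n) : ℝ :=
  ∑ b, g x a b * gammaUp g b x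

/-- `g` satisfies the conformal harmonic gauge on `U`. -/
def ConfHarmonicGauge {n : ℕ} (g : Met n) (U : Set (Pt n)) : Prop :=
  ∃ f : Pt n → ℝ, ContDiffOn ℝ 2 f U ∧ (∀ x ∈ U, 0 < f x) ∧
    (∀ x ∈ U, confLap g f x = 0) ∧
    ∀ a : Fin n, ∀ x ∈ U, gammaLow g a x = 2 * pd a (fun y => Real.log (f y)) x

/-- Determinant-normalized metric `ĝ = (det g)^{-1/n} g`. -/
def dnorm {n : ℕ} (g : Met n) : Met n :=
  fun x => ((g x).det ^ (-(1 : ℝ) / (n : ℝ))) • g x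

/-- Jacobian matrix of a map `Z : ℝⁿ → ℝⁿ`. -/
def jac {n : ℕ} (Z : Pt n → Pt n) (x : Pt n) : Matrix (Fin n) (Fin n) ℝ :=
  Matrix.of fun i j => pd j (fun y => Z y i) x

/-- Riemann curvature tensor `R_{abc}{}^{d}`. -/
def riemannUp {n : ℕ} (g : Met n) (a b c d : Fin n) (x : Pt n) : ℝ :=
  pd a (christoffel g d b c) x - pd b (christoffel g d a c) x
    + (∑ e, christoffel g e b c x * christoffel g d a e x)
    - (∑ e, christoffel g e a c x * christoffel g d b e x)

/-- Riemann curvature tensor `R_{abcd} = R_{abc}{}^{e} g_{ed}`. -/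
def riemannLow {n : ℕ} (g : Met n) (a b c d : Fin n) (x : Pt n) : ℝ :=
  ∑ e, riemannUp g a b c e x * g x e d

/-- Schouten tensor `P_{ab}`. -/
def schouten {n : ℕ} (g : Met n) (a b : Fin n) (x : Pt n) : ℝ :=
  (1 / ((n : ℝ) - 2)) * (ricci g a b x - (scalarCurv g x / (2 * ((n : ℝ) - 1))) * g x a b)

/-- Weyl tensor `W_{abcd}`. -/
def weyl {n : ℕ} (g : Met n) (a b c d : Fin n) (x : Pt n) : ℝ :=
  riemannLow g a b c d x + schouten g a c x * g x b d - schouten g b c x * g x a d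
    + schouten g b d x * g x a c - schouten g a d x * g x b c

/-- Weyl tensor with raised last index, `W_{abc}{}^{d} = g^{de} W_{abce}`. -/
def weylUp {n : ℕ} (g : Met n) (a b c d : Fin n) (x : Pt n) : ℝ :=
  ∑ e, (g x)⁻¹ d e * weyl g a b c e x

/-- Covariant derivative of a 2-tensor: `(∇T)_{cab} = ∇_c T_{ab}`. -/
def cov2 {n : ℕ} (g : Met n) (T : Fin n → Fin n → Pt n → ℝ) (c a b : Fin n) (x : Pt n) : ℝ :=
  pd c (T a b) x - (∑ d, christoffel g d c a x * T d b x)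
    - ∑ d, christoffel g d c b x * T a d x

/-- Covariant derivative of a 3-tensor: `(∇T)_{dabc} = ∇_d T_{abc}`. -/
def cov3 {n : ℕ} (g : Met n) (T : Fin n → Fin n → Fin n → Pt n → ℝ) (d a b c : Fin n)
    (x : Pt n) : ℝ :=
  pd d (T a b c) x - (∑ e, christoffel g e d a x * T e b c x)
    - (∑ e, christoffel g e d b x * T a e c x)
    - ∑ e, christoffel g e d c x * T a b e x

/-- Cotton tensor `C_{abc} = ∇_a P_{bc} - ∇_b P_{ac}`. -/
def cotton {n : ℕ} (g : Met n) (a b c : Fin n) (x : Pt n) : ℝ :=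
  cov2 g (schouten g) a b c x - cov2 g (schouten g) b a c x

/-- Bach tensor `B_{ab}`. -/
def bach {n : ℕ} (g : Met n) (a b : Fin n) (x : Pt n) : ℝ :=
  (∑ c, ∑ d, (g x)⁻¹ c d *
      (cov3 g (cov2 g (schouten g)) d a b c x - cov3 g (cov2 g (schouten g)) d c a b x))
    + ∑ c, ∑ d, ∑ e, ∑ f, (g x)⁻¹ c e * (g x)⁻¹ d f * schouten g e f x * weyl g a c d b x

section IntegrationByParts

open MeasureTheory

variable {n : ℕ}

lemma continuous_pd {f : Pt n → ℝ} (hf : ContDiff ℝ 1 f) (a : Fin n) : Continuous (pd a f) :=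
  (hf.continuous_fderiv one_ne_zero).clm_apply continuous_const

lemma hasCompactSupport_pd {f : Pt n → ℝ} (hf : HasCompactSupport f) (a : Fin n) :
    HasCompactSupport (pd a f) :=
  hf.fderiv_apply ℝ _

lemma pd_mul {f h : Pt n → ℝ} {x : Pt n} (hf : DifferentiableAt ℝ f x)
    (hh : DifferentiableAt ℝ h x) (a : Fin n) :
    pd a (fun y => f y * h y) x = pd a f x * h x + f x * pd a h x := by
  unfold pd
  rw [fderiv_fun_mul hf hh]
  simp only [_root_.add_apply, _root_.smul_apply, smul_eq_mul]
  ring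

lemma integral_mul_pd {f h : Pt n → ℝ} (hf : ContDiff ℝ 1 f) (hh : ContDiff ℝ 1 h)
    (hc : HasCompactSupport h) (a : Fin n) :
    ∫ x, f x * pd a h x = -∫ x, pd a f x * h x := by
  refine integral_mul_fderiv_eq_neg_fderiv_mul_of_integrable ?_ ?_ ?_
    (fun x _ => hf.differentiable one_ne_zero x) (fun x _ => hh.differentiable one_ne_zero x)
  · exact ((continuous_pd hf a).mul hh.continuous).integrable_of_hasCompactSupport hc.mul_left
  · exact (hf.continuous.mul (continuous_pd hh a)).integrable_of_hasCompactSupport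
      (hasCompactSupport_pd hc a).mul_left
  · exact (hf.continuous.mul hh.continuous).integrable_of_hasCompactSupport hc.mul_left

lemma hasDerivAt_integral_mul_translate {q f : Pt n → ℝ} (hq : Continuous q)
    (hqc : HasCompactSupport q) (hf : ContDiff ℝ 1 f) (hfc : HasCompactSupport f) (b : Fin n) :
    HasDerivAt (fun t : ℝ => ∫ x, q x * f (x + t • Pi.single b 1))
      (∫ x, q x * pd b f x) 0 := by
  obtain ⟨C, hC⟩ := (continuous_pd hf b).bounded_above_of_compact_support
    (hasCompactSupport_pd hfc b)
  have key := hasDerivAt_integral_of_dominated_loc_of_deriv_le (μ := (volume : Measure (Pt n)))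
    (F := fun (t : ℝ) (x : Pt n) => q x * f (x + t • Pi.single b 1))
    (F' := fun (t : ℝ) (x : Pt n) => q x * pd b f (x + t • Pi.single b 1))
    (x₀ := (0 : ℝ)) (s := univ) (bound := fun x => |q x| * C) Filter.univ_mem ?_ ?_ ?_ ?_ ?_ ?_
  · simpa using key.2
  · refine Filter.Eventually.of_forall fun t => Continuous.aestronglyMeasurable ?_
    exact hq.mul (hf.continuous.comp (by fun_prop))
  · refine Continuous.integrable_of_hasCompactSupport ?_ hqc.mul_right
    exact hq.mul (hf.continuous.comp (by fun_prop))
  · exact (hq.mul ((continuous_pd hf b).comp (by fun_prop))).aestronglyMeasurable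
  · refine Filter.Eventually.of_forall fun x t _ => ?_
    rw [norm_mul, Real.norm_eq_abs]
    exact mul_le_mul_of_nonneg_left (hC _) (abs_nonneg _)
  · exact (hq.abs.mul continuous_const).integrable_of_hasCompactSupport
      (HasCompactSupport.mul_right (f := fun x => |q x|) (hqc.comp_left abs_zero))
  · refine Filter.Eventually.of_forall fun x t _ => ?_
    have h1 : HasDerivAt (fun t : ℝ => x + t • (Pi.single b 1 : Pt n)) (Pi.single b 1) t := by
      simpa using ((hasDerivAt_id t).smul_const (Pi.single b 1 : Pt n)).const_add x
    exact ((hf.differentiable one_ne_zero _).hasFDerivAt.comp_hasDerivAt t h1).const_mul (q x)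

lemma pd_translate (f : Pt n → ℝ) (a : Fin n) (w x : Pt n) :
    pd a (fun y => f (y + w)) x = pd a f (x + w) := by
  unfold pd
  rw [fderiv_comp_add_right]

/-- Mixed partial derivatives may be exchanged under the integral, for `C¹` functions. -/
lemma integral_pd_mul_pd_comm {f k : Pt n → ℝ} (hf : ContDiff ℝ 1 f)
    (hfc : HasCompactSupport f) (hk : ContDiff ℝ 1 k) (hkc : HasCompactSupport k) (a b : Fin n) :
    ∫ x, pd a f x * pd b k x = ∫ x, pd b f x * pd a k x := by
  have h1 := hasDerivAt_integral_mul_translate (continuous_pd hf a)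
    (hasCompactSupport_pd hfc a) hk hkc b
  have h2 := hasDerivAt_integral_mul_translate (continuous_pd hk a)
    (hasCompactSupport_pd hkc a) hf hfc b
  have h3 : HasDerivAt (fun t : ℝ => -∫ x, pd a k x * f (x + (-t) • Pi.single b 1))
      (∫ x, pd a k x * pd b f x) 0 := by
    have h2' : HasDerivAt (fun t : ℝ => ∫ x, pd a k x * f (x + t • Pi.single b 1))
      (∫ x, pd a k x * pd b f x) (-0) := by simpa using h2
    have h := (h2'.comp (0 : ℝ) (hasDerivAt_neg (0 : ℝ))).neg
    rw [mul_neg_one, neg_neg] at h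
    exact h
  have heq : (fun t : ℝ => ∫ x, pd a f x * k (x + t • Pi.single b 1)) =
      fun t : ℝ => -∫ x, pd a k x * f (x + (-t) • Pi.single b 1) := by
    funext t
    have hkt : ContDiff ℝ 1 fun x => k (x + t • Pi.single b 1) :=
      hk.comp (contDiff_id.add contDiff_const)
    have h4 := integral_mul_pd hkt hf hfc a
    simp only [pd_translate] at h4
    have h5 := integral_add_right_eq_self (μ := (volume : Measure (Pt n)))
      (fun x => pd a k x * f (x + (-t) • Pi.single b 1)) (t • Pi.single b 1)
    simp only [neg_smul, add_neg_cancel_right] at h5 ⊢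
    rw [← h5, ← h4]
    simp only [mul_comm]
  rw [heq] at h1
  rw [h1.unique h3]
  simp only [mul_comm]

lemma integral_mul_pd_mul_pd_sub {m f h : Pt n → ℝ} (hm : ContDiff ℝ 1 m) (hf : ContDiff ℝ 1 f)
    (hfc : HasCompactSupport f) (hh : ContDiff ℝ 1 h) (hhc : HasCompactSupport h) (a b : Fin n) :
    ∫ x, m x * (pd a f x * pd b h x - pd b f x * pd a h x) =
      ∫ x, h x * (pd a m x * pd b f x - pd b m x * pd a f x) := by
  have hcomm := integral_pd_mul_pd_comm hf hfc (hm.mul hh) hhc.mul_left a b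
  have hpd : ∀ c x, pd c (fun y => m y * h y) x = pd c m x * h x + m x * pd c h x := fun c x =>
    pd_mul (hm.differentiable one_ne_zero x) (hh.differentiable one_ne_zero x) c
  have hpa := continuous_pd hf a
  have hpb := continuous_pd hf b
  have hint : ∀ c d, Integrable fun x => pd c f x * pd d (fun y => m y * h y) x := fun c d =>
    ((continuous_pd hf c).mul (continuous_pd (hm.mul hh) d)).integrable_of_hasCompactSupport
      (hasCompactSupport_pd hfc c).mul_right
  have h0 : ∫ x, (pd a f x * pd b (fun y => m y * h y) x
      - pd b f x * pd a (fun y => m y * h y) x) = 0 := by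
    rw [integral_sub (hint a b) (hint b a)]
    exact sub_eq_zero.2 hcomm
  have hi1 : Integrable fun x => m x * (pd a f x * pd b h x - pd b f x * pd a h x) := by
    refine Continuous.integrable_of_hasCompactSupport ?_ ?_
    · exact hm.continuous.mul ((hpa.mul (continuous_pd hh b)).sub (hpb.mul (continuous_pd hh a)))
    · exact ((hasCompactSupport_pd hfc a).mul_right.sub
        (hasCompactSupport_pd hfc b).mul_right).mul_left
  have hi2 : Integrable fun x => h x * (pd a m x * pd b f x - pd b m x * pd a f x) := by
    refine Continuous.integrable_of_hasCompactSupport ?_ hhc.mul_right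
    exact hh.continuous.mul (((continuous_pd hm a).mul hpb).sub ((continuous_pd hm b).mul hpa))
  rw [← sub_eq_zero, ← integral_sub hi1 hi2, ← h0]
  congr 1
  funext x
  rw [hpd, hpd]
  ring

lemma integral_mul_pd_mul_add {m f h : Pt n → ℝ} (hm : ContDiff ℝ 1 m) (hf : ContDiff ℝ 1 f)
    (hfc : HasCompactSupport f) (hh : ContDiff ℝ 1 h) (d : Fin n) :
    ∫ x, m x * (pd d f x * h x + f x * pd d h x) = -∫ x, pd d m x * (f x * h x) := by
  have h1 := integral_mul_pd hm (hf.mul hh) hfc.mul_right d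
  rw [← h1]
  congr 1
  funext x
  rw [pd_mul (hf.differentiable one_ne_zero x) (hh.differentiable one_ne_zero x)]

end IntegrationByParts

section TwoFormAlgebra

variable {n : ℕ}

/-- The bilinear form on matrices induced by a bilinear form `G` on covectors. -/
def matPair (G : Fin n → Fin n → ℝ) (X Y : Fin n → Fin n → ℝ) : ℝ :=
  ∑ b, ∑ b', ∑ c, ∑ c', G b b' * G c c' * (X b c * Y b' c')

lemma matPair_add_left (G : Fin n → Fin n → ℝ) (X Y Z : Fin n → Fin n → ℝ) :
    matPair G (fun b c => X b c + Y b c) Z = matPair G X Z + matPair G Y Z := by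
  simp only [matPair, ← Finset.sum_add_distrib]
  iterate 4 refine Finset.sum_congr rfl fun _ _ => ?_
  ring

lemma matPair_smul_left (G : Fin n → Fin n → ℝ) (r : ℝ) (X Z : Fin n → Fin n → ℝ) :
    matPair G (fun b c => r * X b c) Z = r * matPair G X Z := by
  simp only [matPair, Finset.mul_sum]
  iterate 4 refine Finset.sum_congr rfl fun _ _ => ?_
  ring

lemma matPair_comm {G : Fin n → Fin n → ℝ} (hG : ∀ a b, G a b = G b a)
    (X Y : Fin n → Fin n → ℝ) : matPair G X Y = matPair G Y X := by
  unfold matPair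
  rw [Finset.sum_comm]
  refine Finset.sum_congr rfl fun b _ => Finset.sum_congr rfl fun b' _ => ?_
  rw [Finset.sum_comm]
  refine Finset.sum_congr rfl fun c _ => Finset.sum_congr rfl fun c' _ => ?_
  rw [hG b' b, hG c' c]
  ring

lemma matPair_add_right {G : Fin n → Fin n → ℝ} (hG : ∀ a b, G a b = G b a)
    (X Y Z : Fin n → Fin n → ℝ) :
    matPair G Z (fun b c => X b c + Y b c) = matPair G Z X + matPair G Z Y := by
  rw [matPair_comm hG, matPair_add_left, matPair_comm hG X, matPair_comm hG Y]

lemma matPair_smul_right {G : Fin n → Fin n → ℝ} (hG : ∀ a b, G a b = G b a) (r : ℝ)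
    (X Z : Fin n → Fin n → ℝ) :
    matPair G Z (fun b c => r * X b c) = r * matPair G Z X := by
  rw [matPair_comm hG, matPair_smul_left, matPair_comm hG X]

open scoped MatrixOrder Matrix.Norms.L2Operator in
lemma sum_sq_le_matPair {G : Fin n → Fin n → ℝ} (hG : ∀ a b, G a b = G b a) {l : ℝ} (hl : 0 ≤ l)
    (hpos : ∀ y : Fin n → ℝ, l * ∑ a, y a ^ 2 ≤ ∑ a, ∑ b, G a b * (y a * y b))
    (X : Fin n → Fin n → ℝ) :
    l ^ 2 * ∑ b, ∑ c, X b c ^ 2 ≤ matPair G X X := by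
  have hpsd : (Matrix.of G).PosSemidef := by
    refine Matrix.PosSemidef.of_dotProduct_mulVec_nonneg ?_ ?_
    · ext a b
      simp [Matrix.conjTranspose_apply, hG b a]
    · intro y
      have h := hpos y
      have h0 : 0 ≤ ∑ a, y a ^ 2 := Finset.sum_nonneg fun _ _ => sq_nonneg _
      have : star y ⬝ᵥ (Matrix.of G *ᵥ y) = ∑ a, ∑ b, G a b * (y a * y b) := by
        simp only [dotProduct, mulVec, Matrix.of_apply, Finset.mul_sum, star_trivial]
        iterate 2 refine Finset.sum_congr rfl fun _ _ => ?_
        ring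
      rw [this]
      nlinarith
  obtain ⟨M, hM⟩ := CStarAlgebra.nonneg_iff_eq_star_mul_self.mp hpsd.nonneg
  have hGM : ∀ b b', G b b' = ∑ k, M k b * M k b' := fun b b' => by
    have := congrFun (congrFun hM b) b'
    simpa [Matrix.mul_apply, Matrix.star_apply] using this
  have h1 : matPair G X X = ∑ k, ∑ b, ∑ b', G b b' *
      ((∑ c, M k c * X b c) * (∑ c, M k c * X b' c)) := by
    have : ∀ b b', ∑ c, ∑ c', G b b' * G c c' * (X b c * X b' c') =
        ∑ k, G b b' * ((∑ c, M k c * X b c) * (∑ c, M k c * X b' c)) := fun b b' => by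
      simp only [mul_assoc, ← Finset.mul_sum]
      congr 1
      simp only [Finset.sum_mul_sum]
      simp only [hGM, Finset.sum_mul]
      symm
      rw [Finset.sum_comm]
      refine Finset.sum_congr rfl fun c _ => ?_
      rw [Finset.sum_comm]
      iterate 2 refine Finset.sum_congr rfl fun _ _ => ?_
      ring
    simp only [matPair, this]
    rw [Finset.sum_congr rfl fun b _ => Finset.sum_comm, Finset.sum_comm]
  have h2 : ∀ k, l * ∑ b, (∑ c, M k c * X b c) ^ 2 ≤ ∑ b, ∑ b', G b b' *
      ((∑ c, M k c * X b c) * (∑ c, M k c * X b' c)) := fun k => hpos _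
  have h3 : ∑ k, ∑ b, (∑ c, M k c * X b c) ^ 2 = ∑ b, ∑ c, ∑ c', G c c' * (X b c * X b c') := by
    rw [Finset.sum_comm]
    refine Finset.sum_congr rfl fun b _ => ?_
    simp only [sq, Finset.sum_mul_sum]
    simp only [hGM, Finset.sum_mul]
    rw [Finset.sum_comm]
    refine Finset.sum_congr rfl fun c _ => ?_
    rw [Finset.sum_comm]
    iterate 2 refine Finset.sum_congr rfl fun _ _ => ?_
    ring
  calc l ^ 2 * ∑ b, ∑ c, X b c ^ 2 = l * ∑ b, l * ∑ c, X b c ^ 2 := by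
        rw [← Finset.mul_sum]; ring
    _ ≤ l * ∑ b, ∑ c, ∑ c', G c c' * (X b c * X b c') :=
        mul_le_mul_of_nonneg_left (Finset.sum_le_sum fun b _ => hpos _) hl
    _ = ∑ k, l * ∑ b, (∑ c, M k c * X b c) ^ 2 := by rw [← h3, Finset.mul_sum]
    _ ≤ matPair G X X := by
        rw [h1]
        exact Finset.sum_le_sum fun k _ => h2 k

/-- The principal part of the conjugated first-order system is null-symmetric. -/
lemma matPair_dirac {G : Fin n → Fin n → ℝ} (hG : ∀ a b, G a b = G b a) (p N : Fin n → ℝ)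
    (hN : ∀ a, N a = ∑ b, G a b * p b) (V : Fin n → Fin n → Fin n → ℝ)
    (hV : ∀ e b c, V e b c = -V e c b) :
    matPair G (fun b c => ∑ d, N d * V d b c)
      (fun b c => -(∑ a, N a * (V b c a + V c a b)) - p b * (∑ a, ∑ e, G a e * V e a c)
        + p c * (∑ a, ∑ e, G a e * V e a b)) =
    2 * ∑ e, ∑ a, ∑ c, ∑ c', ∑ d, ∑ b, G e a * G c c' * N d * N b *
        (V d a c' * V e b c - V e a c' * V d b c) := by
  set X : Fin n → Fin n → ℝ := fun b c => ∑ d, N d * V d b c with hX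
  set E : Fin n → Fin n → ℝ := fun e c => ∑ b, N b * V e b c with hE
  set D : Fin n → ℝ := fun c => ∑ a, ∑ e, G a e * V e a c with hD
  set Z : Fin n → ℝ := fun c => ∑ b, N b * X b c with hZ
  have hXa : ∀ b c, X b c = -X c b := fun b c => by
    simp only [hX, ← Finset.sum_neg_distrib]
    exact Finset.sum_congr rfl fun d _ => by rw [hV d b c]; ring
  have h1 : (fun b c => -(∑ a, N a * (V b c a + V c a b)) - p b * D c + p c * D b) =
      fun b c => (E b c + (-1) * (p b * D c)) + (-1) * (E c b + (-1) * (p c * D b)) := by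
    funext b c
    have : ∑ a, N a * (V b c a + V c a b) = -E b c + E c b := by
      simp only [hE, ← Finset.sum_neg_distrib, ← Finset.sum_add_distrib]
      exact Finset.sum_congr rfl fun a _ => by rw [hV b c a]; ring
    rw [this]; ring
  have h2 : ∀ T : Fin n → Fin n → ℝ,
      matPair G X (fun b c => T b c + (-1) * T c b) = 2 * matPair G X T := by
    intro T
    have : matPair G X (fun b c => T c b) = - matPair G X T := by
      calc matPair G X (fun b c => T c b)
          = ∑ c, ∑ c', ∑ b, ∑ b', G b b' * G c c' * (X b c * T c' b') := by
            simp only [matPair]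
            rw [Finset.sum_congr rfl fun b _ => Finset.sum_comm, Finset.sum_comm]
            refine Finset.sum_congr rfl fun c _ => ?_
            rw [Finset.sum_congr rfl fun b _ => Finset.sum_comm, Finset.sum_comm]
        _ = - matPair G X T := by
            simp only [matPair, ← Finset.sum_neg_distrib]
            iterate 4 refine Finset.sum_congr rfl fun _ _ => ?_
            rw [hXa]
            ring
    rw [matPair_add_right hG, matPair_smul_right hG, this]
    ring
  change matPair G X (fun b c => -(∑ a, N a * (V b c a + V c a b)) - p b * D c + p c * D b) = _
  rw [h1, h2 fun b c => E b c + (-1) * (p b * D c), matPair_add_right hG,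
    matPair_smul_right hG]
  congr 1
  have h3 : matPair G X (fun b c => p b * D c) = ∑ c, ∑ c', G c c' * (Z c * D c') := by
    have : ∀ b, ∑ b', ∑ c, ∑ c', G b b' * G c c' * (X b c * (p b' * D c')) =
        ∑ c, ∑ c', G c c' * ((N b * X b c) * D c') := by
      intro b
      rw [Finset.sum_comm]
      refine Finset.sum_congr rfl fun c _ => ?_
      rw [Finset.sum_comm]
      refine Finset.sum_congr rfl fun c' _ => ?_
      rw [hN b, Finset.sum_mul, Finset.sum_mul, Finset.mul_sum]
      exact Finset.sum_congr rfl fun b' _ => by ring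
    simp only [matPair, this]
    rw [Finset.sum_comm]
    refine Finset.sum_congr rfl fun c _ => ?_
    rw [Finset.sum_comm]
    refine Finset.sum_congr rfl fun c' _ => ?_
    rw [← Finset.mul_sum, ← Finset.sum_mul]
  have hNE : ∀ c, ∑ d, N d * E d c = Z c := fun c => by
    simp only [hE, hZ, hX, Finset.mul_sum]
    rw [Finset.sum_comm]
    iterate 2 refine Finset.sum_congr rfl fun _ _ => ?_
    ring
  have h4 : ∀ e a c c', ∑ d, ∑ b, G e a * G c c' * N d * N b *
        (V d a c' * V e b c - V e a c' * V d b c) =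
      G e a * G c c' * (X a c' * E e c) - G c c' * ((G a e * V e a c') * Z c) := by
    intro e a c c'
    have e1 : X a c' * E e c = ∑ d, ∑ b, N d * N b * (V d a c' * V e b c) := by
      simp only [hX, hE, Finset.sum_mul_sum]
      iterate 2 refine Finset.sum_congr rfl fun _ _ => ?_
      ring
    have e2 : V e a c' * Z c = ∑ d, ∑ b, N d * N b * (V e a c' * V d b c) := by
      simp only [← hNE, hE, Finset.mul_sum]
      iterate 2 refine Finset.sum_congr rfl fun _ _ => ?_
      ring
    rw [mul_assoc (G a e), e2, e1, hG a e]
    simp only [Finset.mul_sum, ← Finset.sum_sub_distrib]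
    iterate 2 refine Finset.sum_congr rfl fun _ _ => ?_
    ring
  simp only [h4, Finset.sum_sub_distrib]
  rw [h3]
  have h5 : ∑ e, ∑ a, ∑ c, ∑ c', G c c' * ((G a e * V e a c') * Z c) =
      ∑ c, ∑ c', G c c' * (Z c * D c') := by
    rw [Finset.sum_comm]
    simp only [hD, Finset.mul_sum]
    rw [Finset.sum_congr rfl fun a _ => Finset.sum_comm, Finset.sum_comm]
    refine Finset.sum_congr rfl fun c _ => ?_
    rw [Finset.sum_congr rfl fun a _ => Finset.sum_comm, Finset.sum_comm]
    iterate 3 refine Finset.sum_congr rfl fun _ _ => ?_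
    ring
  have h6 : matPair G X E = ∑ e, ∑ a, ∑ c, ∑ c', G e a * G c c' * (X a c' * E e c) := by
    rw [matPair_comm hG]
    simp only [matPair]
    iterate 4 refine Finset.sum_congr rfl fun _ _ => ?_
    ring
  rw [h5, h6]
  ring

end TwoFormAlgebra

section GradientEstimate

open MeasureTheory

variable {n : ℕ}

lemma integrable_of_forall_notMem_eq_zero {B : Set (Pt n)} (hB : IsCompact B) {f : Pt n → ℝ}
    (hf : Continuous f) (h0 : ∀ x ∉ B, f x = 0) : Integrable f :=
  hf.integrable_of_hasCompactSupport (HasCompactSupport.intro hB h0)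

lemma sum_le_card_mul {ι : Type*} [Fintype ι] {t : ι → ℝ} {M : ℝ} (h : ∀ i, t i ≤ M) :
    ∑ i, t i ≤ Fintype.card ι * M := by
  simpa using Finset.sum_le_card_nsmul Finset.univ t M fun i _ => h i

/-- Pointwise squared norm of a family of functions with two indices. -/
def normSq (v : Fin n → Fin n → Pt n → ℝ) (x : Pt n) : ℝ := ∑ b, ∑ c, v b c x ^ 2

/-- Pointwise squared norm of the gradient of a family of functions with two indices. -/
def gradSq (v : Fin n → Fin n → Pt n → ℝ) (x : Pt n) : ℝ := ∑ e, ∑ b, ∑ c, pd e (v b c) x ^ 2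

/-- The components of `e^φ d (e^{-φ} v)` where `dφ = κ p`. -/
def conjD (κ : Pt n → ℝ) (p : Fin n → Pt n → ℝ) (v : Fin n → Fin n → Pt n → ℝ) (a b c : Fin n)
    (x : Pt n) : ℝ :=
  pd a (v b c) x + pd b (v c a) x + pd c (v a b) x
    - κ x * (p a x * v b c x + p b x * v c a x + p c x * v a b x)

/-- The components of `e^φ δ (e^{-φ} v)` where `dφ = κ p`. -/
def conjDiv (G : Fin n → Fin n → Pt n → ℝ) (κ : Pt n → ℝ) (p : Fin n → Pt n → ℝ)
    (v : Fin n → Fin n → Pt n → ℝ) (b : Fin n) (x : Pt n) : ℝ :=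
  ∑ a, ∑ e, G a e x * (pd e (v a b) x - κ x * (p e x * v a b x))

/-- Pointwise squared norm of the pair formed by `conjD` and `conjDiv`. -/
def conjSq (G : Fin n → Fin n → Pt n → ℝ) (κ : Pt n → ℝ) (p : Fin n → Pt n → ℝ)
    (v : Fin n → Fin n → Pt n → ℝ) (x : Pt n) : ℝ :=
  (∑ a, ∑ b, ∑ c, conjD κ p v a b c x ^ 2) + ∑ b, conjDiv G κ p v b x ^ 2

lemma normSq_nonneg (v : Fin n → Fin n → Pt n → ℝ) (x : Pt n) : 0 ≤ normSq v x := by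
  unfold normSq; positivity

lemma gradSq_nonneg (v : Fin n → Fin n → Pt n → ℝ) (x : Pt n) : 0 ≤ gradSq v x := by
  unfold gradSq; positivity

lemma conjSq_nonneg (G : Fin n → Fin n → Pt n → ℝ) (κ : Pt n → ℝ) (p : Fin n → Pt n → ℝ)
    (v : Fin n → Fin n → Pt n → ℝ) (x : Pt n) : 0 ≤ conjSq G κ p v x := by
  unfold conjSq; positivity

lemma abs_le_sqrt_normSq (v : Fin n → Fin n → Pt n → ℝ) (x : Pt n) (b c : Fin n) :
    |v b c x| ≤ √(normSq v x) := by
  refine Real.abs_le_sqrt ?_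
  unfold normSq
  exact (Finset.single_le_sum (f := fun c => v b c x ^ 2) (fun _ _ => sq_nonneg _)
    (Finset.mem_univ c)).trans (Finset.single_le_sum (f := fun b => ∑ c, v b c x ^ 2)
      (fun _ _ => by positivity) (Finset.mem_univ b))

lemma abs_pd_le_sqrt_gradSq (v : Fin n → Fin n → Pt n → ℝ) (x : Pt n) (e b c : Fin n) :
    |pd e (v b c) x| ≤ √(gradSq v x) := by
  refine Real.abs_le_sqrt ?_
  unfold gradSq
  exact ((Finset.single_le_sum (f := fun c => pd e (v b c) x ^ 2) (fun _ _ => sq_nonneg _)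
    (Finset.mem_univ c)).trans (Finset.single_le_sum (f := fun b => ∑ c, pd e (v b c) x ^ 2)
      (fun _ _ => by positivity) (Finset.mem_univ b))).trans
      (Finset.single_le_sum (f := fun e => ∑ b, ∑ c, pd e (v b c) x ^ 2)
      (fun _ _ => by positivity) (Finset.mem_univ e))

lemma abs_conjD_le (G : Fin n → Fin n → Pt n → ℝ) (κ : Pt n → ℝ) (p : Fin n → Pt n → ℝ)
    (v : Fin n → Fin n → Pt n → ℝ) (a b c : Fin n) (x : Pt n) :
    |conjD κ p v a b c x| ≤ √(conjSq G κ p v x) := by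
  refine Real.abs_le_sqrt ?_
  unfold conjSq
  refine le_trans ?_ (le_add_of_nonneg_right (by positivity))
  exact ((Finset.single_le_sum (f := fun c => conjD κ p v a b c x ^ 2) (fun _ _ => sq_nonneg _)
    (Finset.mem_univ c)).trans (Finset.single_le_sum (f := fun b => ∑ c, conjD κ p v a b c x ^ 2)
      (fun _ _ => by positivity) (Finset.mem_univ b))).trans
      (Finset.single_le_sum (f := fun a => ∑ b, ∑ c, conjD κ p v a b c x ^ 2)
      (fun _ _ => by positivity) (Finset.mem_univ a))

lemma abs_conjDiv_le (G : Fin n → Fin n → Pt n → ℝ) (κ : Pt n → ℝ) (p : Fin n → Pt n → ℝ)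
    (v : Fin n → Fin n → Pt n → ℝ) (b : Fin n) (x : Pt n) :
    |conjDiv G κ p v b x| ≤ √(conjSq G κ p v x) := by
  refine Real.abs_le_sqrt ?_
  unfold conjSq
  refine le_trans ?_ (le_add_of_nonneg_left (by positivity))
  exact Finset.single_le_sum (f := fun b => conjDiv G κ p v b x ^ 2) (fun _ _ => sq_nonneg _)
    (Finset.mem_univ b)

/-- An antisymmetric two-index family of `C¹` functions supported in `B`. -/
structure IsTwoFormOn (B : Set (Pt n)) (v : Fin n → Fin n → Pt n → ℝ) : Prop where
  contDiff : ∀ b c, ContDiff ℝ 1 (v b c)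
  supp : ∀ b c, tsupport (v b c) ⊆ B
  antisymm : ∀ b c x, v b c x = -v c b x

namespace IsTwoFormOn

variable {B : Set (Pt n)} {v : Fin n → Fin n → Pt n → ℝ}

lemma eq_zero (hv : IsTwoFormOn B v) {x : Pt n} (hx : x ∉ B) (b c : Fin n) : v b c x = 0 :=
  image_eq_zero_of_notMem_tsupport fun h => hx (hv.supp b c h)

lemma pd_eq_zero (hv : IsTwoFormOn B v) {x : Pt n} (hx : x ∉ B) (e b c : Fin n) :
    pd e (v b c) x = 0 := by
  have : x ∉ tsupport (fderiv ℝ (v b c)) :=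
    fun h => hx (hv.supp b c (tsupport_fderiv_subset ℝ h))
  simp [pd, image_eq_zero_of_notMem_tsupport this]

lemma hasCompactSupport (hv : IsTwoFormOn B v) (hB : IsCompact B) (b c : Fin n) :
    HasCompactSupport (v b c) :=
  hB.of_isClosed_subset (isClosed_tsupport _) (hv.supp b c)

lemma pd_antisymm (hv : IsTwoFormOn B v) (e b c : Fin n) (x : Pt n) :
    pd e (v b c) x = -pd e (v c b) x := by
  have : v b c = fun y => -v c b y := funext fun y => hv.antisymm b c y
  simp [pd, this]

lemma continuous_normSq (hv : IsTwoFormOn B v) : Continuous (normSq v) := by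
  have := fun b c => (hv.contDiff b c).continuous
  unfold normSq
  fun_prop

lemma continuous_gradSq (hv : IsTwoFormOn B v) : Continuous (gradSq v) := by
  have := fun e b c => continuous_pd (hv.contDiff b c) e
  unfold gradSq
  fun_prop

lemma continuous_conjSq (hv : IsTwoFormOn B v) {G : Fin n → Fin n → Pt n → ℝ} {κ : Pt n → ℝ}
    {p : Fin n → Pt n → ℝ} (hG : ∀ a b, Continuous (G a b)) (hκ : Continuous κ)
    (hp : ∀ a, Continuous (p a)) : Continuous (conjSq G κ p v) := by
  have h1 := fun b c => (hv.contDiff b c).continuous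
  have h2 := fun e b c => continuous_pd (hv.contDiff b c) e
  unfold conjSq conjD conjDiv
  fun_prop

lemma normSq_eq_zero (hv : IsTwoFormOn B v) {x : Pt n} (hx : x ∉ B) : normSq v x = 0 := by
  simp [normSq, hv.eq_zero hx]

lemma gradSq_eq_zero (hv : IsTwoFormOn B v) {x : Pt n} (hx : x ∉ B) : gradSq v x = 0 := by
  simp [gradSq, hv.pd_eq_zero hx]

lemma conjSq_eq_zero (hv : IsTwoFormOn B v) (G : Fin n → Fin n → Pt n → ℝ) (κ : Pt n → ℝ)
    (p : Fin n → Pt n → ℝ) {x : Pt n} (hx : x ∉ B) : conjSq G κ p v x = 0 := by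
  simp [conjSq, conjD, conjDiv, hv.pd_eq_zero hx, hv.eq_zero hx]

lemma integrable_normSq (hv : IsTwoFormOn B v) (hB : IsCompact B) : Integrable (normSq v) :=
  integrable_of_forall_notMem_eq_zero hB hv.continuous_normSq fun _ => hv.normSq_eq_zero

lemma integrable_gradSq (hv : IsTwoFormOn B v) (hB : IsCompact B) : Integrable (gradSq v) :=
  integrable_of_forall_notMem_eq_zero hB hv.continuous_gradSq fun _ => hv.gradSq_eq_zero

lemma integrable_conjSq (hv : IsTwoFormOn B v) (hB : IsCompact B)
    {G : Fin n → Fin n → Pt n → ℝ} {κ : Pt n → ℝ}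
    {p : Fin n → Pt n → ℝ} (hG : ∀ a b, Continuous (G a b)) (hκ : Continuous κ)
    (hp : ∀ a, Continuous (p a)) : Integrable (conjSq G κ p v) :=
  integrable_of_forall_notMem_eq_zero hB (hv.continuous_conjSq hG hκ hp)
    fun _ => hv.conjSq_eq_zero G κ p

lemma integrable_sqrt_mul_sqrt (hv : IsTwoFormOn B v) (hB : IsCompact B) :
    Integrable fun x => √(normSq v x) * √(gradSq v x) := by
  refine integrable_of_forall_notMem_eq_zero hB ?_ fun x hx => by simp [hv.normSq_eq_zero hx]
  exact hv.continuous_normSq.sqrt.mul hv.continuous_gradSq.sqrt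

lemma integrable_null (hv : IsTwoFormOn B v) (hB : IsCompact B) {m : Pt n → ℝ}
    (hm : Continuous m) (a b i j k l : Fin n) :
    Integrable fun x => m x * (pd a (v i j) x * pd b (v k l) x
      - pd b (v i j) x * pd a (v k l) x) := by
  refine integrable_of_forall_notMem_eq_zero hB ?_ fun x hx => by simp [hv.pd_eq_zero hx]
  have := fun e b c => continuous_pd (hv.contDiff b c) e
  fun_prop

lemma abs_integral_null_le (hv : IsTwoFormOn B v) (hB : IsCompact B) {m : Pt n → ℝ}
    (hm : ContDiff ℝ 1 m) {K : ℝ} (hK : ∀ x ∈ B, ∀ c, |pd c m x| ≤ K) (a b i j k l : Fin n) :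
    |∫ x, m x * (pd a (v i j) x * pd b (v k l) x - pd b (v i j) x * pd a (v k l) x)| ≤
      2 * K * ∫ x, √(normSq v x) * √(gradSq v x) := by
  rw [integral_mul_pd_mul_pd_sub hm (hv.contDiff i j) (hv.hasCompactSupport hB i j)
    (hv.contDiff k l) (hv.hasCompactSupport hB k l), ← integral_const_mul, ← Real.norm_eq_abs]
  refine norm_integral_le_of_norm_le ((hv.integrable_sqrt_mul_sqrt hB).const_mul _)
    (Filter.Eventually.of_forall fun x => ?_)
  by_cases hx : x ∈ B
  · have h1 := abs_le_sqrt_normSq v x k l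
    have h2 := abs_pd_le_sqrt_gradSq v x a i j
    have h3 := abs_pd_le_sqrt_gradSq v x b i j
    have hK0 : 0 ≤ K := (abs_nonneg _).trans (hK x hx a)
    rw [norm_mul, Real.norm_eq_abs, Real.norm_eq_abs]
    have h4 : |pd a m x * pd b (v i j) x - pd b m x * pd a (v i j) x| ≤
        2 * K * √(gradSq v x) := by
      calc _ ≤ |pd a m x| * |pd b (v i j) x| + |pd b m x| * |pd a (v i j) x| := by
            rw [← abs_mul, ← abs_mul]; exact abs_sub _ _
        _ ≤ K * √(gradSq v x) + K * √(gradSq v x) := by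
            gcongr <;> exact hK x hx _
        _ = _ := by ring
    calc _ ≤ √(normSq v x) * (2 * K * √(gradSq v x)) := by gcongr
      _ = _ := by ring
  · simp [hv.eq_zero hx, hv.normSq_eq_zero hx]

end IsTwoFormOn

end GradientEstimate

section GradientEstimateTwo

open MeasureTheory

variable {n : ℕ}

/-- A symmetric `C¹` coefficient matrix with quantitative bounds on a set `B`. -/
structure IsEllipticOn (B : Set (Pt n)) (G : Fin n → Fin n → Pt n → ℝ) (l K : ℝ) : Prop where
  contDiff : ∀ a b, ContDiff ℝ 1 (G a b)
  symm : ∀ a b x, G a b x = G b a x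
  pos : 0 < l
  lower : ∀ x ∈ B, ∀ y : Fin n → ℝ, l * ∑ a, y a ^ 2 ≤ ∑ a, ∑ b, G a b x * (y a * y b)
  bound : ∀ x ∈ B, ∀ a b, |G a b x| ≤ K
  pd_bound : ∀ x ∈ B, ∀ a b c, |pd c (G a b) x| ≤ K

/-- The null-form remainder in the pointwise gradient identity. -/
def gradNull (G : Fin n → Fin n → Pt n → ℝ) (v : Fin n → Fin n → Pt n → ℝ) (b c : Fin n)
    (x : Pt n) : ℝ :=
  ∑ a, ∑ e, (G a e x * (pd e (v b c) x * pd b (v c a) x - pd b (v b c) x * pd e (v c a) x)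
    + G a e x * (pd e (v b c) x * pd c (v a b) x - pd c (v b c) x * pd e (v a b) x))

lemma IsTwoFormOn.sum_mul_pd_mul_pd {B : Set (Pt n)} {v : Fin n → Fin n → Pt n → ℝ}
    (hv : IsTwoFormOn B v)
    (G : Fin n → Fin n → Pt n → ℝ) (p : Fin n → Pt n → ℝ) (b c : Fin n) (x : Pt n) :
    ∑ a, ∑ e, G a e x * (pd a (v b c) x * pd e (v b c) x) =
      (∑ a, ∑ e, G a e x * (pd e (v b c) x * conjD 0 p v a b c x))
        + pd b (v b c) x * conjDiv G 0 p v c x - pd c (v b c) x * conjDiv G 0 p v b x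
        - gradNull G v b c x := by
  simp only [conjD, conjDiv, gradNull, Finset.mul_sum, ← Finset.sum_add_distrib,
    ← Finset.sum_sub_distrib, Pi.zero_apply, zero_mul, sub_zero]
  refine Finset.sum_congr rfl fun a _ => Finset.sum_congr rfl fun e _ => ?_
  rw [hv.pd_antisymm e c a]
  ring

lemma abs_integral_gradNull_le {B : Set (Pt n)} {v : Fin n → Fin n → Pt n → ℝ}
    (hv : IsTwoFormOn B v) (hB : IsCompact B) {G : Fin n → Fin n → Pt n → ℝ} {l K : ℝ}
    (hG : IsEllipticOn B G l K) (b c : Fin n) :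
    Integrable (gradNull G v b c) ∧
    -∫ x, gradNull G v b c x ≤ n * (n * (4 * K * ∫ x, √(normSq v x) * √(gradSq v x))) := by
  have hi1 := fun a e => hv.integrable_null hB (hG.contDiff a e).continuous e b b c c a
  have hi2 := fun a e => hv.integrable_null hB (hG.contDiff a e).continuous e c b c a b
  have hi3 := fun a e => (hi1 a e).fun_add (hi2 a e)
  have hi4 := fun a => integrable_finsetSum Finset.univ fun e _ => hi3 a e
  have hint : Integrable (gradNull G v b c) :=
    integrable_finsetSum Finset.univ fun a _ => hi4 a
  refine ⟨hint, ?_⟩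
  unfold gradNull
  rw [integral_finsetSum _ fun a _ => hi4 a, ← Finset.sum_neg_distrib]
  refine (sum_le_card_mul (M := n * (4 * K * ∫ x, √(normSq v x) * √(gradSq v x)))
    fun a => ?_).trans (by simp)
  rw [integral_finsetSum _ fun e _ => hi3 a e, ← Finset.sum_neg_distrib]
  refine (sum_le_card_mul (M := (4 * K * ∫ x, √(normSq v x) * √(gradSq v x)))
    fun e => ?_).trans (by simp)
  rw [integral_add (hi1 a e) (hi2 a e)]
  have h1 := (abs_le.1 (hv.abs_integral_null_le hB (hG.contDiff a e)
    (fun x hx d => hG.pd_bound x hx a e d) e b b c c a)).1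
  have h2 := (abs_le.1 (hv.abs_integral_null_le hB (hG.contDiff a e)
    (fun x hx d => hG.pd_bound x hx a e d) e c b c a b)).1
  linarith

lemma integrable_sqrt_gradSq_mul_sqrt_conjSq {B : Set (Pt n)} {v : Fin n → Fin n → Pt n → ℝ}
    (hv : IsTwoFormOn B v) (hB : IsCompact B) {G : Fin n → Fin n → Pt n → ℝ} {κ : Pt n → ℝ}
    {p : Fin n → Pt n → ℝ} (hG : ∀ a b, Continuous (G a b)) (hκ : Continuous κ)
    (hp : ∀ a, Continuous (p a)) :
    Integrable fun x => √(gradSq v x) * √(conjSq G κ p v x) := by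
  refine integrable_of_forall_notMem_eq_zero hB ?_ fun x hx => by simp [hv.gradSq_eq_zero hx]
  exact hv.continuous_gradSq.sqrt.mul (hv.continuous_conjSq hG hκ hp).sqrt

lemma IsEllipticOn.bound_nonneg [NeZero n] {B : Set (Pt n)} {G : Fin n → Fin n → Pt n → ℝ} {l K : ℝ}
    (hG : IsEllipticOn B G l K) {x : Pt n} (hx : x ∈ B) : 0 ≤ K :=
  (abs_nonneg _).trans (hG.bound x hx 0 0)

lemma integral_gradSq_le_aux [NeZero n] {B : Set (Pt n)} {v : Fin n → Fin n → Pt n → ℝ}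
    (hv : IsTwoFormOn B v) (hB : IsCompact B) {G : Fin n → Fin n → Pt n → ℝ} {l K : ℝ}
    (hG : IsEllipticOn B G l K) {p : Fin n → Pt n → ℝ} (hp : ∀ a, Continuous (p a)) :
    l * ∫ x, gradSq v x ≤
      n * (n * (((n * (n * K)) + 2) * ∫ x, √(gradSq v x) * √(conjSq G 0 p v x)))
      + n * (n * (n * (n * (4 * K * ∫ x, √(normSq v x) * √(gradSq v x))))) := by
  have hGc := fun a b => (hG.contDiff a b).continuous
  have hiφ := integrable_sqrt_gradSq_mul_sqrt_conjSq hv hB hGc continuous_zero hp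
  have hipd : ∀ a b c, Integrable fun x => pd a (v b c) x ^ 2 := fun a b c =>
    integrable_of_forall_notMem_eq_zero hB ((continuous_pd (hv.contDiff b c) a).pow 2)
      fun x hx => by simp [hv.pd_eq_zero hx]
  have hipd2 : ∀ b c, Integrable fun x => ∑ a, pd a (v b c) x ^ 2 := fun b c =>
    integrable_finsetSum _ fun a _ => hipd a b c
  have key : ∀ b c, l * ∫ x, ∑ a, pd a (v b c) x ^ 2 ≤
      ((n * (n * K)) + 2) * (∫ x, √(gradSq v x) * √(conjSq G 0 p v x))
      + n * (n * (4 * K * ∫ x, √(normSq v x) * √(gradSq v x))) := by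
    intro b c
    obtain ⟨hi, hle⟩ := abs_integral_gradNull_le hv hB hG b c
    refine le_trans ?_ (add_le_add_right hle _)
    rw [← integral_const_mul, ← integral_const_mul, ← integral_neg, ← integral_add
      (hiφ.const_mul _) (g := fun x => -gradNull G v b c x) hi.neg]
    refine integral_mono ((hipd2 b c).const_mul l) ((hiφ.const_mul _).add hi.neg) fun x => ?_
    by_cases hx : x ∈ B
    · have h1 := hG.lower x hx fun a => pd a (v b c) x
      rw [hv.sum_mul_pd_mul_pd G p] at h1
      have hK := hG.bound_nonneg hx
      have h2 : ∑ a, ∑ e, G a e x * (pd e (v b c) x * conjD 0 p v a b c x) ≤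
          n * (n * (K * (√(gradSq v x) * √(conjSq G 0 p v x)))) := by
        refine (sum_le_card_mul fun a => (sum_le_card_mul
          (M := K * (√(gradSq v x) * √(conjSq G 0 p v x))) fun e => ?_)).trans (by simp)
        refine (le_abs_self _).trans ?_
        rw [abs_mul, abs_mul]
        gcongr
        · exact hG.bound x hx a e
        · exact abs_pd_le_sqrt_gradSq v x e b c
        · exact abs_conjD_le G 0 p v a b c x
      have h3 : ∀ i j, |pd i (v b c) x * conjDiv G 0 p v j x| ≤
          √(gradSq v x) * √(conjSq G 0 p v x) := by
        intro i j
        rw [abs_mul]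
        gcongr
        · exact abs_pd_le_sqrt_gradSq v x _ b c
        · exact abs_conjDiv_le G 0 p v _ x
      have h4 := (abs_le.1 (h3 b c)).2
      have h5 := (abs_le.1 (h3 c b)).1
      show l * _ ≤ (n * (n * K) + 2) * _ + -_
      linarith
    · simp [hv.pd_eq_zero hx, hv.gradSq_eq_zero hx, gradNull]
  have hsum : ∫ x, gradSq v x = ∑ b, ∑ c, ∫ x, ∑ a, pd a (v b c) x ^ 2 := by
    simp_rw [← integral_finsetSum Finset.univ fun c _ => hipd2 _ c]
    rw [← integral_finsetSum Finset.univ fun b _ => integrable_finsetSum _ fun c _ => hipd2 b c]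
    congr 1
    funext x
    unfold gradSq
    rw [Finset.sum_comm]
    refine Finset.sum_congr rfl fun b _ => ?_
    rw [Finset.sum_comm]
  rw [hsum, Finset.mul_sum]
  simp_rw [Finset.mul_sum]
  refine (sum_le_card_mul fun b => (sum_le_card_mul fun c => key b c)).trans ?_
  simp only [Fintype.card_fin]
  apply le_of_eq
  ring

/-- Gårding-type inequality for two-forms: the full gradient is controlled by the exterior
derivative, the divergence and the form itself. -/
lemma exists_integral_gradSq_le [NeZero n] {B : Set (Pt n)} (hB : IsCompact B)
    {G : Fin n → Fin n → Pt n → ℝ} {l K : ℝ} (hG : IsEllipticOn B G l K) :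
    ∃ C, 0 ≤ C ∧ ∀ (p : Fin n → Pt n → ℝ), (∀ a, Continuous (p a)) →
      ∀ v, IsTwoFormOn B v →
      ∫ x, gradSq v x ≤ C * (∫ x, conjSq G 0 p v x) + C * ∫ x, normSq v x := by
  obtain ⟨C₁, hC₁⟩ : ∃ C : ℝ, C = n * (n * ((n * (n * K)) + 2)) := ⟨_, rfl⟩
  obtain ⟨C₂, hC₂⟩ : ∃ C : ℝ, C = n * (n * (n * (n * (4 * K)))) := ⟨_, rfl⟩
  have hl := hG.pos
  refine ⟨2 * (C₁ ^ 2 + C₂ ^ 2) / l ^ 2, by positivity, fun p hp v hv => ?_⟩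
  have h := integral_gradSq_le_aux hv hB hG hp
  have hGc := fun a b => (hG.contDiff a b).continuous
  have hiφ := integrable_sqrt_gradSq_mul_sqrt_conjSq hv hB hGc continuous_zero hp
  have hiν := hv.integrable_sqrt_mul_sqrt hB
  have hig := hv.integrable_gradSq hB
  have hic := hv.integrable_conjSq hB hGc continuous_zero hp
  have hin := hv.integrable_normSq hB
  have e1 : C₁ * ∫ x, √(gradSq v x) * √(conjSq G 0 p v x) ≤
      l / 4 * (∫ x, gradSq v x) + C₁ ^ 2 / l * ∫ x, conjSq G 0 p v x := by
    simp only [← integral_const_mul]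
    rw [← integral_add (hig.const_mul _) (hic.const_mul _)]
    refine integral_mono (hiφ.const_mul _) ((hig.const_mul _).add (hic.const_mul _)) fun x => ?_
    have s1 := Real.sq_sqrt (gradSq_nonneg v x)
    have s2 := Real.sq_sqrt (conjSq_nonneg G 0 p v x)
    have : l / 4 * gradSq v x + C₁ ^ 2 / l * conjSq G 0 p v x
      - C₁ * (√(gradSq v x) * √(conjSq G 0 p v x)) =
      l * (√(gradSq v x) / 2 - C₁ / l * √(conjSq G 0 p v x)) ^ 2 := by
      rw [← s1, ← s2]
      simp only [Real.sqrt_sq (Real.sqrt_nonneg _)]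
      field_simp
      ring
    have h0 : 0 ≤ l * (√(gradSq v x) / 2 - C₁ / l * √(conjSq G 0 p v x)) ^ 2 := by positivity
    show _ ≤ l / 4 * gradSq v x + C₁ ^ 2 / l * conjSq G 0 p v x
    linarith
  have e2 : C₂ * ∫ x, √(normSq v x) * √(gradSq v x) ≤
      l / 4 * (∫ x, gradSq v x) + C₂ ^ 2 / l * ∫ x, normSq v x := by
    simp only [← integral_const_mul]
    rw [← integral_add (hig.const_mul _) (hin.const_mul _)]
    refine integral_mono (hiν.const_mul _) ((hig.const_mul _).add (hin.const_mul _)) fun x => ?_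
    have s1 := Real.sq_sqrt (gradSq_nonneg v x)
    have s2 := Real.sq_sqrt (normSq_nonneg v x)
    have : l / 4 * gradSq v x + C₂ ^ 2 / l * normSq v x
      - C₂ * (√(normSq v x) * √(gradSq v x)) =
      l * (√(gradSq v x) / 2 - C₂ / l * √(normSq v x)) ^ 2 := by
      rw [← s1, ← s2]
      simp only [Real.sqrt_sq (Real.sqrt_nonneg _)]
      field_simp
      ring
    have h0 : 0 ≤ l * (√(gradSq v x) / 2 - C₂ / l * √(normSq v x)) ^ 2 := by positivity
    show _ ≤ l / 4 * gradSq v x + C₂ ^ 2 / l * normSq v x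
    linarith
  have h' : l / 2 * (∫ x, gradSq v x) ≤ C₁ ^ 2 / l * (∫ x, conjSq G 0 p v x)
      + C₂ ^ 2 / l * ∫ x, normSq v x := by
    rw [hC₁] at *
    rw [hC₂] at *
    linarith
  have n1 : 0 ≤ ∫ x, conjSq G 0 p v x := integral_nonneg fun x => conjSq_nonneg G 0 p v x
  have n2 : 0 ≤ ∫ x, normSq v x := integral_nonneg fun x => normSq_nonneg v x
  have h2 : ∫ x, gradSq v x ≤ 2 * C₁ ^ 2 / l ^ 2 * (∫ x, conjSq G 0 p v x)
      + 2 * C₂ ^ 2 / l ^ 2 * ∫ x, normSq v x := by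
    have := mul_le_mul_of_nonneg_left h' (show 0 ≤ 2 / l by positivity)
    calc _ = 2 / l * (l / 2 * (∫ x, gradSq v x)) := by field_simp
      _ ≤ _ := this
      _ = _ := by ring
  refine h2.trans ?_
  gcongr
  · nlinarith [sq_nonneg C₂]
  · nlinarith [sq_nonneg C₁]

lemma conjSq_zero_le {B : Set (Pt n)} {G : Fin n → Fin n → Pt n → ℝ} {l K : ℝ}
    (hG : IsEllipticOn B G l K) {p : Fin n → Pt n → ℝ} (hp : ∀ x ∈ B, ∀ a, |p a x| ≤ K)
    (κ : Pt n → ℝ) (v : Fin n → Fin n → Pt n → ℝ) {x : Pt n} (hx : x ∈ B) :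
    conjSq G 0 p v x ≤ 2 * conjSq G κ p v x
      + (n * (n * (n * (18 * K ^ 2))) + n * (2 * (n * (n * K ^ 2)) ^ 2)) *
        (κ x ^ 2 * normSq v x) := by
  have s2 := Real.sq_sqrt (normSq_nonneg v x)
  have hpv : ∀ a b c, |p a x * v b c x| ≤ K * √(normSq v x) := fun a b c => by
    rw [abs_mul]
    gcongr
    · exact (abs_nonneg _).trans (hp x hx a)
    · exact hp x hx a
    · exact abs_le_sqrt_normSq v x b c
  have h1 : ∀ a b c, conjD 0 p v a b c x ^ 2 ≤ 2 * conjD κ p v a b c x ^ 2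
      + 18 * K ^ 2 * (κ x ^ 2 * normSq v x) := by
    intro a b c
    have e : conjD 0 p v a b c x = conjD κ p v a b c x
      + κ x * (p a x * v b c x + p b x * v c a x + p c x * v a b x) := by
      simp [conjD]
    have hb : (p a x * v b c x + p b x * v c a x + p c x * v a b x) ^ 2 ≤
        (3 * (K * √(normSq v x))) ^ 2 := by
      refine sq_le_sq' ?_ ?_
      · linarith [(abs_le.1 (hpv a b c)).1, (abs_le.1 (hpv b c a)).1, (abs_le.1 (hpv c a b)).1]
      · linarith [(abs_le.1 (hpv a b c)).2, (abs_le.1 (hpv b c a)).2, (abs_le.1 (hpv c a b)).2]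
    have hb2 := mul_le_mul_of_nonneg_left hb (sq_nonneg (κ x))
    have hb3 : κ x ^ 2 * (3 * (K * √(normSq v x))) ^ 2 = 9 * K ^ 2 * (κ x ^ 2 * normSq v x) := by
      rw [← s2, Real.sqrt_sq (Real.sqrt_nonneg _)]; ring
    rw [e]
    nlinarith [sq_nonneg (conjD κ p v a b c x
      - κ x * (p a x * v b c x + p b x * v c a x + p c x * v a b x))]
  have h2 : ∀ b, conjDiv G 0 p v b x ^ 2 ≤ 2 * conjDiv G κ p v b x ^ 2
      + 2 * (n * (n * K ^ 2)) ^ 2 * (κ x ^ 2 * normSq v x) := by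
    intro b
    have e : conjDiv G 0 p v b x = conjDiv G κ p v b x
      + κ x * (∑ a, ∑ e, G a e x * (p e x * v a b x)) := by
      simp only [conjDiv, Finset.mul_sum, ← Finset.sum_add_distrib, Pi.zero_apply]
      iterate 2 refine Finset.sum_congr rfl fun _ _ => ?_
      ring
    have hb0 : |∑ a, ∑ e, G a e x * (p e x * v a b x)| ≤ n * (n * K ^ 2) * √(normSq v x) := by
      refine (Finset.abs_sum_le_sum_abs _ _).trans ?_
      refine (sum_le_card_mul fun a => ((Finset.abs_sum_le_sum_abs _ _).trans
        (sum_le_card_mul (M := K * (K * √(normSq v x))) fun e => ?_))).trans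
        (by simp only [Fintype.card_fin]; apply le_of_eq; ring)
      rw [abs_mul]
      gcongr
      · exact (abs_nonneg _).trans (hp x hx a)
      · exact hG.bound x hx a e
      · exact hpv e a b
    have hb := sq_le_sq' (abs_le.1 hb0).1 (abs_le.1 hb0).2
    have hb2 := mul_le_mul_of_nonneg_left hb (sq_nonneg (κ x))
    have hb3 : κ x ^ 2 * (n * (n * K ^ 2) * √(normSq v x)) ^ 2 =
        (n * (n * K ^ 2)) ^ 2 * (κ x ^ 2 * normSq v x) := by
      rw [mul_pow _ (√_), s2]; ring
    rw [e]
    nlinarith [sq_nonneg (conjDiv G κ p v b x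
      - κ x * (∑ a, ∑ e, G a e x * (p e x * v a b x)))]
  have s1 : ∑ a, ∑ b, ∑ c, conjD 0 p v a b c x ^ 2 ≤ 2 * (∑ a, ∑ b, ∑ c, conjD κ p v a b c x ^ 2)
      + n * (n * (n * (18 * K ^ 2 * (κ x ^ 2 * normSq v x)))) := by
    refine (Finset.sum_le_sum fun a _ => Finset.sum_le_sum fun b _ => Finset.sum_le_sum
      fun c _ => h1 a b c).trans (le_of_eq ?_)
    simp [Finset.sum_add_distrib, Finset.mul_sum]
  have s3 : ∑ b, conjDiv G 0 p v b x ^ 2 ≤ 2 * (∑ b, conjDiv G κ p v b x ^ 2)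
      + n * (2 * (n * (n * K ^ 2)) ^ 2 * (κ x ^ 2 * normSq v x)) := by
    refine (Finset.sum_le_sum fun b _ => h2 b).trans (le_of_eq ?_)
    simp [Finset.sum_add_distrib, Finset.mul_sum]
  simp only [conjSq] at *
  linarith

end GradientEstimateTwo

section Carleman

open MeasureTheory

variable {n : ℕ}

lemma exists_forall_abs_le {ι : Type*} [Fintype ι] {B : Set (Pt n)} (hB : IsCompact B)
    {f : ι → Pt n → ℝ} (hf : ∀ i, Continuous (f i)) :
    ∃ K, 0 ≤ K ∧ ∀ x ∈ B, ∀ i, |f i x| ≤ K := by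
  obtain ⟨K, hK⟩ := hB.exists_bound_of_continuousOn (f := fun x i => f i x)
    (continuous_pi hf).continuousOn
  exact ⟨max K 0, le_max_right _ _, fun x hx i =>
    ((norm_le_pi_norm (fun i => f i x) i).trans (hK x hx)).trans (le_max_left _ _)⟩

lemma IsTwoFormOn.abs_integral_sum_null_le {ι : Type*} [Fintype ι] {B : Set (Pt n)}
    {v : Fin n → Fin n → Pt n → ℝ} (hv : IsTwoFormOn B v) (hB : IsCompact B)
    {m : ι → Pt n → ℝ} (hm : ∀ i, ContDiff ℝ 1 (m i)) {K : ℝ}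
    (hK : ∀ i, ∀ x ∈ B, ∀ c, |pd c (m i) x| ≤ K) (a b i j k l : ι → Fin n) :
    (Integrable fun x => ∑ t, m t x * (pd (a t) (v (i t) (j t)) x * pd (b t) (v (k t) (l t)) x
      - pd (b t) (v (i t) (j t)) x * pd (a t) (v (k t) (l t)) x)) ∧
    |∫ x, ∑ t, m t x * (pd (a t) (v (i t) (j t)) x * pd (b t) (v (k t) (l t)) x
      - pd (b t) (v (i t) (j t)) x * pd (a t) (v (k t) (l t)) x)| ≤
      Fintype.card ι * (2 * K * ∫ x, √(normSq v x) * √(gradSq v x)) := by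
  have hi := fun t => hv.integrable_null hB (hm t).continuous (a t) (b t) (i t) (j t) (k t) (l t)
  refine ⟨integrable_finsetSum _ fun t _ => hi t, ?_⟩
  rw [integral_finsetSum _ fun t _ => hi t]
  refine (Finset.abs_sum_le_sum_abs _ _).trans (sum_le_card_mul fun t => ?_)
  exact hv.abs_integral_null_le hB (hm t) (hK t) _ _ _ _ _ _

lemma IsTwoFormOn.integral_sum_mul_pd_mul_add {ι : Type*} [Fintype ι] {B : Set (Pt n)}
    {v : Fin n → Fin n → Pt n → ℝ} (hv : IsTwoFormOn B v) (hB : IsCompact B)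
    {m : ι → Pt n → ℝ} (hm : ∀ i, ContDiff ℝ 1 (m i)) (d i j k l : ι → Fin n) :
    ∫ x, ∑ t, m t x * (pd (d t) (v (i t) (j t)) x * v (k t) (l t) x
      + v (i t) (j t) x * pd (d t) (v (k t) (l t)) x) =
    -∫ x, ∑ t, pd (d t) (m t) x * (v (i t) (j t) x * v (k t) (l t) x) := by
  have h1 := fun b c => (hv.contDiff b c).continuous
  have h2 := fun e b c => continuous_pd (hv.contDiff b c) e
  have h3 := fun t e => continuous_pd (hm t) e
  have h4 := fun t => (hm t).continuous
  rw [integral_finsetSum, integral_finsetSum, ← Finset.sum_neg_distrib]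
  · exact Finset.sum_congr rfl fun t _ => integral_mul_pd_mul_add (hm t) (hv.contDiff _ _)
      (hv.hasCompactSupport hB _ _) (hv.contDiff _ _) (d t)
  · exact fun t _ => integrable_of_forall_notMem_eq_zero hB (by fun_prop)
      fun x hx => by simp [hv.eq_zero hx]
  · exact fun t _ => integrable_of_forall_notMem_eq_zero hB (by fun_prop)
      fun x hx => by simp [hv.eq_zero hx]

/-- The raised covector `N^a = G^{ab} p_b`. -/
def raise (G : Fin n → Fin n → Pt n → ℝ) (p : Fin n → Pt n → ℝ) (a : Fin n) (x : Pt n) : ℝ :=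
  ∑ b, G a b x * p b x

/-- The squared length `G^{ab} p_a p_b`. -/
def lenSq (G : Fin n → Fin n → Pt n → ℝ) (p : Fin n → Pt n → ℝ) (x : Pt n) : ℝ :=
  ∑ a, raise G p a x * p a x

/-- Pairing of the directional derivative `N v` with `v`. -/
def diracX (G : Fin n → Fin n → Pt n → ℝ) (p : Fin n → Pt n → ℝ)
    (v : Fin n → Fin n → Pt n → ℝ) (x : Pt n) (b c : Fin n) : ℝ :=
  ∑ d, raise G p d x * pd d (v b c) x

/-- The skew first-order part of the Clifford square. -/
def diracA (G : Fin n → Fin n → Pt n → ℝ) (p : Fin n → Pt n → ℝ)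
    (v : Fin n → Fin n → Pt n → ℝ) (x : Pt n) (b c : Fin n) : ℝ :=
  -(∑ a, raise G p a x * (pd b (v c a) x + pd c (v a b) x))
    - p b x * (∑ a, ∑ e, G a e x * pd e (v a c) x)
    + p c x * (∑ a, ∑ e, G a e x * pd e (v a b) x)

/-- The Clifford product of `p` with the pair `(conjD, conjDiv)`. -/
def diracS (G : Fin n → Fin n → Pt n → ℝ) (κ : Pt n → ℝ) (p : Fin n → Pt n → ℝ)
    (v : Fin n → Fin n → Pt n → ℝ) (x : Pt n) (b c : Fin n) : ℝ :=
  (∑ a, raise G p a x * conjD κ p v a b c x) + p b x * conjDiv G κ p v c x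
    - p c x * conjDiv G κ p v b x

lemma diracS_eq (G : Fin n → Fin n → Pt n → ℝ) (κ : Pt n → ℝ) (p : Fin n → Pt n → ℝ)
    {v : Fin n → Fin n → Pt n → ℝ} (hv : ∀ b c x, v b c x = -v c b x) (x : Pt n) (b c : Fin n) :
    diracS G κ p v x b c = diracX G p v x b c
      + (-1) * (diracA G p v x b c + (κ x * lenSq G p x) * v b c x) := by
  have h1 : ∀ c, conjDiv G κ p v c x = (∑ a, ∑ e, G a e x * pd e (v a c) x)
      - κ x * ∑ a, raise G p a x * v a c x := by
    intro c
    simp only [conjDiv, raise, Finset.mul_sum, Finset.sum_mul, ← Finset.sum_sub_distrib]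
    iterate 2 refine Finset.sum_congr rfl fun _ _ => ?_
    ring
  have h2 : ∑ a, raise G p a x * conjD κ p v a b c x = diracX G p v x b c
      + (∑ a, raise G p a x * (pd b (v c a) x + pd c (v a b) x))
      - κ x * (lenSq G p x * v b c x + p b x * (∑ a, raise G p a x * v c a x)
        + p c x * ∑ a, raise G p a x * v a b x) := by
    simp only [conjD, diracX, lenSq, Finset.mul_sum, Finset.sum_mul, ← Finset.sum_sub_distrib,
      ← Finset.sum_add_distrib]
    refine Finset.sum_congr rfl fun _ _ => ?_
    ring
  have h3 : ∑ a, raise G p a x * v c a x = -∑ a, raise G p a x * v a c x := by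
    rw [← Finset.sum_neg_distrib]
    refine Finset.sum_congr rfl fun a _ => ?_
    rw [hv c a]; ring
  unfold diracS diracA
  rw [h1, h1, h2, h3]
  ring

end Carleman

section CarlemanTwo

open MeasureTheory

variable {n : ℕ}

lemma abs_matPair_le {G : Fin n → Fin n → ℝ} {X Y : Fin n → Fin n → ℝ} {K M M' : ℝ}
    (hG : ∀ a b, |G a b| ≤ K) (hX : ∀ a b, |X a b| ≤ M) (hY : ∀ a b, |Y a b| ≤ M') :
    |matPair G X Y| ≤ n * (n * (n * (n * (K * K * (M * M'))))) := by
  unfold matPair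
  refine (Finset.abs_sum_le_sum_abs _ _).trans ((sum_le_card_mul fun b => ?_).trans
    (by rw [Fintype.card_fin]))
  refine (Finset.abs_sum_le_sum_abs _ _).trans ((sum_le_card_mul fun b' => ?_).trans
    (by rw [Fintype.card_fin]))
  refine (Finset.abs_sum_le_sum_abs _ _).trans ((sum_le_card_mul fun c => ?_).trans
    (by rw [Fintype.card_fin]))
  refine (Finset.abs_sum_le_sum_abs _ _).trans ((sum_le_card_mul fun c' => ?_).trans
    (by rw [Fintype.card_fin]))
  have hK := (abs_nonneg _).trans (hG b b')
  have hM := (abs_nonneg _).trans (hX b b')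
  rw [abs_mul, abs_mul, abs_mul]
  gcongr
  · exact hG b b'
  · exact hG c c'
  · exact hX b c
  · exact hY b' c'

/-- Coefficients of the null form in `matPair_dirac`. -/
def diracNullCoeff (G : Fin n → Fin n → Pt n → ℝ) (p : Fin n → Pt n → ℝ)
    (t : Fin n × Fin n × Fin n × Fin n × Fin n × Fin n) (x : Pt n) : ℝ :=
  G t.1 t.2.1 x * G t.2.2.1 t.2.2.2.1 x * raise G p t.2.2.2.2.1 x * raise G p t.2.2.2.2.2 x

/-- Coefficients of the quadratic form obtained from the zeroth-order part of the weight. -/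
def diracDivCoeff (G : Fin n → Fin n → Pt n → ℝ) (p : Fin n → Pt n → ℝ)
    (t : Fin n × Fin n × Fin n × Fin n × Fin n) (x : Pt n) : ℝ :=
  lenSq G p x * (G t.1 t.2.1 x * G t.2.2.1 t.2.2.2.1 x * raise G p t.2.2.2.2 x)

/-- Bounds for the coefficients entering the Carleman estimate. -/
structure WeightBounds (B : Set (Pt n)) (G : Fin n → Fin n → Pt n → ℝ) (p : Fin n → Pt n → ℝ)
    (K c : ℝ) : Prop where
  contDiff : ∀ a, ContDiff ℝ 1 (p a)
  bound : ∀ x ∈ B, ∀ a, |p a x| ≤ K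
  raise_bound : ∀ x ∈ B, ∀ a, |raise G p a x| ≤ K
  null_bound : ∀ t, ∀ x ∈ B, ∀ e, |pd e (diracNullCoeff G p t) x| ≤ K
  div_bound : ∀ t, ∀ x ∈ B, ∀ e, |pd e (diracDivCoeff G p t) x| ≤ K
  pos : 0 < c
  lower : ∀ x ∈ B, c ≤ lenSq G p x

section

variable {B : Set (Pt n)} {G : Fin n → Fin n → Pt n → ℝ} {p : Fin n → Pt n → ℝ} {l K c : ℝ}
  {v : Fin n → Fin n → Pt n → ℝ}

lemma IsEllipticOn.contDiff_raise (hG : IsEllipticOn B G l K) (hp : ∀ a, ContDiff ℝ 1 (p a))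
    (a : Fin n) : ContDiff ℝ 1 (raise G p a) :=
  ContDiff.sum fun b _ => (hG.contDiff a b).mul (hp b)

lemma IsEllipticOn.contDiff_lenSq (hG : IsEllipticOn B G l K) (hp : ∀ a, ContDiff ℝ 1 (p a)) :
    ContDiff ℝ 1 (lenSq G p) :=
  ContDiff.sum fun a _ => (hG.contDiff_raise hp a).mul (hp a)

lemma IsEllipticOn.contDiff_diracNullCoeff (hG : IsEllipticOn B G l K)
    (hp : ∀ a, ContDiff ℝ 1 (p a)) (t : Fin n × Fin n × Fin n × Fin n × Fin n × Fin n) :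
    ContDiff ℝ 1 (diracNullCoeff G p t) :=
  (((hG.contDiff _ _).mul (hG.contDiff _ _)).mul (hG.contDiff_raise hp _)).mul
    (hG.contDiff_raise hp _)

lemma IsEllipticOn.contDiff_diracDivCoeff (hG : IsEllipticOn B G l K)
    (hp : ∀ a, ContDiff ℝ 1 (p a)) (t : Fin n × Fin n × Fin n × Fin n × Fin n) :
    ContDiff ℝ 1 (diracDivCoeff G p t) :=
  (hG.contDiff_lenSq hp).mul
    (((hG.contDiff _ _).mul (hG.contDiff _ _)).mul (hG.contDiff_raise hp _))

lemma abs_diracS_le (hw : WeightBounds B G p K c) (κ : Pt n → ℝ) {x : Pt n} (hx : x ∈ B)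
    (b d : Fin n) : |diracS G κ p v x b d| ≤ (n + 2) * K * √(conjSq G κ p v x) := by
  have hK : 0 ≤ K := (abs_nonneg _).trans (hw.bound x hx b)
  have h1 : |∑ a, raise G p a x * conjD κ p v a b d x| ≤ n * (K * √(conjSq G κ p v x)) := by
    refine (Finset.abs_sum_le_sum_abs _ _).trans ((sum_le_card_mul fun a => ?_).trans
      (by rw [Fintype.card_fin]))
    rw [abs_mul]
    gcongr
    · exact hw.raise_bound x hx a
    · exact abs_conjD_le G κ p v a b d x
  have h2 : ∀ i j, |p i x * conjDiv G κ p v j x| ≤ K * √(conjSq G κ p v x) := fun i j => by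
    rw [abs_mul]
    gcongr
    · exact hw.bound x hx i
    · exact abs_conjDiv_le G κ p v j x
  unfold diracS
  have h3 := abs_le.1 h1
  have h4 := abs_le.1 (h2 b d)
  have h5 := abs_le.1 (h2 d b)
  refine abs_le.2 ⟨?_, ?_⟩ <;> linarith

lemma matPair_self_nonneg (hG : IsEllipticOn B G l K) {x : Pt n} (hx : x ∈ B)
    (X : Fin n → Fin n → ℝ) : l ^ 2 * (∑ b, ∑ c, X b c ^ 2) ≤ matPair (fun a b => G a b x) X X :=
  sum_sq_le_matPair (fun a b => hG.symm a b x) hG.pos.le (hG.lower x hx) X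

lemma neg_four_mul_matPair_le (hG : IsEllipticOn B G l K) (hw : WeightBounds B G p K c)
    (hv : IsTwoFormOn B v) (κ : Pt n → ℝ) {x : Pt n} (hx : x ∈ B) :
    -4 * matPair (fun a b => G a b x) (diracX G p v x) (diracA G p v x)
      - 4 * (κ x * lenSq G p x * matPair (fun a b => G a b x) (diracX G p v x)
          (fun b c => v b c x)) ≤
      n ^ 4 * K ^ 2 * ((n + 2) * K) ^ 2 * conjSq G κ p v x := by
  have hs : ∀ a b, (fun a b => G a b x) a b = (fun a b => G a b x) b a :=
    fun a b => hG.symm a b x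
  have h1 := (le_abs_self _).trans (abs_matPair_le (fun a b => hG.bound x hx a b)
    (abs_diracS_le (v := v) hw κ hx) (abs_diracS_le (v := v) hw κ hx))
  have s2 := Real.mul_self_sqrt (conjSq_nonneg G κ p v x)
  have h2 : (n : ℝ) * (n * (n * (n * (K * K * ((n + 2) * K * √(conjSq G κ p v x) *
      ((n + 2) * K * √(conjSq G κ p v x))))))) =
      n ^ 4 * K ^ 2 * ((n + 2) * K) ^ 2 * conjSq G κ p v x := by
    rw [← s2, ← s2]; simp only [Real.sqrt_mul_self (Real.sqrt_nonneg _)]; ring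
  rw [h2] at h1
  refine le_trans ?_ h1
  obtain ⟨Y, hY⟩ : ∃ Y : Fin n → Fin n → ℝ, Y = fun b c =>
    diracA G p v x b c + (κ x * lenSq G p x) * v b c x := ⟨_, rfl⟩
  have hS : diracS G κ p v x = fun b c => diracX G p v x b c + (-1) * Y b c :=
    by
    rw [hY]; exact funext fun b => funext fun c => diracS_eq G κ p hv.antisymm x b c
  have h0 := (by positivity : (0 : ℝ) ≤ l ^ 2 * ∑ b, ∑ c, (diracX G p v x b c + Y b c) ^ 2).trans
    (matPair_self_nonneg hG hx fun b c => diracX G p v x b c + Y b c)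
  have hXY : matPair (fun a b => G a b x) (diracX G p v x) Y =
      matPair (fun a b => G a b x) (diracX G p v x) (diracA G p v x) +
      κ x * lenSq G p x * matPair (fun a b => G a b x) (diracX G p v x) (fun b c => v b c x) := by
    rw [hY, matPair_add_right hs, matPair_smul_right hs]
  rw [hS]
  rw [matPair_add_left, matPair_add_right hs, matPair_add_right hs,
    matPair_comm hs Y (diracX G p v x)] at h0
  rw [matPair_add_left, matPair_add_right hs, matPair_add_right hs,
    matPair_smul_left, matPair_smul_left, matPair_smul_right hs, matPair_smul_right hs,
    matPair_comm hs Y (diracX G p v x)]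
  linarith

lemma abs_integral_matPair_dirac_le (hG : IsEllipticOn B G l K) (hw : WeightBounds B G p K c)
    (hv : IsTwoFormOn B v) (hB : IsCompact B) :
    (Integrable fun x => matPair (fun a b => G a b x) (diracX G p v x) (diracA G p v x)) ∧
    |∫ x, matPair (fun a b => G a b x) (diracX G p v x) (diracA G p v x)| ≤
      4 * n ^ 6 * K * ∫ x, √(normSq v x) * √(gradSq v x) := by
  have h := hv.abs_integral_sum_null_le hB (m := diracNullCoeff G p)
    (hG.contDiff_diracNullCoeff hw.contDiff) hw.null_bound
    (fun t => t.2.2.2.2.1) (fun t => t.1) (fun t => t.2.1) (fun t => t.2.2.2.1)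
    (fun t => t.2.2.2.2.2) (fun t => t.2.2.1)
  have e : ∀ x, matPair (fun a b => G a b x) (diracX G p v x) (diracA G p v x) =
      2 * ∑ t : Fin n × Fin n × Fin n × Fin n × Fin n × Fin n, diracNullCoeff G p t x *
        (pd t.2.2.2.2.1 (v t.2.1 t.2.2.2.1) x * pd t.1 (v t.2.2.2.2.2 t.2.2.1) x
          - pd t.1 (v t.2.1 t.2.2.2.1) x * pd t.2.2.2.2.1 (v t.2.2.2.2.2 t.2.2.1) x) := by
    intro x
    refine (matPair_dirac (fun a b => hG.symm a b x) (fun a => p a x) (fun a => raise G p a x)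
      (fun a => rfl) (fun e b c => pd e (v b c) x) (fun e b c => hv.pd_antisymm e b c x)).trans ?_
    simp only [Fintype.sum_prod_type, diracNullCoeff]
  simp only [e]
  refine ⟨h.1.const_mul 2, ?_⟩
  rw [integral_const_mul, abs_mul, abs_two]
  refine (mul_le_mul_of_nonneg_left h.2 (by norm_num)).trans (le_of_eq ?_)
  simp only [Fintype.card_prod, Fintype.card_fin]
  push_cast
  ring

lemma integral_matPair_diracX (hG : IsEllipticOn B G l K) (hp : ∀ a, ContDiff ℝ 1 (p a))
    (hv : IsTwoFormOn B v) (hB : IsCompact B) {κ : Pt n → ℝ} (hκ : ContDiff ℝ 1 κ) {q : ℝ}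
    (hκp : ∀ a x, pd a κ x = q * p a x) :
    (Integrable fun x => κ x * lenSq G p x * matPair (fun a b => G a b x) (diracX G p v x)
          (fun b c => v b c x)) ∧
    (Integrable fun x => q * lenSq G p x ^ 2 *
        matPair (fun a b => G a b x) (fun b c => v b c x) (fun b c => v b c x)
      + κ x * ∑ t : Fin n × Fin n × Fin n × Fin n × Fin n,
        pd t.2.2.2.2 (diracDivCoeff G p t) x * (v t.1 t.2.2.1 x * v t.2.1 t.2.2.2.1 x)) ∧
    -2 * ∫ x, κ x * lenSq G p x * matPair (fun a b => G a b x) (diracX G p v x)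
          (fun b c => v b c x) =
    ∫ x, (q * lenSq G p x ^ 2 *
        matPair (fun a b => G a b x) (fun b c => v b c x) (fun b c => v b c x)
      + κ x * ∑ t : Fin n × Fin n × Fin n × Fin n × Fin n,
        pd t.2.2.2.2 (diracDivCoeff G p t) x * (v t.1 t.2.2.1 x * v t.2.1 t.2.2.2.1 x)) := by
  have hl := hG.contDiff_lenSq hp
  have hr := hG.contDiff_raise hp
  have hm := hG.contDiff_diracDivCoeff hp
  have hlc := hl.continuous
  have hrc := fun a => (hr a).continuous
  have hGc := fun a b => (hG.contDiff a b).continuous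
  have hκc := hκ.continuous
  have h1 := fun b c => (hv.contDiff b c).continuous
  have h2 := fun e b c => continuous_pd (hv.contDiff b c) e
  have h3 := fun t e => continuous_pd (hm t) e
  have h := hv.integral_sum_mul_pd_mul_add hB (m := fun t x => κ x * diracDivCoeff G p t x)
    (fun t => hκ.mul (hm t))
    (fun t => t.2.2.2.2) (fun t => t.1) (fun t => t.2.2.1) (fun t => t.2.1) (fun t => t.2.2.2.1)
  have e1 : ∀ x, κ x * lenSq G p x * matPair (fun a b => G a b x) (diracX G p v x)
          (fun b c => v b c x) * 2 =
      ∑ t : Fin n × Fin n × Fin n × Fin n × Fin n, κ x * diracDivCoeff G p t x *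
        (pd t.2.2.2.2 (v t.1 t.2.2.1) x * v t.2.1 t.2.2.2.1 x
          + v t.1 t.2.2.1 x * pd t.2.2.2.2 (v t.2.1 t.2.2.2.1) x) := by
    intro x
    have hs : ∀ a b, (fun a b => G a b x) a b = (fun a b => G a b x) b a :=
      fun a b => hG.symm a b x
    rw [mul_two]
    nth_rewrite 2 [matPair_comm hs]
    simp only [matPair, diracX, Fintype.sum_prod_type, diracDivCoeff, Finset.mul_sum,
      Finset.sum_mul, ← Finset.sum_add_distrib]
    iterate 5 refine Finset.sum_congr rfl fun _ _ => ?_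
    ring
  have e2 : ∀ x, ∑ t : Fin n × Fin n × Fin n × Fin n × Fin n,
      pd t.2.2.2.2 (fun x => κ x * diracDivCoeff G p t x) x *
        (v t.1 t.2.2.1 x * v t.2.1 t.2.2.2.1 x) =
      q * lenSq G p x ^ 2 *
        matPair (fun a b => G a b x) (fun b c => v b c x) (fun b c => v b c x)
      + κ x * ∑ t : Fin n × Fin n × Fin n × Fin n × Fin n,
        pd t.2.2.2.2 (diracDivCoeff G p t) x * (v t.1 t.2.2.1 x * v t.2.1 t.2.2.2.1 x) := by
    intro x
    have e3 : ∀ t : Fin n × Fin n × Fin n × Fin n × Fin n,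
      pd t.2.2.2.2 (fun x => κ x * diracDivCoeff G p t x) x = q * p t.2.2.2.2 x
        * diracDivCoeff G p t x + κ x * pd t.2.2.2.2 (diracDivCoeff G p t) x := fun t => by
      rw [pd_mul (hκ.differentiable one_ne_zero x) ((hm t).differentiable one_ne_zero x), hκp]
    have e4 : q * lenSq G p x ^ 2 *
        matPair (fun a b => G a b x) (fun b c => v b c x) (fun b c => v b c x) =
        ∑ t : Fin n × Fin n × Fin n × Fin n × Fin n, q * p t.2.2.2.2 x
        * diracDivCoeff G p t x * (v t.1 t.2.2.1 x * v t.2.1 t.2.2.2.1 x) := by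
      have : lenSq G p x ^ 2 = ∑ d, lenSq G p x * (raise G p d x * p d x) := by
        rw [← Finset.mul_sum, pow_two]; rfl
      rw [this]
      simp only [matPair, Fintype.sum_prod_type, diracDivCoeff, Finset.mul_sum, Finset.sum_mul]
      iterate 5 refine Finset.sum_congr rfl fun _ _ => ?_
      ring
    simp only [e3, add_mul, Finset.sum_add_distrib, e4, Finset.mul_sum]
    congr 1
    exact Finset.sum_congr rfl fun t _ => by ring
  refine ⟨?_, ?_, ?_⟩
  · refine integrable_of_forall_notMem_eq_zero hB ?_ fun x hx => ?_
    · unfold matPair diracX; fun_prop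
    · simp [matPair, hv.eq_zero hx]
  · refine integrable_of_forall_notMem_eq_zero hB ?_ fun x hx => ?_
    · unfold matPair; fun_prop
    · simp [matPair, hv.eq_zero hx]
  · simp only [e2, ← e1] at h
    rw [integral_mul_const] at h
    linarith

end

end CarlemanTwo

section CarlemanThree

open MeasureTheory

variable {n : ℕ} {B : Set (Pt n)} {G : Fin n → Fin n → Pt n → ℝ} {l K c : ℝ}
  {v : Fin n → Fin n → Pt n → ℝ}

lemma le_integral_divCoeff {p : Fin n → Pt n → ℝ}
    (hG : IsEllipticOn B G l K) (hw : WeightBounds B G p K c)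
    (hv : IsTwoFormOn B v) (hB : IsCompact B) {κ : Pt n → ℝ} {q M : ℝ} (hq : 0 ≤ q)
    (hκ : ∀ x, normSq v x ≠ 0 → |κ x| ≤ M)
    (hi : Integrable fun x => q * lenSq G p x ^ 2 *
        matPair (fun a b => G a b x) (fun b c => v b c x) (fun b c => v b c x)
      + κ x * ∑ t : Fin n × Fin n × Fin n × Fin n × Fin n,
        pd t.2.2.2.2 (diracDivCoeff G p t) x * (v t.1 t.2.2.1 x * v t.2.1 t.2.2.2.1 x)) :
    (q * c ^ 2 * l ^ 2 - M * (n ^ 5 * K)) * ∫ x, normSq v x ≤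
    ∫ x, (q * lenSq G p x ^ 2 *
        matPair (fun a b => G a b x) (fun b c => v b c x) (fun b c => v b c x)
      + κ x * ∑ t : Fin n × Fin n × Fin n × Fin n × Fin n,
        pd t.2.2.2.2 (diracDivCoeff G p t) x * (v t.1 t.2.2.1 x * v t.2.1 t.2.2.2.1 x)) := by
  rw [← integral_const_mul]
  refine integral_mono ((hv.integrable_normSq hB).const_mul _) hi fun x => ?_
  by_cases h0 : normSq v x = 0
  · have hz : ∀ b c, v b c x = 0 := fun b c => by
      have := abs_le_sqrt_normSq v x b c
      rw [h0, Real.sqrt_zero] at this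
      exact abs_nonpos_iff.1 this
    simp [h0, hz, matPair]
  · have hx : x ∈ B := by
      by_contra h
      exact h0 (hv.normSq_eq_zero h)
    have h1 : q * c ^ 2 * (l ^ 2 * normSq v x) ≤ q * lenSq G p x ^ 2 *
        matPair (fun a b => G a b x) (fun b c => v b c x) (fun b c => v b c x) := by
      have h3 := hw.lower x hx
      have h4 := hw.pos
      have h5 := matPair_self_nonneg hG hx fun b c => v b c x
      have h6 : 0 ≤ l ^ 2 * normSq v x := by have := normSq_nonneg v x; positivity
      have h7 : c ^ 2 ≤ lenSq G p x ^ 2 := by gcongr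
      exact mul_le_mul (mul_le_mul_of_nonneg_left h7 hq) h5 h6 (by positivity)
    have h2 : |κ x * ∑ t : Fin n × Fin n × Fin n × Fin n × Fin n,
        pd t.2.2.2.2 (diracDivCoeff G p t) x * (v t.1 t.2.2.1 x * v t.2.1 t.2.2.2.1 x)| ≤
        M * (n ^ 5 * K * normSq v x) := by
      have hM := hκ x h0
      have hs : |∑ t : Fin n × Fin n × Fin n × Fin n × Fin n,
        pd t.2.2.2.2 (diracDivCoeff G p t) x * (v t.1 t.2.2.1 x * v t.2.1 t.2.2.2.1 x)| ≤
          n ^ 5 * K * normSq v x := by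
        refine (Finset.abs_sum_le_sum_abs _ _).trans ((sum_le_card_mul
          (M := K * (√(normSq v x) * √(normSq v x))) fun t => ?_).trans (le_of_eq ?_))
        · have hb := hw.div_bound t x hx t.2.2.2.2
          have hK := (abs_nonneg _).trans hb
          rw [abs_mul, abs_mul]
          gcongr
          · exact abs_le_sqrt_normSq v x _ _
          · exact abs_le_sqrt_normSq v x _ _
        · rw [Real.mul_self_sqrt (normSq_nonneg v x)]
          simp only [Fintype.card_prod, Fintype.card_fin]
          push_cast
          ring
      rw [abs_mul]
      exact mul_le_mul hM hs (abs_nonneg _) ((abs_nonneg _).trans hM)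
    have h3 := (abs_le.1 h2).1
    show (q * c ^ 2 * l ^ 2 - M * (n ^ 5 * K)) * normSq v x ≤ _
    linarith

/-- Carleman estimate for two-forms with the convexified weight `ψ + A ψ² / 2`. -/
theorem exists_carleman [NeZero n] (hB : IsCompact B) (hG : IsEllipticOn B G l K) {ψ : Pt n → ℝ}
    (hψ : ContDiff ℝ 2 ψ) (hw : WeightBounds B G (fun a => pd a ψ) K c) (hBne : B.Nonempty) :
    ∃ A, 0 < A ∧ ∃ C, 0 ≤ C ∧ ∀ τ, 1 ≤ τ → ∀ v, IsTwoFormOn B v →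
      (∀ x, 1 / 2 < |A * ψ x| → normSq v x = 0) →
      τ * ∫ x, normSq v x ≤
        C * ∫ x, conjSq G (fun x => τ * (1 + A * ψ x)) (fun a => pd a ψ) v x := by
  obtain ⟨C₄, hC₄, hgrad⟩ := exists_integral_gradSq_le hB hG
  have hK : 0 ≤ K := hG.bound_nonneg hBne.some_mem
  have hl := hG.pos
  have hc := hw.pos
  obtain ⟨C₁, hC₁⟩ : ∃ C : ℝ, C = n ^ 4 * K ^ 2 * ((n + 2) * K) ^ 2 := ⟨_, rfl⟩
  obtain ⟨C₂, hC₂⟩ : ∃ C : ℝ, C = 4 * n ^ 6 * K := ⟨_, rfl⟩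
  obtain ⟨C₅, hC₅⟩ : ∃ C : ℝ,
      C = (n * (n * (n * (18 * K ^ 2))) + n * (2 * (n * (n * K ^ 2)) ^ 2)) :=
    ⟨_, rfl⟩
  have hC₁0 : 0 ≤ C₁ := by rw [hC₁]; positivity
  have hC₂0 : 0 ≤ C₂ := by rw [hC₂]; positivity
  have hC₅0 : 0 ≤ C₅ := by rw [hC₅]; positivity
  obtain ⟨C₆, hC₆⟩ : ∃ C : ℝ, C = C₄ * (C₅ * (9 / 4)) + C₄ := ⟨_, rfl⟩
  have hC₆0 : 0 ≤ C₆ := by rw [hC₆]; positivity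
  obtain ⟨A, hA⟩ : ∃ A : ℝ, A = (1 + 3 * n ^ 5 * K + 4 * C₂ * (1 + C₆)) / (2 * c ^ 2 * l ^ 2) :=
    ⟨_, rfl⟩
  refine ⟨A, by rw [hA]; positivity, C₁ + 8 * C₂ * C₄, by positivity, fun τ hτ v hv hvψ => ?_⟩
  have hA0 : 0 < A := by rw [hA]; positivity
  have hA2 : 2 * A * c ^ 2 * l ^ 2 = 1 + 3 * n ^ 5 * K + 4 * C₂ * (1 + C₆) := by
    rw [hA]; field_simp
  have hτ0 : 0 < τ := by linarith
  set κ : Pt n → ℝ := fun x => τ * (1 + A * ψ x) with hκdef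
  set p : Fin n → Pt n → ℝ := fun a => pd a ψ with hpdef
  have hp := hw.contDiff
  have hpc := fun a => (hp a).continuous
  have hGc := fun a b => (hG.contDiff a b).continuous
  have hψ1 : ContDiff ℝ 1 ψ := hψ.of_le (by norm_num)
  have hκ : ContDiff ℝ 1 κ := by rw [hκdef]; fun_prop
  have hκc := hκ.continuous
  have hκp : ∀ a x, pd a κ x = (τ * A) * p a x := by
    intro a x
    have hd : DifferentiableAt ℝ ψ x := hψ1.differentiable one_ne_zero x
    have : HasFDerivAt κ (τ • (A • fderiv ℝ ψ x)) x :=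
      ((hd.hasFDerivAt.const_mul A).const_add 1).const_mul τ
    simp only [pd, this.fderiv, hpdef, _root_.smul_apply, smul_eq_mul]
    ring
  have hκb : ∀ x, normSq v x ≠ 0 → |κ x| ≤ 3 / 2 * τ := by
    intro x hx
    have h1 : |A * ψ x| ≤ 1 / 2 := not_lt.1 fun h => hx (hvψ x h)
    have h2 := abs_le.1 h1
    simp only [hκdef]
    rw [abs_mul, abs_of_pos hτ0, mul_comm]
    refine mul_le_mul_of_nonneg_right (abs_le.2 ⟨?_, ?_⟩) hτ0.le <;> linarith
  obtain ⟨hiA, hleA⟩ := abs_integral_matPair_dirac_le hG hw hv hB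
  obtain ⟨hiX, hiD, heD⟩ := integral_matPair_diracX hG hp hv hB hκ hκp
  have hD := le_integral_divCoeff hG hw hv hB (by positivity : 0 ≤ τ * A) hκb hiD
  rw [← heD] at hD
  have hic := hv.integrable_conjSq hB hGc hκc hpc
  have hic0 := hv.integrable_conjSq hB hGc continuous_zero hpc
  have hin := hv.integrable_normSq hB
  have hig := hv.integrable_gradSq hB
  have hing := hv.integrable_sqrt_mul_sqrt hB
  have i1 : -4 * (∫ x, matPair (fun a b => G a b x) (diracX G p v x) (diracA G p v x))
      - 4 * (∫ x, κ x * lenSq G p x * matPair (fun a b => G a b x) (diracX G p v x)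
          (fun b c => v b c x)) ≤ C₁ * ∫ x, conjSq G κ p v x := by
    simp only [← integral_const_mul]
    rw [← integral_sub (hiA.const_mul _) (hiX.const_mul _)]
    refine integral_mono ((hiA.const_mul _).sub (hiX.const_mul _)) (hic.const_mul _) fun x => ?_
    by_cases hx : x ∈ B
    · have := neg_four_mul_matPair_le hG hw hv κ hx
      rw [← hC₁] at this
      exact this
    · simp [matPair, diracX, hv.eq_zero hx, hv.pd_eq_zero hx, hv.conjSq_eq_zero G κ p hx]
  have i2 : ∫ x, conjSq G 0 p v x ≤ 2 * (∫ x, conjSq G κ p v x)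
      + C₅ * (9 / 4 * τ ^ 2) * ∫ x, normSq v x := by
    simp only [← integral_const_mul]
    rw [← integral_add (hic.const_mul _) (hin.const_mul _)]
    refine integral_mono hic0 ((hic.const_mul _).add (hin.const_mul _)) fun x => ?_
    by_cases hx : x ∈ B
    · have h1 := conjSq_zero_le hG hw.bound κ v hx
      rw [← hC₅] at h1
      have h2 : κ x ^ 2 * normSq v x ≤ 9 / 4 * τ ^ 2 * normSq v x := by
        by_cases h0 : normSq v x = 0
        · simp [h0]
        · refine mul_le_mul_of_nonneg_right ?_ (normSq_nonneg v x)
          have := abs_le.1 (hκb x h0)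
          nlinarith
      refine h1.trans ?_
      show _ ≤ 2 * _ + C₅ * (9 / 4 * τ ^ 2) * normSq v x
      have := mul_le_mul_of_nonneg_left h2 hC₅0
      linarith
    · simp [hv.conjSq_eq_zero G _ p hx, hv.normSq_eq_zero hx]
  have i3 := hgrad p hpc v hv
  have n1 : 0 ≤ ∫ x, conjSq G κ p v x := integral_nonneg fun x => conjSq_nonneg G κ p v x
  have n2 : 0 ≤ ∫ x, normSq v x := integral_nonneg fun x => normSq_nonneg v x
  have i4 : ∫ x, gradSq v x ≤ 2 * C₄ * (∫ x, conjSq G κ p v x) + C₆ * τ ^ 2 * ∫ x, normSq v x := by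
    have h1 := mul_le_mul_of_nonneg_left i2 hC₄
    have h2 : C₄ * (∫ x, normSq v x) ≤ C₄ * τ ^ 2 * ∫ x, normSq v x := by
      exact mul_le_mul_of_nonneg_right (le_mul_of_one_le_right hC₄ (one_le_pow₀ hτ)) n2
    rw [hC₆]
    linarith
  have i5 : ∫ x, √(normSq v x) * √(gradSq v x) ≤ τ * (∫ x, normSq v x)
      + 1 / τ * ∫ x, gradSq v x := by
    simp only [← integral_const_mul]
    rw [← integral_add (hin.const_mul _) (hig.const_mul _)]
    refine integral_mono hing ((hin.const_mul _).add (hig.const_mul _)) fun x => ?_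
    have s1 := Real.sq_sqrt (gradSq_nonneg v x)
    have s2 := Real.sq_sqrt (normSq_nonneg v x)
    have : τ * normSq v x + 1 / τ * gradSq v x
      - (√(normSq v x) * √(gradSq v x)) =
      τ * ((√(normSq v x) - 1 / (2 * τ) * √(gradSq v x)) ^ 2
        + 3 / (4 * τ ^ 2) * √(gradSq v x) ^ 2) := by
      rw [← s1, ← s2]
      simp only [Real.sqrt_sq (Real.sqrt_nonneg _)]
      field_simp
      ring
    have h0 : 0 ≤ τ * ((√(normSq v x) - 1 / (2 * τ) * √(gradSq v x)) ^ 2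
        + 3 / (4 * τ ^ 2) * √(gradSq v x) ^ 2) := by positivity
    show _ ≤ τ * normSq v x + 1 / τ * gradSq v x
    linarith
  have i6 : 1 / τ * ∫ x, gradSq v x ≤ 2 * C₄ * (∫ x, conjSq G κ p v x)
      + C₆ * τ * ∫ x, normSq v x := by
    have h1 := mul_le_mul_of_nonneg_left i4 (by positivity : 0 ≤ 1 / τ)
    have h2 : 1 / τ * (2 * C₄ * (∫ x, conjSq G κ p v x) + C₆ * τ ^ 2 * ∫ x, normSq v x) =
        1 / τ * (2 * C₄ * (∫ x, conjSq G κ p v x)) + C₆ * τ * ∫ x, normSq v x := by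
      field_simp
    have h3 : 1 / τ * (2 * C₄ * (∫ x, conjSq G κ p v x)) ≤
        1 * (2 * C₄ * (∫ x, conjSq G κ p v x)) := by
      refine mul_le_mul_of_nonneg_right ?_ (by positivity)
      rw [div_le_one hτ0]; exact hτ
    linarith
  have i7 := mul_le_mul_of_nonneg_left (i5.trans (add_le_add_right i6 _)) hC₂0
  have i8 := (abs_le.1 hleA).2
  rw [← hC₂] at i8
  have i9 : 2 * (τ * A * c ^ 2 * l ^ 2 - 3 / 2 * τ * (n ^ 5 * K)) * (∫ x, normSq v x) =
      τ * ((1 + 4 * C₂ * (1 + C₆)) * ∫ x, normSq v x) := by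
    linear_combination τ * (∫ x, normSq v x) * hA2
  linarith

end CarlemanThree

section ConjugatedBounds

variable {n : ℕ}

lemma IsEllipticOn.mono {B B' : Set (Pt n)} {G : Fin n → Fin n → Pt n → ℝ} {l K K' : ℝ}
    (hG : IsEllipticOn B G l K) (hB : B' ⊆ B) (hK : K ≤ K') : IsEllipticOn B' G l K' :=
  ⟨hG.contDiff, hG.symm, hG.pos, fun x hx => hG.lower x (hB hx),
    fun x hx a b => (hG.bound x (hB hx) a b).trans hK,
    fun x hx a b c => (hG.pd_bound x (hB hx) a b c).trans hK⟩

lemma exists_weightBounds {B : Set (Pt n)} (hB : IsCompact B) {G : Fin n → Fin n → Pt n → ℝ}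
    {l K c : ℝ} (hG : IsEllipticOn B G l K) {p : Fin n → Pt n → ℝ}
    (hp : ∀ a, ContDiff ℝ 1 (p a)) (hc : 0 < c) (hlow : ∀ x ∈ B, c ≤ lenSq G p x) :
    ∃ K', IsEllipticOn B G l K' ∧ WeightBounds B G p K' c := by
  obtain ⟨K₁, h₁, hK₁⟩ := exists_forall_abs_le hB fun a => (hp a).continuous
  obtain ⟨K₂, h₂, hK₂⟩ := exists_forall_abs_le hB fun a => (hG.contDiff_raise hp a).continuous
  obtain ⟨K₃, h₃, hK₃⟩ := exists_forall_abs_le hB (f := fun t : _ × _ =>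
      pd t.1 (diracNullCoeff G p t.2))
    fun t => continuous_pd (hG.contDiff_diracNullCoeff hp t.2) t.1
  obtain ⟨K₄, h₄, hK₄⟩ := exists_forall_abs_le hB (f := fun t : _ × _ =>
      pd t.1 (diracDivCoeff G p t.2))
    fun t => continuous_pd (hG.contDiff_diracDivCoeff hp t.2) t.1
  have h₅ := abs_nonneg K
  have h₆ := le_abs_self K
  refine ⟨K₁ + K₂ + K₃ + K₄ + |K|, hG.mono subset_rfl (by linarith), hp, ?_, ?_, ?_, ?_, hc, hlow⟩
  · exact fun x hx a => (hK₁ x hx a).trans (by linarith)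
  · exact fun x hx a => (hK₂ x hx a).trans (by linarith)
  · exact fun t x hx e => (hK₃ x hx (e, t)).trans (by linarith)
  · exact fun t x hx e => (hK₄ x hx (e, t)).trans (by linarith)

variable {G : Fin n → Fin n → Pt n → ℝ} {κ : Pt n → ℝ} {p : Fin n → Pt n → ℝ}
  {E χ : Pt n → ℝ} {ω : Fin n → Fin n → Pt n → ℝ}

lemma pd_mul_mul {f : Pt n → ℝ} (hE : ContDiff ℝ 1 E) (hχ : ContDiff ℝ 1 χ)
    (hf : ContDiff ℝ 1 f) (hEp : ∀ a x, pd a E x = κ x * p a x * E x) (a : Fin n) (x : Pt n) :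
    pd a (fun y => E y * (χ y * f y)) x =
      κ x * (p a x * (E x * (χ x * f x))) + E x * (pd a χ x * f x + χ x * pd a f x) := by
  rw [pd_mul (hE.differentiable one_ne_zero x)
    ((hχ.mul hf).differentiable one_ne_zero x), pd_mul (hχ.differentiable one_ne_zero x)
    (hf.differentiable one_ne_zero x), hEp]
  ring

lemma conjD_mul_mul (hE : ContDiff ℝ 1 E) (hχ : ContDiff ℝ 1 χ)
    (hω : ∀ b c, ContDiff ℝ 1 (ω b c)) (hEp : ∀ a x, pd a E x = κ x * p a x * E x)
    (a b c : Fin n) (x : Pt n) :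
    conjD κ p (fun b c y => E y * (χ y * ω b c y)) a b c x =
      E x * (χ x * conjD 0 p ω a b c x
        + (pd a χ x * ω b c x + pd b χ x * ω c a x + pd c χ x * ω a b x)) := by
  simp only [conjD, pd_mul_mul hE hχ (hω _ _) hEp, Pi.zero_apply]
  ring

lemma conjDiv_mul_mul (hE : ContDiff ℝ 1 E) (hχ : ContDiff ℝ 1 χ)
    (hω : ∀ b c, ContDiff ℝ 1 (ω b c)) (hEp : ∀ a x, pd a E x = κ x * p a x * E x)
    (b : Fin n) (x : Pt n) :
    conjDiv G κ p (fun b c y => E y * (χ y * ω b c y)) b x =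
      E x * (χ x * conjDiv G 0 p ω b x + ∑ a, ∑ e, G a e x * (pd e χ x * ω a b x)) := by
  simp only [conjDiv, pd_mul_mul hE hχ (hω _ _) hEp, Pi.zero_apply, Finset.mul_sum,
    ← Finset.sum_add_distrib]
  iterate 2 refine Finset.sum_congr rfl fun _ _ => ?_
  ring

lemma conjSq_mul_mul_le {K M q s : ℝ} (hE : ContDiff ℝ 1 E) (hχ : ContDiff ℝ 1 χ)
    (hω : ∀ b c, ContDiff ℝ 1 (ω b c)) (hEp : ∀ a x, pd a E x = κ x * p a x * E x)
    {x : Pt n} (hG : ∀ a b, |G a b x| ≤ K) (hs : 0 ≤ s)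
    (hωq : ∀ b c, |ω b c x| ≤ q) (hχs : ∀ a, |pd a χ x| ≤ s)
    (hD : ∀ a b c, |conjD 0 p ω a b c x| ≤ M * q) (hδ : ∀ b, |conjDiv G 0 p ω b x| ≤ M * q) :
    conjSq G κ p (fun b c y => E y * (χ y * ω b c y)) x ≤
      (2 * n ^ 3 + 2 * n) * M ^ 2 * (E x ^ 2 * (χ x ^ 2 * q ^ 2))
      + (18 * n ^ 3 + 2 * n ^ 5 * K ^ 2) * (E x ^ 2 * (s ^ 2 * q ^ 2)) := by
  have sq_bound : ∀ X Y L : ℝ, |X| ≤ M * q → |Y| ≤ L * (s * q) →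
      (E x * (χ x * X + Y)) ^ 2 ≤ 2 * M ^ 2 * (E x ^ 2 * (χ x ^ 2 * q ^ 2))
        + 2 * L ^ 2 * (E x ^ 2 * (s ^ 2 * q ^ 2)) := by
    intro X Y L hX hY
    have h1 : X ^ 2 ≤ (M * q) ^ 2 := sq_le_sq' (abs_le.1 hX).1 (abs_le.1 hX).2
    have h2 : Y ^ 2 ≤ (L * (s * q)) ^ 2 := sq_le_sq' (abs_le.1 hY).1 (abs_le.1 hY).2
    have h3 : (χ x * X + Y) ^ 2 ≤ 2 * (χ x ^ 2 * X ^ 2) + 2 * Y ^ 2 := by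
      nlinarith [sq_nonneg (χ x * X - Y)]
    calc (E x * (χ x * X + Y)) ^ 2 = E x ^ 2 * (χ x * X + Y) ^ 2 := by ring
      _ ≤ E x ^ 2 * (2 * (χ x ^ 2 * (M * q) ^ 2) + 2 * (L * (s * q)) ^ 2) := by
        refine mul_le_mul_of_nonneg_left (h3.trans ?_) (sq_nonneg _)
        gcongr
      _ = _ := by ring
  have hprod : ∀ a b c, |pd a χ x * ω b c x| ≤ s * q := fun a b c => by
    rw [abs_mul]
    exact mul_le_mul (hχs a) (hωq b c) (abs_nonneg _) hs
  have h1 : ∀ a b c, conjD κ p (fun b c y => E y * (χ y * ω b c y)) a b c x ^ 2 ≤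
      2 * M ^ 2 * (E x ^ 2 * (χ x ^ 2 * q ^ 2)) + 2 * 3 ^ 2 * (E x ^ 2 * (s ^ 2 * q ^ 2)) :=
    fun a b c => by
    rw [conjD_mul_mul hE hχ hω hEp]
    refine sq_bound _ _ 3 (hD a b c) ?_
    have e1 := abs_le.1 (hprod a b c)
    have e2 := abs_le.1 (hprod b c a)
    have e3 := abs_le.1 (hprod c a b)
    exact abs_le.2 ⟨by linarith, by linarith⟩
  have h2 : ∀ b, conjDiv G κ p (fun b c y => E y * (χ y * ω b c y)) b x ^ 2 ≤
      2 * M ^ 2 * (E x ^ 2 * (χ x ^ 2 * q ^ 2))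
        + 2 * (n * (n * K)) ^ 2 * (E x ^ 2 * (s ^ 2 * q ^ 2)) :=
    fun b => by
    rw [conjDiv_mul_mul hE hχ hω hEp]
    refine sq_bound _ _ (n * (n * K)) (hδ b) ?_
    refine (Finset.abs_sum_le_sum_abs _ _).trans ((sum_le_card_mul
      (M := n * (K * (s * q))) fun a => ?_).trans (le_of_eq (by rw [Fintype.card_fin]; ring)))
    refine (Finset.abs_sum_le_sum_abs _ _).trans ((sum_le_card_mul
      (M := K * (s * q)) fun e => ?_).trans (le_of_eq (by rw [Fintype.card_fin])))
    rw [abs_mul]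
    exact mul_le_mul (hG a e) (hprod e a b) (abs_nonneg _) ((abs_nonneg _).trans (hG a e))
  unfold conjSq
  have h3 := (sum_le_card_mul fun a => sum_le_card_mul fun b => sum_le_card_mul fun c => h1 a b c)
  have h4 := sum_le_card_mul h2
  refine (add_le_add h3 h4).trans (le_of_eq ?_)
  simp only [Fintype.card_fin]
  ring

end ConjugatedBounds

section LocalUniqueContinuation

open MeasureTheory Filter Topology

variable {n : ℕ}

/-- Pointwise squared norm of a family of two-forms. -/
def famSq {ι : Type*} [Fintype ι] (ω : ι → Fin n → Fin n → Pt n → ℝ) (x : Pt n) : ℝ :=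
  ∑ k, normSq (ω k) x

lemma famSq_nonneg {ι : Type*} [Fintype ι] (ω : ι → Fin n → Fin n → Pt n → ℝ) (x : Pt n) :
    0 ≤ famSq ω x :=
  Finset.sum_nonneg fun k _ => normSq_nonneg (ω k) x

lemma abs_le_sqrt_famSq {ι : Type*} [Fintype ι] (ω : ι → Fin n → Fin n → Pt n → ℝ) (x : Pt n)
    (k : ι) (b c : Fin n) : |ω k b c x| ≤ √(famSq ω x) :=
  (abs_le_sqrt_normSq (ω k) x b c).trans (Real.sqrt_le_sqrt
    (Finset.single_le_sum (f := fun k => normSq (ω k) x)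
      (fun k _ => normSq_nonneg (ω k) x) (Finset.mem_univ k)))

/-- The quadratic weight, vanishing at `x₁` and at `x₀`. -/
def sphereWeight (x₀ x₁ x : Pt n) : ℝ :=
  (∑ i, (x₁ i - x₀ i) ^ 2) / 4 - ∑ i, (x i - (x₀ i + x₁ i) / 2) ^ 2

lemma contDiff_sphereWeight (x₀ x₁ : Pt n) {m : ℕ∞} : ContDiff ℝ m (sphereWeight x₀ x₁) := by
  unfold sphereWeight
  fun_prop

lemma sphereWeight_eq (x₀ x₁ x : Pt n) : sphereWeight x₀ x₁ x =
    (∑ i, (x₁ i - x₀ i) ^ 2) / 2 - (∑ i, (x i - x₀ i) ^ 2) / 2 - (∑ i, (x i - x₁ i) ^ 2) / 2 := by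
  unfold sphereWeight
  simp only [Finset.sum_div, ← Finset.sum_sub_distrib]
  exact Finset.sum_congr rfl fun i _ => by ring

lemma pd_sphereWeight (x₀ x₁ x : Pt n) (a : Fin n) :
    pd a (sphereWeight x₀ x₁) x = -2 * (x a - (x₀ a + x₁ a) / 2) := by
  have h : HasFDerivAt (sphereWeight x₀ x₁)
      (-∑ i, ((2 : ℕ) • (x i - (x₀ i + x₁ i) / 2) ^ (2 - 1)) •
        (ContinuousLinearMap.proj (R := ℝ) (φ := fun _ : Fin n => ℝ) i)) x := by
    refine HasFDerivAt.const_sub (HasFDerivAt.fun_sum fun i _ => ?_) _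
    exact ((hasFDerivAt_apply i x).sub_const _).pow 2
  unfold pd
  rw [h.fderiv]
  simp [Pi.single_apply]

lemma sq_le_sum_sq_of_notMem_ball {x x₁ : Pt n} {δ : ℝ} (hδ : 0 < δ)
    (hx : x ∉ Metric.ball x₁ δ) : δ ^ 2 ≤ ∑ i, (x i - x₁ i) ^ 2 := by
  by_contra! h
  refine hx ?_
  rw [Metric.mem_ball, dist_pi_lt_iff hδ]
  intro i
  rw [Real.dist_eq]
  refine abs_lt_of_sq_lt_sq ?_ hδ.le
  exact (Finset.single_le_sum (f := fun i => (x i - x₁ i) ^ 2) (fun _ _ => sq_nonneg _)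
    (Finset.mem_univ i)).trans_lt h

lemma pd_exp_weight {ψ : Pt n → ℝ} (hψ : ContDiff ℝ 1 ψ) (A τ : ℝ) (a : Fin n) (x : Pt n) :
    pd a (fun x => Real.exp (τ * (ψ x + A / 2 * ψ x ^ 2))) x =
      (τ * (1 + A * ψ x)) * pd a ψ x * Real.exp (τ * (ψ x + A / 2 * ψ x ^ 2)) := by
  have h := (hψ.differentiable one_ne_zero x).hasFDerivAt
  have h2 := ((h.add ((h.pow 2).const_mul (A / 2))).const_mul τ).exp
  unfold pd
  refine (congrArg (fun L => L (Pi.single a 1)) h2.fderiv).trans ?_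
  simp only [_root_.add_apply, _root_.smul_apply, smul_eq_mul, Pi.add_apply, nsmul_eq_mul]
  push_cast
  ring

lemma contDiff_exp_weight {ψ : Pt n → ℝ} (hψ : ContDiff ℝ 1 ψ) (A τ : ℝ) :
    ContDiff ℝ 1 fun x => Real.exp (τ * (ψ x + A / 2 * ψ x ^ 2)) := by
  fun_prop

lemma weight_convex_le {A s : ℝ} (hs : s ≤ 0) (hA : |A * s| ≤ 1 / 2) :
    s + A / 2 * s ^ 2 ≤ 3 / 4 * s := by
  have := (abs_le.1 hA).1
  nlinarith

lemma lenSq_sphereWeight_pos {B : Set (Pt n)} {G : Fin n → Fin n → Pt n → ℝ} {l K : ℝ}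
    (hG : IsEllipticOn B G l K) {x₀ x₁ : Pt n} (hne : x₀ ≠ x₁) (hx : x₁ ∈ B) :
    0 < lenSq G (fun a => pd a (sphereWeight x₀ x₁)) x₁ := by
  have h := hG.lower x₁ hx fun a => pd a (sphereWeight x₀ x₁) x₁
  have e : lenSq G (fun a => pd a (sphereWeight x₀ x₁)) x₁ = ∑ a, ∑ b, G a b x₁ *
      (pd a (sphereWeight x₀ x₁) x₁ * pd b (sphereWeight x₀ x₁) x₁) := by
    simp only [lenSq, raise, Finset.sum_mul]
    iterate 2 refine Finset.sum_congr rfl fun _ _ => ?_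
    ring
  rw [e]
  refine lt_of_lt_of_le (mul_pos hG.pos ?_) h
  obtain ⟨i, hi⟩ := Function.ne_iff.1 hne
  refine Finset.sum_pos' (fun _ _ => sq_nonneg _) ⟨i, Finset.mem_univ i, ?_⟩
  rw [pd_sphereWeight]
  have : -2 * (x₁ i - (x₀ i + x₁ i) / 2) ≠ 0 := fun h0 => hi (by linarith)
  positivity

/-- The gradient length of a cutoff function. -/
def gradLen (χ : Pt n → ℝ) (x : Pt n) : ℝ := √(∑ a, pd a χ x ^ 2)

lemma abs_pd_le_gradLen (χ : Pt n → ℝ) (x : Pt n) (a : Fin n) : |pd a χ x| ≤ gradLen χ x :=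
  Real.abs_le_sqrt (Finset.single_le_sum (f := fun a => pd a χ x ^ 2) (fun _ _ => sq_nonneg _)
    (Finset.mem_univ a))

lemma continuous_gradLen {χ : Pt n → ℝ} (hχ : ContDiff ℝ 1 χ) : Continuous (gradLen χ) :=
  (continuous_finsetSum _ fun a _ => (continuous_pd hχ a).pow 2).sqrt

lemma integral_weight_le [NeZero n] {ι : Type*} [Fintype ι] {x₁ : Pt n} {ρ : ℝ}
    {G : Fin n → Fin n → Pt n → ℝ} {l K M A C τ : ℝ}
    (hG : IsEllipticOn (Metric.closedBall x₁ ρ) G l K) {ω : ι → Fin n → Fin n → Pt n → ℝ}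
    (hω : ∀ k b c, ContDiff ℝ 1 (ω k b c)) (hanti : ∀ k b c x, ω k b c x = -ω k c b x)
    (hD : ∀ x ∈ Metric.closedBall x₁ ρ, ∀ k a b c,
      |pd a (ω k b c) x + pd b (ω k c a) x + pd c (ω k a b) x| ≤ M * √(famSq ω x))
    (hδ : ∀ x ∈ Metric.closedBall x₁ ρ, ∀ k b,
      |∑ a, ∑ e, G a e x * pd e (ω k a b) x| ≤ M * √(famSq ω x))
    {ψ : Pt n → ℝ} (hψ : ContDiff ℝ 2 ψ) (hC : 0 ≤ C)
    (hcar : ∀ v, IsTwoFormOn (Metric.closedBall x₁ ρ) v →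
      (∀ x, 1 / 2 < |A * ψ x| → normSq v x = 0) →
      τ * ∫ x, normSq v x ≤
        C * ∫ x, conjSq G (fun x => τ * (1 + A * ψ x)) (fun a => pd a ψ) v x)
    {χ : Pt n → ℝ} (hχ : ContDiff ℝ 1 χ) (hχs : tsupport χ ⊆ Metric.closedBall x₁ ρ)
    (hχψ : ∀ x ∈ tsupport χ, |A * ψ x| ≤ 1 / 2) :
    τ * ∫ x, Real.exp (τ * (ψ x + A / 2 * ψ x ^ 2)) ^ 2 * (χ x ^ 2 * famSq ω x) ≤
      C * Fintype.card ι * (((2 * n ^ 3 + 2 * n) * M ^ 2) *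
        (∫ x, Real.exp (τ * (ψ x + A / 2 * ψ x ^ 2)) ^ 2 * (χ x ^ 2 * famSq ω x))
      + (18 * n ^ 3 + 2 * n ^ 5 * K ^ 2) *
        ∫ x, Real.exp (τ * (ψ x + A / 2 * ψ x ^ 2)) ^ 2 * (gradLen χ x ^ 2 * famSq ω x)) := by
  have hB := isCompact_closedBall x₁ ρ
  have hψ1 : ContDiff ℝ 1 ψ := hψ.of_le (by norm_num)
  have hE := contDiff_exp_weight hψ1 A τ
  have hEp := pd_exp_weight hψ1 A τ
  set E : Pt n → ℝ := fun x => Real.exp (τ * (ψ x + A / 2 * ψ x ^ 2)) with hEdef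
  set κ : Pt n → ℝ := fun x => τ * (1 + A * ψ x) with hκ
  set p : Fin n → Pt n → ℝ := fun a => pd a ψ with hp
  have hpc : ∀ a, Continuous (p a) := fun a => continuous_pd hψ1 a
  have hκc : Continuous κ := by
    have := hψ.continuous
    rw [hκ]; fun_prop
  have hGc := fun a b => (hG.contDiff a b).continuous
  set v : ι → Fin n → Fin n → Pt n → ℝ := fun k b c y => E y * (χ y * ω k b c y) with hvdef
  have hv : ∀ k, IsTwoFormOn (Metric.closedBall x₁ ρ) (v k) := fun k => by
    refine ⟨fun b c => hE.mul (hχ.mul (hω k b c)), fun b c => ?_, fun b c x => ?_⟩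
    · exact ((tsupport_mul_subset_right).trans tsupport_mul_subset_left).trans hχs
    · simp only [hvdef]; rw [hanti k b c x]; ring
  have hvn : ∀ k x, normSq (v k) x = E x ^ 2 * (χ x ^ 2 * normSq (ω k) x) := fun k x => by
    simp only [normSq, hvdef, Finset.mul_sum]
    iterate 2 refine Finset.sum_congr rfl fun _ _ => ?_
    ring
  have hvs : ∀ x, ∑ k, normSq (v k) x = E x ^ 2 * (χ x ^ 2 * famSq ω x) := fun x => by
    simp only [hvn, famSq, Finset.mul_sum]
  have hfc : Continuous (famSq ω) := by
    have := fun k b c => (hω k b c).continuous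
    unfold famSq normSq; fun_prop
  have hχ0 : ∀ x ∉ Metric.closedBall x₁ ρ, χ x = 0 := fun x hx =>
    image_eq_zero_of_notMem_tsupport fun h => hx (hχs h)
  have hχ1 : ∀ x ∉ Metric.closedBall x₁ ρ, gradLen χ x = 0 := fun x hx => by
    have : x ∉ tsupport (fderiv ℝ χ) := fun h => hx (hχs (tsupport_fderiv_subset ℝ h))
    simp [gradLen, pd, image_eq_zero_of_notMem_tsupport this]
  have i1 : Integrable fun x => E x ^ 2 * (χ x ^ 2 * famSq ω x) := by
    refine integrable_of_forall_notMem_eq_zero hB ?_ fun x hx => by simp [hχ0 x hx]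
    exact (hE.continuous.pow 2).mul ((hχ.continuous.pow 2).mul hfc)
  have i2 : Integrable fun x => E x ^ 2 * (gradLen χ x ^ 2 * famSq ω x) := by
    refine integrable_of_forall_notMem_eq_zero hB ?_ fun x hx => by simp [hχ1 x hx]
    exact (hE.continuous.pow 2).mul (((continuous_gradLen hχ).pow 2).mul hfc)
  have key : ∀ k, ∫ x, conjSq G κ p (v k) x ≤ ((2 * n ^ 3 + 2 * n) * M ^ 2) *
        (∫ x, E x ^ 2 * (χ x ^ 2 * famSq ω x))
      + (18 * n ^ 3 + 2 * n ^ 5 * K ^ 2) * ∫ x, E x ^ 2 * (gradLen χ x ^ 2 * famSq ω x) := by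
    intro k
    rw [← integral_const_mul, ← integral_const_mul, ← integral_add (i1.const_mul _)
      (i2.const_mul _)]
    refine integral_mono ((hv k).integrable_conjSq hB hGc hκc hpc)
      ((i1.const_mul _).add (i2.const_mul _)) fun x => ?_
    by_cases hx : x ∈ Metric.closedBall x₁ ρ
    · have h := conjSq_mul_mul_le (G := G) (κ := κ) (p := p) (q := √(famSq ω x)) hE hχ (hω k) hEp
        (fun a b => hG.bound x hx a b)
        (Real.sqrt_nonneg _) (fun b c => abs_le_sqrt_famSq ω x k b c)
        (fun a => abs_pd_le_gradLen χ x a) (M := M)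
        (fun a b c => by simpa [conjD] using hD x hx k a b c)
        (fun b => by simpa [conjDiv] using hδ x hx k b)
      rw [Real.sq_sqrt (famSq_nonneg ω x)] at h
      exact h
    · simp [(hv k).conjSq_eq_zero G κ p hx, hχ0 x hx, hχ1 x hx]
  have hin : ∀ k, Integrable (normSq (v k)) := fun k => (hv k).integrable_normSq hB
  have hcar' : ∀ k, τ * ∫ x, normSq (v k) x ≤ C * _ := fun k =>
    (hcar (v k) (hv k) fun x hx => by
      have : x ∉ tsupport χ := fun h => absurd (hχψ x h) (not_le.2 hx)
      rw [hvn, image_eq_zero_of_notMem_tsupport this]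
      ring).trans (mul_le_mul_of_nonneg_left (key k) hC)
  change τ * (∫ x, E x ^ 2 * (χ x ^ 2 * famSq ω x)) ≤ C * Fintype.card ι * (_ *
    (∫ x, E x ^ 2 * (χ x ^ 2 * famSq ω x)) + _ * ∫ x, E x ^ 2 * (gradLen χ x ^ 2 * famSq ω x))
  simp only [← hvs] at hcar' ⊢
  rw [integral_finsetSum _ fun k _ => hin k, Finset.mul_sum]
  rw [integral_finsetSum _ fun k _ => hin k] at hcar'
  refine (sum_le_card_mul hcar').trans (le_of_eq (by ring))

end LocalUniqueContinuation

section TouchingSphere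

open MeasureTheory Filter Topology

variable {n : ℕ}

lemma gradLen_eq_zero_of_mem_ball {x₁ : Pt n} (χ : ContDiffBump x₁) {x : Pt n}
    (hx : x ∈ Metric.ball x₁ χ.rIn) : gradLen χ x = 0 := by
  have h : (χ : Pt n → ℝ) =ᶠ[𝓝 x] fun _ => 1 := χ.eventuallyEq_one_of_mem_ball hx
  simp [gradLen, pd, h.fderiv_eq]

lemma nonpos_of_forall_mul_le {a b t : ℝ} (h : ∀ τ, t ≤ τ → τ * a ≤ b) : a ≤ 0 := by
  by_contra! ha
  have h1 := h (max t ((b + 1) / a)) (le_max_left _ _)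
  have h2 : (b + 1) / a * a ≤ max t ((b + 1) / a) * a :=
    mul_le_mul_of_nonneg_right (le_max_right _ _) ha.le
  rw [div_mul_cancel₀ _ ha.ne'] at h2
  linarith

/-- Absorbing argument: an exponentially weighted estimate forces vanishing. -/
lemma integral_nonpos_of_weighted {φ q q₁ q₂ : Pt n → ℝ} {β t a b : ℝ}
    (hφ : Continuous φ) (hi : Integrable q) (hi₂ : Integrable q₂)
    (hc : Continuous q₁) (hs₁ : HasCompactSupport q₁) (hc₂ : Continuous q₂)
    (hs₂ : HasCompactSupport q₂) (hb : 0 ≤ b)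
    (hq : ∀ x, 0 ≤ q x) (hq₁ : ∀ x, q x ≤ q₁ x) (hlow : ∀ x, q x ≠ 0 → -β ≤ φ x)
    (hq₁' : ∀ x, 0 ≤ q₁ x) (hq₂ : ∀ x, 0 ≤ q₂ x) (hup : ∀ x, q₂ x ≠ 0 → φ x ≤ -β)
    (h : ∀ τ, t ≤ τ → τ * ∫ x, Real.exp (τ * φ x) ^ 2 * q₁ x ≤
      a * (∫ x, Real.exp (τ * φ x) ^ 2 * q₁ x) + b * ∫ x, Real.exp (τ * φ x) ^ 2 * q₂ x) :
    ∫ x, q x ≤ 0 := by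
  refine nonpos_of_forall_mul_le (t := max 1 (max t (2 * a))) (b := 2 * b * ∫ x, q₂ x)
    fun τ hτ => ?_
  have hτ1 : 1 ≤ τ := (le_max_left _ _).trans hτ
  have hτt : t ≤ τ := ((le_max_left _ _).trans (le_max_right _ _)).trans hτ
  have hτa : 2 * a ≤ τ := ((le_max_right _ _).trans (le_max_right _ _)).trans hτ
  have hE : Continuous fun x => Real.exp (τ * φ x) ^ 2 := by fun_prop
  have j₁ : Integrable fun x => Real.exp (τ * φ x) ^ 2 * q₁ x :=
    (hE.mul hc).integrable_of_hasCompactSupport hs₁.mul_left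
  have j₂ : Integrable fun x => Real.exp (τ * φ x) ^ 2 * q₂ x :=
    (hE.mul hc₂).integrable_of_hasCompactSupport hs₂.mul_left
  set e := Real.exp (τ * -β) ^ 2 with he
  have hepos : 0 < e := by positivity
  have l₁ : e * ∫ x, q x ≤ ∫ x, Real.exp (τ * φ x) ^ 2 * q₁ x := by
    rw [← integral_const_mul]
    refine integral_mono (hi.const_mul _) j₁ fun x => ?_
    by_cases hx : q x = 0
    · simp only [hx, mul_zero]
      exact mul_nonneg (sq_nonneg _) (hq₁' x)
    · refine mul_le_mul ?_ (hq₁ x) (hq x) (sq_nonneg _)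
      exact pow_le_pow_left₀ (Real.exp_pos _).le (Real.exp_le_exp.2
        (mul_le_mul_of_nonneg_left (hlow x hx) (by linarith))) 2
  have l₂ : ∫ x, Real.exp (τ * φ x) ^ 2 * q₂ x ≤ e * ∫ x, q₂ x := by
    rw [← integral_const_mul]
    refine integral_mono j₂ (hi₂.const_mul _) fun x => ?_
    by_cases hx : q₂ x = 0
    · simp [hx]
    · refine mul_le_mul_of_nonneg_right ?_ (hq₂ x)
      exact pow_le_pow_left₀ (Real.exp_pos _).le (Real.exp_le_exp.2
        (mul_le_mul_of_nonneg_left (hup x hx) (by linarith))) 2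
  have h0 : 0 ≤ ∫ x, Real.exp (τ * φ x) ^ 2 * q₁ x :=
    integral_nonneg fun x => mul_nonneg (sq_nonneg _) (hq₁' x)
  have h1 := h τ hτt
  set I := ∫ x, Real.exp (τ * φ x) ^ 2 * q₁ x
  have h2 : τ * I ≤ 2 * b * (e * ∫ x, q₂ x) := by
    have := mul_le_mul_of_nonneg_left l₂ hb
    nlinarith
  have h3 : τ * (e * ∫ x, q x) ≤ τ * I := mul_le_mul_of_nonneg_left l₁ (by linarith)
  refine le_of_mul_le_mul_left ?_ hepos
  calc e * (τ * ∫ x, q x) = τ * (e * ∫ x, q x) := by ring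
    _ ≤ _ := h3.trans h2
    _ = _ := by ring

/-- A solution of a first-order elliptic inequality vanishing inside a sphere vanishes near each
point of that sphere. -/
theorem eventually_eq_zero_of_dirac_bound [NeZero n] {ι : Type*} [Fintype ι] {x₀ x₁ : Pt n}
    (hne : x₀ ≠ x₁) {ρ : ℝ} (hρ : 0 < ρ) {G : Fin n → Fin n → Pt n → ℝ} {l K M : ℝ}
    (hG : IsEllipticOn (Metric.closedBall x₁ ρ) G l K) {ω : ι → Fin n → Fin n → Pt n → ℝ}
    (hω : ∀ k b c, ContDiff ℝ 1 (ω k b c)) (hanti : ∀ k b c x, ω k b c x = -ω k c b x)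
    (hD : ∀ x ∈ Metric.closedBall x₁ ρ, ∀ k a b c,
      |pd a (ω k b c) x + pd b (ω k c a) x + pd c (ω k a b) x| ≤ M * √(famSq ω x))
    (hδ : ∀ x ∈ Metric.closedBall x₁ ρ, ∀ k b,
      |∑ a, ∑ e, G a e x * pd e (ω k a b) x| ≤ M * √(famSq ω x))
    (h0 : ∀ x ∈ Metric.closedBall x₁ ρ, ∑ i, (x i - x₀ i) ^ 2 < ∑ i, (x₁ i - x₀ i) ^ 2 →
      ∀ k b c, ω k b c x = 0) :
    ∀ᶠ x in 𝓝 x₁, ∀ k b c, ω k b c x = 0 := by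
  set ψ := sphereWeight x₀ x₁ with hψdef
  have hψ : ContDiff ℝ 2 ψ := contDiff_sphereWeight x₀ x₁ (m := 2)
  have hψc := hψ.continuous
  have hψ1 : ∀ a, ContDiff ℝ 1 (pd a ψ) := fun a =>
    (hψ.fderiv_right (m := 1) (by norm_num)).clm_apply contDiff_const
  have hpos := lenSq_sphereWeight_pos hG hne (Metric.mem_closedBall_self hρ.le)
  have hlc := (hG.contDiff_lenSq hψ1).continuous
  have hev : ∀ᶠ x in 𝓝 x₁, lenSq G (fun a => pd a ψ) x₁ / 2 ≤ lenSq G (fun a => pd a ψ) x :=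
    (hlc.continuousAt.eventually (lt_mem_nhds (half_lt_self hpos))).mono fun x hx => hx.le
  obtain ⟨ρ', hρ', hsub⟩ := Metric.nhds_basis_closedBall.eventually_iff.1 hev
  set ρ₁ := min ρ ρ' with hρ₁
  have hρ₁pos : 0 < ρ₁ := lt_min hρ hρ'
  have hBB : Metric.closedBall x₁ ρ₁ ⊆ Metric.closedBall x₁ ρ :=
    Metric.closedBall_subset_closedBall (min_le_left _ _)
  obtain ⟨K', hG', hw⟩ := exists_weightBounds (isCompact_closedBall x₁ ρ₁)
    (hG.mono hBB le_rfl) hψ1 (half_pos hpos)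
    fun x hx => hsub (Metric.closedBall_subset_closedBall (min_le_right _ _) hx)
  obtain ⟨A, hA, C, hC, hcar⟩ := exists_carleman (isCompact_closedBall x₁ ρ₁) hG' hψ hw
    ⟨x₁, Metric.mem_closedBall_self hρ₁pos.le⟩
  have hψx₁ : ψ x₁ = 0 := by rw [hψdef, sphereWeight_eq]; simp
  have hev2 : ∀ᶠ x in 𝓝 x₁, |A * ψ x| ≤ 1 / 2 := by
    have : Tendsto (fun x => |A * ψ x|) (𝓝 x₁) (𝓝 |A * ψ x₁|) :=
      ((hψc.const_mul A).abs).continuousAt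
    rw [hψx₁, mul_zero, abs_zero] at this
    exact (this.eventually (gt_mem_nhds (by norm_num : (0 : ℝ) < 1 / 2))).mono fun x hx => hx.le
  obtain ⟨δ', hδ'pos, hδ'⟩ := Metric.nhds_basis_closedBall.eventually_iff.1 hev2
  obtain ⟨δ, hδpos, hδ1, hδ2⟩ : ∃ δ : ℝ, 0 < δ ∧ 2 * δ ≤ ρ₁ ∧ 2 * δ ≤ δ' :=
    ⟨min ρ₁ δ' / 2, by positivity, by linarith [min_le_left ρ₁ δ'],
      by linarith [min_le_right ρ₁ δ']⟩
  set φ : Pt n → ℝ := fun x => ψ x + A / 2 * ψ x ^ 2 with hφ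
  have hφc : Continuous φ := by rw [hφ]; fun_prop
  obtain ⟨β, hβ⟩ : ∃ β : ℝ, β = 3 * δ ^ 2 / 8 := ⟨_, rfl⟩
  have hβpos : 0 < β := by rw [hβ]; positivity
  have hev3 : ∀ᶠ x in 𝓝 x₁, -β ≤ φ x :=
    (hφc.continuousAt.eventually (lt_mem_nhds (by simp [hφ, hψx₁, hβpos] : -β < φ x₁))).mono
      fun x hx => hx.le
  obtain ⟨ε', hε'pos, hε'⟩ := Metric.nhds_basis_closedBall.eventually_iff.1 hev3
  let χ : ContDiffBump x₁ := ⟨δ, 2 * δ, hδpos, by linarith⟩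
  have hεpos : 0 < min ε' δ := lt_min hε'pos hδpos
  let χ₂ : ContDiffBump x₁ := ⟨min ε' δ / 2, min ε' δ, half_pos hεpos, half_lt_self hεpos⟩
  have hχ : ContDiff ℝ 1 χ := χ.contDiff
  have hfc : Continuous (famSq ω) := by
    have := fun k b c => (hω k b c).continuous
    unfold famSq normSq; fun_prop
  have hχs : tsupport χ = Metric.closedBall x₁ (2 * δ) := χ.tsupport_eq
  have hgs : HasCompactSupport (gradLen χ) := by
    refine HasCompactSupport.intro (isCompact_closedBall x₁ (2 * δ)) fun x hx => ?_
    have : x ∉ tsupport (fderiv ℝ χ) := fun h => hx (hχs ▸ tsupport_fderiv_subset ℝ h)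
    simp [gradLen, pd, image_eq_zero_of_notMem_tsupport this]
  have c₁ : Continuous fun x => χ x ^ 2 * famSq ω x := (hχ.continuous.pow 2).mul hfc
  have s₁ : HasCompactSupport fun x => χ x ^ 2 * famSq ω x :=
    HasCompactSupport.mul_right (by
      simp only [sq]
      exact χ.hasCompactSupport.mul_right (f' := χ))
  have c₂ : Continuous fun x => gradLen χ x ^ 2 * famSq ω x :=
    ((continuous_gradLen hχ).pow 2).mul hfc
  have s₂ : HasCompactSupport fun x => gradLen χ x ^ 2 * famSq ω x :=
    HasCompactSupport.mul_right (by
      simp only [sq]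
      exact hgs.mul_right (f' := gradLen χ))
  have c₀ : Continuous fun x => χ₂ x * famSq ω x := χ₂.continuous.mul hfc
  have s₀ : HasCompactSupport fun x => χ₂ x * famSq ω x := χ₂.hasCompactSupport.mul_right
  have n₀ : ∀ x, 0 ≤ χ₂ x * famSq ω x := fun x => mul_nonneg χ₂.nonneg (famSq_nonneg ω x)
  have hχ₂0 : ∀ x, χ₂ x ≠ 0 → x ∈ Metric.ball x₁ (min ε' δ) := fun x hx => by
    have : x ∈ Function.support χ₂ := hx
    rwa [χ₂.support_eq] at this
  have hle : ∫ x, χ₂ x * famSq ω x ≤ 0 := by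
    refine integral_nonpos_of_weighted (φ := φ) (q₁ := fun x => χ x ^ 2 * famSq ω x)
      (q₂ := fun x => gradLen χ x ^ 2 * famSq ω x) (β := β) (t := 1)
      (a := C * Fintype.card ι * ((2 * n ^ 3 + 2 * n) * M ^ 2))
      (b := C * Fintype.card ι * (18 * n ^ 3 + 2 * n ^ 5 * K' ^ 2)) hφc
      (c₀.integrable_of_hasCompactSupport s₀)
      (c₂.integrable_of_hasCompactSupport s₂) c₁ s₁ c₂ s₂ (by positivity) n₀ ?_ ?_
      (fun x => mul_nonneg (sq_nonneg _) (famSq_nonneg ω x))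
      (fun x => mul_nonneg (sq_nonneg _) (famSq_nonneg ω x)) ?_ ?_
    · intro x
      refine mul_le_mul_of_nonneg_right ?_ (famSq_nonneg ω x)
      by_cases hx : χ₂ x = 0
      · rw [hx]; positivity
      · have : χ x = 1 := χ.one_of_mem_closedBall
          (Metric.closedBall_subset_closedBall (min_le_right _ _)
            (Metric.ball_subset_closedBall (hχ₂0 x hx)))
        rw [this, one_pow]
        exact χ₂.le_one
    · intro x hx
      exact hε' (Metric.closedBall_subset_closedBall (min_le_left _ _)
        (Metric.ball_subset_closedBall (hχ₂0 x (left_ne_zero_of_mul hx))))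
    · intro x hx
      have hg : gradLen χ x ≠ 0 := fun h => hx (by simp [h])
      have hQ : famSq ω x ≠ 0 := right_ne_zero_of_mul hx
      have hx2 : x ∈ Metric.closedBall x₁ (2 * δ) := by
        by_contra h
        refine hg ?_
        have : x ∉ tsupport (fderiv ℝ χ) := fun h' => h (hχs ▸ tsupport_fderiv_subset ℝ h')
        simp [gradLen, pd, image_eq_zero_of_notMem_tsupport this]
      have hx1 : x ∉ Metric.ball x₁ δ := fun h => hg (gradLen_eq_zero_of_mem_ball χ h)
      have hxρ : x ∈ Metric.closedBall x₁ ρ :=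
        hBB (Metric.closedBall_subset_closedBall hδ1 hx2)
      have hr : ∑ i, (x₁ i - x₀ i) ^ 2 ≤ ∑ i, (x i - x₀ i) ^ 2 := by
        by_contra! h
        exact hQ (by simp [famSq, normSq, h0 x hxρ h])
      have hd := sq_le_sum_sq_of_notMem_ball hδpos hx1
      have hs : ψ x ≤ -δ ^ 2 / 2 := by rw [hψdef, sphereWeight_eq]; linarith
      have := weight_convex_le (hs.trans (by nlinarith))
        (hδ' (Metric.closedBall_subset_closedBall hδ2 hx2))
      simp only [hφ, hβ]
      linarith
    · intro τ hτ
      refine (integral_weight_le hG' hω hanti (fun x hx => hD x (hBB hx))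
        (fun x hx => hδ x (hBB hx)) hψ hC (fun v hv hv' => hcar τ hτ v hv hv') hχ
        (hχs ▸ Metric.closedBall_subset_closedBall hδ1) (fun x hx =>
          hδ' (Metric.closedBall_subset_closedBall hδ2 (hχs ▸ hx)))).trans (le_of_eq ?_)
      ring
  have hzero : ∀ x, χ₂ x * famSq ω x = 0 := by
    by_contra! h
    obtain ⟨x, hx⟩ := h
    exact absurd hle (not_le.2 (c₀.integral_pos_of_hasCompactSupport_nonneg_nonzero s₀ n₀ hx))
  filter_upwards [χ₂.eventuallyEq_one] with x hx k b c
  have h1 := hzero x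
  rw [hx, Pi.one_apply, one_mul] at h1
  have := abs_le_sqrt_famSq ω x k b c
  rw [h1, Real.sqrt_zero] at this
  exact abs_nonpos_iff.1 this

end TouchingSphere

section Localization

open Filter Topology

variable {n : ℕ} {J : Type*} [Fintype J]

/-- `f` is locally bounded by a multiple of `∑ |uⱼ|` on `U`. -/
def LinBound (U : Set (Pt n)) (u : J → Pt n → ℝ) (f : Pt n → ℝ) : Prop :=
  ∀ x ∈ U, ∃ M : ℝ, ∀ᶠ y in 𝓝 x, |f y| ≤ M * ∑ j, |u j y|

namespace LinBound

variable {U : Set (Pt n)} {u : J → Pt n → ℝ} {f h : Pt n → ℝ}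

lemma zero : LinBound U u fun _ => 0 := fun x _ => ⟨0, by simp⟩

lemma of_mem (j : J) : LinBound U u (u j) := fun x _ => ⟨1, Eventually.of_forall fun y => by
  rw [one_mul]
  exact Finset.single_le_sum (f := fun j => |u j y|) (fun _ _ => abs_nonneg _) (Finset.mem_univ j)⟩

lemma add (hf : LinBound U u f) (hh : LinBound U u h) : LinBound U u fun y => f y + h y := by
  intro x hx
  obtain ⟨M, hM⟩ := hf x hx
  obtain ⟨N, hN⟩ := hh x hx
  refine ⟨M + N, ?_⟩
  filter_upwards [hM, hN] with y h1 h2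
  rw [add_mul]
  exact (abs_add_le _ _).trans (add_le_add h1 h2)

lemma neg (hf : LinBound U u f) : LinBound U u fun y => -f y := by
  simpa only [LinBound, abs_neg] using hf

lemma sub (hf : LinBound U u f) (hh : LinBound U u h) : LinBound U u fun y => f y - h y := by
  simpa only [sub_eq_add_neg] using hf.add hh.neg

lemma sum {κ : Type*} (s : Finset κ) {F : κ → Pt n → ℝ} (hF : ∀ i ∈ s, LinBound U u (F i)) :
    LinBound U u fun y => ∑ i ∈ s, F i y := by
  classical
  induction s using Finset.induction_on with
  | empty => simpa using zero
  | insert a s ha ih =>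
    simp only [Finset.sum_insert ha]
    exact (hF a (Finset.mem_insert_self a s)).add
      (ih fun i hi => hF i (Finset.mem_insert_of_mem hi))

lemma mul_left (hU : IsOpen U) (hh : ContinuousOn h U) (hf : LinBound U u f) :
    LinBound U u fun y => h y * f y := by
  intro x hx
  obtain ⟨M, hM⟩ := hf x hx
  have hc : ∀ᶠ y in 𝓝 x, |h y| < |h x| + 1 :=
    ((hh.continuousAt (hU.mem_nhds hx)).abs.eventually (gt_mem_nhds (lt_add_one _)))
  refine ⟨(|h x| + 1) * M, ?_⟩
  filter_upwards [hM, hc] with y h1 h2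
  rw [abs_mul, mul_assoc]
  exact mul_le_mul h2.le h1 (abs_nonneg _) (by positivity)

lemma mul_right (hU : IsOpen U) (hf : LinBound U u f) (hh : ContinuousOn h U) :
    LinBound U u fun y => f y * h y := by
  simpa only [mul_comm] using hf.mul_left hU hh

lemma congr (hU : IsOpen U) (hf : LinBound U u f) (he : ∀ y ∈ U, h y = f y) :
    LinBound U u h := by
  intro x hx
  obtain ⟨M, hM⟩ := hf x hx
  refine ⟨M, ?_⟩
  filter_upwards [hM, hU.mem_nhds hx] with y h1 h2
  rwa [he y h2]

end LinBound

lemma exists_uniform_bound {κ : Type*} [Finite κ] {U : Set (Pt n)} {u : J → Pt n → ℝ}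
    {F : κ → Pt n → ℝ} (hF : ∀ i, LinBound U u (F i)) {x : Pt n} (hx : x ∈ U) :
    ∃ M, 0 ≤ M ∧ ∀ᶠ y in 𝓝 x, ∀ i, |F i y| ≤ M * ∑ j, |u j y| := by
  have := Fintype.ofFinite κ
  choose M hM using fun i => hF i x hx
  refine ⟨∑ i, |M i|, Finset.sum_nonneg fun _ _ => abs_nonneg _, ?_⟩
  refine eventually_all.2 fun i => (hM i).mono fun y hy => hy.trans ?_
  refine mul_le_mul_of_nonneg_right ?_ (Finset.sum_nonneg fun _ _ => abs_nonneg _)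
  exact (le_abs_self _).trans (Finset.single_le_sum (f := fun i => |M i|)
    (fun _ _ => abs_nonneg _) (Finset.mem_univ i))

lemma contDiff_bump_mul {U : Set (Pt n)} (hU : IsOpen U) {x₁ : Pt n} (θ : ContDiffBump x₁)
    (hθ : Metric.closedBall x₁ θ.rOut ⊆ U) {f : Pt n → ℝ} (hf : ContDiffOn ℝ 1 f U) :
    ContDiff ℝ 1 fun x => θ x * f x := by
  refine contDiff_iff_contDiffAt.2 fun x => ?_
  by_cases hx : x ∈ tsupport θ
  · rw [θ.tsupport_eq] at hx
    exact θ.contDiffAt.mul (hf.contDiffAt (hU.mem_nhds (hθ hx)))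
  · refine contDiffAt_const (c := (0 : ℝ)) |>.congr_of_eventuallyEq ?_
    filter_upwards [notMem_tsupport_iff_eventuallyEq.1 hx] with y hy
    rw [hy, Pi.zero_apply, zero_mul]

lemma exists_ellipticity [NeZero n] {B : Set (Pt n)} (hB : IsCompact B)
    {G : Fin n → Fin n → Pt n → ℝ} (hG : ∀ a b, ContDiff ℝ 1 (G a b))
    (hsymm : ∀ a b x, G a b x = G b a x)
    (hpos : ∀ x ∈ B, ∀ y : Fin n → ℝ, y ≠ 0 → 0 < ∑ a, ∑ b, G a b x * (y a * y b)) :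
    ∃ l K, IsEllipticOn B G l K := by
  obtain ⟨K₁, h₁, hK₁⟩ := exists_forall_abs_le hB (f := fun t : _ × _ => G t.1 t.2)
    fun t => (hG t.1 t.2).continuous
  obtain ⟨K₂, h₂, hK₂⟩ := exists_forall_abs_le hB (f := fun t : _ × _ × _ => pd t.1 (G t.2.1 t.2.2))
    fun t => continuous_pd (hG t.2.1 t.2.2) t.1
  obtain ⟨m, hm, hml⟩ : ∃ m, 0 < m ∧ ∀ x ∈ B, ∀ y ∈ Metric.sphere (0 : Fin n → ℝ) 1,
      m ≤ ∑ a, ∑ b, G a b x * (y a * y b) := by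
    by_cases hBne : (B ×ˢ Metric.sphere (0 : Fin n → ℝ) 1).Nonempty
    · have hc : Continuous fun z : Pt n × (Fin n → ℝ) => ∑ a, ∑ b, G a b z.1 * (z.2 a * z.2 b) := by
        have := fun a b => (hG a b).continuous
        fun_prop
      obtain ⟨z, hz, hz'⟩ := (hB.prod (isCompact_sphere (0 : Fin n → ℝ) 1)).exists_isMinOn hBne
        hc.continuousOn
      refine ⟨_, hpos z.1 hz.1 z.2 ?_, fun x hx y hy => hz' (mk_mem_prod hx hy)⟩
      exact ne_zero_of_mem_unit_sphere (⟨z.2, hz.2⟩ : Metric.sphere (0 : Fin n → ℝ) 1)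
    · exact ⟨1, one_pos, fun x hx y hy => absurd ⟨(x, y), hx, hy⟩ hBne⟩
  have hn : (0 : ℝ) < n := by exact_mod_cast Nat.pos_of_ne_zero (NeZero.ne n)
  refine ⟨m / n, K₁ + K₂, hG, hsymm, by positivity, fun x hx y => ?_,
    fun x hx a b => (hK₁ x hx (a, b)).trans (by linarith),
    fun x hx a b c => (hK₂ x hx (c, a, b)).trans (by linarith)⟩
  by_cases hy : y = 0
  · simp [hy]
  have hy' : 0 < ‖y‖ := norm_pos_iff.2 hy
  have hs : ∑ a, y a ^ 2 ≤ n * ‖y‖ ^ 2 := by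
    refine (Finset.sum_le_card_nsmul _ _ (‖y‖ ^ 2) fun a _ => ?_).trans (by simp)
    rw [← sq_abs]
    exact pow_le_pow_left₀ (abs_nonneg _) (norm_le_pi_norm y a) 2
  have h := hml x hx (‖y‖⁻¹ • y) (by simp [norm_smul, hy'.ne'])
  have e : ∑ a, ∑ b, G a b x * ((‖y‖⁻¹ • y) a * (‖y‖⁻¹ • y) b) =
      (‖y‖⁻¹) ^ 2 * ∑ a, ∑ b, G a b x * (y a * y b) := by
    simp only [Finset.mul_sum, Pi.smul_apply, smul_eq_mul]
    iterate 2 refine Finset.sum_congr rfl fun _ _ => ?_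
    ring
  rw [e] at h
  calc m / n * ∑ a, y a ^ 2 ≤ m / n * (n * ‖y‖ ^ 2) :=
        mul_le_mul_of_nonneg_left hs (by positivity)
    _ = m * ‖y‖ ^ 2 := by field_simp
    _ ≤ (‖y‖⁻¹) ^ 2 * (∑ a, ∑ b, G a b x * (y a * y b)) * ‖y‖ ^ 2 :=
        mul_le_mul_of_nonneg_right h (by positivity)
    _ = _ := by field_simp

/-- Local form of unique continuation across a touching sphere for coefficients and solutions
that are only defined on an open set. -/
theorem eventually_eq_zero_of_linBound [NeZero n] {ι : Type*} [Fintype ι] {U : Set (Pt n)}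
    (hU : IsOpen U) {G : Fin n → Fin n → Pt n → ℝ} (hG : ∀ a b, ContDiffOn ℝ 1 (G a b) U)
    (hsymm : ∀ a b, ∀ x ∈ U, G a b x = G b a x)
    (hpos : ∀ x ∈ U, ∀ y : Fin n → ℝ, y ≠ 0 → 0 < ∑ a, ∑ b, G a b x * (y a * y b))
    {ω : ι → Fin n → Fin n → Pt n → ℝ} (hω : ∀ k b c, ContDiffOn ℝ 1 (ω k b c) U)
    (hanti : ∀ k b c, ∀ x ∈ U, ω k b c x = -ω k c b x)
    (hD : ∀ k a b c, LinBound U (fun t : ι × Fin n × Fin n => ω t.1 t.2.1 t.2.2)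
      fun x => pd a (ω k b c) x + pd b (ω k c a) x + pd c (ω k a b) x)
    (hδ : ∀ k b, LinBound U (fun t : ι × Fin n × Fin n => ω t.1 t.2.1 t.2.2)
      fun x => ∑ a, ∑ e, G a e x * pd e (ω k a b) x)
    {x₀ x₁ : Pt n} (hne : x₀ ≠ x₁) (hx₁ : x₁ ∈ U)
    (h0 : ∀ᶠ x in 𝓝 x₁, ∑ i, (x i - x₀ i) ^ 2 < ∑ i, (x₁ i - x₀ i) ^ 2 →
      ∀ k b c, ω k b c x = 0) :
    ∀ᶠ x in 𝓝 x₁, ∀ k b c, ω k b c x = 0 := by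
  obtain ⟨M₁, hM₁, hD'⟩ := exists_uniform_bound (κ := ι × Fin n × Fin n × Fin n)
    (fun t => hD t.1 t.2.1 t.2.2.1 t.2.2.2) hx₁
  obtain ⟨M₂, hM₂, hδ'⟩ := exists_uniform_bound (κ := ι × Fin n) (fun t => hδ t.1 t.2) hx₁
  obtain ⟨R, hR, hRU⟩ := Metric.nhds_basis_closedBall.mem_iff.1 (hU.mem_nhds hx₁)
  let θ : ContDiffBump x₁ := ⟨R / 2, R, half_pos hR, half_lt_self hR⟩
  have hθU : Metric.closedBall x₁ θ.rOut ⊆ U := hRU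
  have hθ0 : ∀ x ∉ U, θ x = 0 := fun x hx => by
    refine image_eq_zero_of_notMem_tsupport fun h => hx (hθU ?_)
    rwa [θ.tsupport_eq] at h
  have hθ1 : ∀ x ∈ Metric.ball x₁ (R / 2), (θ : Pt n → ℝ) =ᶠ[𝓝 x] fun _ => 1 := fun x hx =>
    θ.eventuallyEq_one_of_mem_ball hx
  obtain ⟨r, hr, hev⟩ := Metric.nhds_basis_closedBall.eventually_iff.1 (hD'.and (hδ'.and h0))
  obtain ⟨ρ, hρ, hρr, hρR⟩ : ∃ ρ : ℝ, 0 < ρ ∧ ρ ≤ r ∧ ρ < R / 2 :=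
    ⟨min r (R / 4), by positivity, min_le_left _ _,
      (min_le_right _ _).trans_lt (by linarith)⟩
  have hball : ∀ x ∈ Metric.closedBall x₁ ρ, x ∈ Metric.ball x₁ (R / 2) :=
    fun x hx => Metric.closedBall_subset_ball hρR hx
  have hxU : ∀ x ∈ Metric.closedBall x₁ ρ, x ∈ U := fun x hx =>
    hRU (Metric.closedBall_subset_closedBall (by linarith) hx)
  have heq : ∀ (f : Pt n → ℝ), ∀ x ∈ Metric.closedBall x₁ ρ, θ x * f x = f x := fun f x hx => by
    rw [(hθ1 x (hball x hx)).eq_of_nhds, one_mul]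
  have hpd : ∀ (f : Pt n → ℝ) (a : Fin n), ∀ x ∈ Metric.closedBall x₁ ρ,
      pd a (fun y => θ y * f y) x = pd a f x := fun f a x hx => by
    have : (fun y => θ y * f y) =ᶠ[𝓝 x] f := (hθ1 x (hball x hx)).mono fun y hy => by
      simp only [hy, one_mul]
    simp only [pd, this.fderiv_eq]
  have hsymm' : ∀ a b x, θ x * G a b x = θ x * G b a x := fun a b x => by
    by_cases hx : x ∈ U
    · rw [hsymm a b x hx]
    · simp [hθ0 x hx]
  obtain ⟨l, K, hell⟩ := exists_ellipticity (isCompact_closedBall x₁ ρ)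
    (G := fun a b x => θ x * G a b x) (fun a b => contDiff_bump_mul hU θ hθU (hG a b)) hsymm'
    fun x hx y hy => by
      simp only [heq _ x hx]
      exact hpos x (hxU x hx) y hy
  set ω' : ι → Fin n → Fin n → Pt n → ℝ := fun k b c x => θ x * ω k b c x with hω'
  have hωx : ∀ x ∈ Metric.closedBall x₁ ρ, ∀ k b c, ω' k b c x = ω k b c x :=
    fun x hx k b c => heq _ x hx
  have hsum : ∀ x ∈ Metric.closedBall x₁ ρ,
      ∑ t : ι × Fin n × Fin n, |ω t.1 t.2.1 t.2.2 x| ≤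
        Fintype.card (ι × Fin n × Fin n) * √(famSq ω' x) := fun x hx =>
    sum_le_card_mul fun t => by
      rw [← hωx x hx]
      exact abs_le_sqrt_famSq ω' x _ _ _
  have key := eventually_eq_zero_of_dirac_bound hne hρ hell (ω := ω')
    (M := (M₁ + M₂) * Fintype.card (ι × Fin n × Fin n))
    (fun k b c => contDiff_bump_mul hU θ hθU (hω k b c)) (fun k b c x => by
      by_cases hx : x ∈ U
      · simp only [hω']; rw [hanti k b c x hx]; ring
      · simp [hω', hθ0 x hx])
    (fun x hx k a b c => by
      simp only [hω', hpd _ _ x hx]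
      refine ((hev (Metric.closedBall_subset_closedBall hρr hx)).1 (k, a, b, c)).trans ?_
      rw [mul_assoc]
      exact mul_le_mul (by linarith) (hsum x hx)
        (Finset.sum_nonneg fun _ _ => abs_nonneg _) (by linarith))
    (fun x hx k b => by
      simp only [hω', hpd _ _ x hx, heq _ x hx]
      refine ((hev (Metric.closedBall_subset_closedBall hρr hx)).2.1 (k, b)).trans ?_
      rw [mul_assoc]
      exact mul_le_mul (by linarith) (hsum x hx)
        (Finset.sum_nonneg fun _ _ => abs_nonneg _) (by linarith))
    (fun x hx hlt k b c => by
      rw [hωx x hx]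
      exact (hev (Metric.closedBall_subset_closedBall hρr hx)).2.2 hlt k b c)
  filter_upwards [key, Metric.closedBall_mem_nhds x₁ hρ] with x h1 h2 k b c
  rw [← hωx x h2]
  exact h1 k b c

end Localization

section GlobalUniqueContinuation

open Filter Topology

variable {n : ℕ}

/-- Unique continuation for solutions of first-order elliptic (Dirac type) inequalities. -/
theorem eq_zero_of_linBound [NeZero n] {ι : Type*} [Fintype ι] {U : Set (Pt n)}
    (hU : IsOpen U) (hUc : IsPreconnected U)
    {G : Fin n → Fin n → Pt n → ℝ} (hG : ∀ a b, ContDiffOn ℝ 1 (G a b) U)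
    (hsymm : ∀ a b, ∀ x ∈ U, G a b x = G b a x)
    (hpos : ∀ x ∈ U, ∀ y : Fin n → ℝ, y ≠ 0 → 0 < ∑ a, ∑ b, G a b x * (y a * y b))
    {ω : ι → Fin n → Fin n → Pt n → ℝ} (hω : ∀ k b c, ContDiffOn ℝ 1 (ω k b c) U)
    (hanti : ∀ k b c, ∀ x ∈ U, ω k b c x = -ω k c b x)
    (hD : ∀ k a b c, LinBound U (fun t : ι × Fin n × Fin n => ω t.1 t.2.1 t.2.2)
      fun x => pd a (ω k b c) x + pd b (ω k c a) x + pd c (ω k a b) x)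
    (hδ : ∀ k b, LinBound U (fun t : ι × Fin n × Fin n => ω t.1 t.2.1 t.2.2)
      fun x => ∑ a, ∑ e, G a e x * pd e (ω k a b) x)
    {O : Set (Pt n)} (hO : IsOpen O) (hOne : O.Nonempty) (hOU : O ⊆ U)
    (h0 : ∀ x ∈ O, ∀ k b c, ω k b c x = 0) :
    ∀ x ∈ U, ∀ k b c, ω k b c x = 0 := by
  obtain ⟨Z, hZ⟩ : ∃ Z : Set (Pt n), Z = {x | ∀ᶠ y in 𝓝 x, ∀ k b c, ω k b c y = 0} := ⟨_, rfl⟩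
  have hZo : IsOpen Z := by
    rw [hZ]
    exact isOpen_setOfPred_eventually_nhds
  have hZ0 : ∀ x ∈ Z, ∀ k b c, ω k b c x = 0 := fun x hx => by
    rw [hZ] at hx
    exact hx.self_of_nhds
  have hOZ : O ⊆ Z := fun x hx => by
    rw [hZ]
    filter_upwards [hO.mem_nhds hx] with y hy using h0 y hy
  suffices hUZ : U ⊆ Z from fun x hx => hZ0 x (hUZ hx)
  obtain ⟨o, ho⟩ := hOne
  refine hUc.subset_of_closure_inter_subset hZo ⟨o, hOU ho, hOZ ho⟩ ?_
  rintro p ⟨hpZ, hpU⟩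
  by_contra hp
  obtain ⟨R, hR, hRU⟩ := Metric.nhds_basis_ball.mem_iff.1 (hU.mem_nhds hpU)
  have hlt : ∀ x y : Pt n, ∑ i, (x i - y i) ^ 2 < (R / 2) ^ 2 → dist x y < R / 2 :=
    fun x y h => by
      by_contra! hd
      refine absurd h (not_lt.2 (sq_le_sum_sq_of_notMem_ball (half_pos hR) fun hb => ?_))
      exact absurd (Metric.mem_ball.1 hb) (not_lt.2 hd)
  obtain ⟨x₀, hx₀, hx₀Z⟩ : ({y | ∑ i, (p i - y i) ^ 2 < (R / 2) ^ 2} ∩ Z).Nonempty := by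
    refine mem_closure_iff.1 hpZ _ ?_ ?_
    · exact isOpen_lt (by fun_prop) continuous_const
    · simp only [mem_ofPred_eq, sub_self]
      simp only [ne_eq, OfNat.ofNat_ne_zero, not_false_eq_true, zero_pow, Finset.sum_const_zero]
      positivity
  have hin : ∀ y : Pt n, ∑ i, (y i - x₀ i) ^ 2 ≤ ∑ i, (p i - x₀ i) ^ 2 → y ∈ Metric.ball p R :=
    fun y hy => by
      rw [Metric.mem_ball]
      have h1 := hlt y x₀ (hy.trans_lt hx₀)
      have h2 := hlt p x₀ hx₀
      rw [dist_comm p x₀] at h2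
      linarith [dist_triangle y x₀ p]
  have hcont : Continuous fun y : Pt n => ∑ i, (y i - x₀ i) ^ 2 := by fun_prop
  have hS : IsCompact ({y : Pt n | ∑ i, (y i - x₀ i) ^ 2 ≤ ∑ i, (p i - x₀ i) ^ 2} ∩ Zᶜ) := by
    refine (isCompact_closedBall p R).of_isClosed_subset
      ((isClosed_le hcont continuous_const).inter hZo.isClosed_compl) ?_
    exact fun y hy => Metric.ball_subset_closedBall (hin y hy.1)
  obtain ⟨x₁, hx₁, hmin⟩ := hS.exists_isMinOn
    ⟨p, le_refl (∑ i, (p i - x₀ i) ^ 2), hp⟩ hcont.continuousOn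
  refine hx₁.2 ?_
  have hne : x₀ ≠ x₁ := fun h => hx₁.2 (h ▸ hx₀Z)
  have := eventually_eq_zero_of_linBound hU hG hsymm hpos hω hanti hD hδ hne
    (hRU (hin x₁ hx₁.1)) (Eventually.of_forall fun x hx => hZ0 x (by
      by_contra hxZ
      exact absurd (hmin ⟨hx.le.trans hx₁.1, hxZ⟩) (not_le.2 hx)))
  rw [hZ]
  exact this

end GlobalUniqueContinuation

section MatrixCalculus

open Filter Topology

variable {n : ℕ} {U : Set (Pt n)}

lemma contDiffOn_pd (hU : IsOpen U) {m : ℕ} {f : Pt n → ℝ} (hf : ContDiffOn ℝ (m + 1) f U)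
    (a : Fin n) : ContDiffOn ℝ m (pd a f) U :=
  (hf.fderiv_of_isOpen hU le_rfl).clm_apply contDiffOn_const

lemma pd_congr (hU : IsOpen U) {f h : Pt n → ℝ} (he : ∀ y ∈ U, f y = h y) (a : Fin n) {x : Pt n}
    (hx : x ∈ U) : pd a f x = pd a h x := by
  have : f =ᶠ[𝓝 x] h := by
    filter_upwards [hU.mem_nhds hx] with y hy using he y hy
  simp only [pd, this.fderiv_eq]

lemma pd_add {f h : Pt n → ℝ} {x : Pt n} (hf : DifferentiableAt ℝ f x)
    (hh : DifferentiableAt ℝ h x) (a : Fin n) :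
    pd a (fun y => f y + h y) x = pd a f x + pd a h x := by
  simp [pd, fderiv_fun_add hf hh]

lemma pd_sub {f h : Pt n → ℝ} {x : Pt n} (hf : DifferentiableAt ℝ f x)
    (hh : DifferentiableAt ℝ h x) (a : Fin n) :
    pd a (fun y => f y - h y) x = pd a f x - pd a h x := by
  simp [pd, fderiv_fun_sub hf hh]

lemma pd_neg (f : Pt n → ℝ) (a : Fin n) (x : Pt n) :
    pd a (fun y => -f y) x = -pd a f x := by
  simp [pd, fderiv_fun_neg]

lemma pd_const (r : ℝ) (a : Fin n) (x : Pt n) : pd a (fun _ => r) x = 0 := by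
  simp [pd]

lemma pd_sum {κ : Type*} (s : Finset κ) {F : κ → Pt n → ℝ} {x : Pt n}
    (hF : ∀ i ∈ s, DifferentiableAt ℝ (F i) x) (a : Fin n) :
    pd a (fun y => ∑ i ∈ s, F i y) x = ∑ i ∈ s, pd a (F i) x := by
  simp [pd, fderiv_fun_sum hF]

lemma pd_pd_comm (hU : IsOpen U) {f : Pt n → ℝ} (hf : ContDiffOn ℝ 2 f U) (a b : Fin n)
    {x : Pt n} (hx : x ∈ U) : pd a (pd b f) x = pd b (pd a f) x := by
  have h2 : ContDiffAt ℝ 2 f x := hf.contDiffAt (hU.mem_nhds hx)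
  have hs := h2.isSymmSndFDerivAt (by simp)
  have hd : DifferentiableAt ℝ (fderiv ℝ f) x :=
    (h2.fderiv_right (m := 1) (by norm_num)).differentiableAt one_ne_zero
  have e : ∀ a b : Fin n, pd a (pd b f) x =
      fderiv ℝ (fderiv ℝ f) x (Pi.single a 1) (Pi.single b 1) := fun a b => by
    have : pd b f = fun y => fderiv ℝ f y (Pi.single b 1) := rfl
    rw [this]
    simp [pd, fderiv_clm_apply hd (differentiableAt_const _)]
  rw [e, e]
  exact hs _ _

/-- Entrywise `C^m` regularity of a matrix-valued function. -/
def MatContDiffOn (m : ℕ) (F : Pt n → Matrix (Fin n) (Fin n) ℝ) (U : Set (Pt n)) : Prop :=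
  ∀ i j, ContDiffOn ℝ m (fun y => F y i j) U

/-- Entrywise partial derivative of a matrix-valued function. -/
def matPd (a : Fin n) (F : Pt n → Matrix (Fin n) (Fin n) ℝ) (x : Pt n) :
    Matrix (Fin n) (Fin n) ℝ :=
  Matrix.of fun i j => pd a (fun y => F y i j) x

lemma differentiableAt_of_contDiffOn (hU : IsOpen U) {m : ℕ} {f : Pt n → ℝ}
    (hf : ContDiffOn ℝ (m + 1) f U) {x : Pt n} (hx : x ∈ U) : DifferentiableAt ℝ f x :=
  (hf.contDiffAt (hU.mem_nhds hx)).differentiableAt (by simp)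

namespace MatContDiffOn

variable {m : ℕ} {F H : Pt n → Matrix (Fin n) (Fin n) ℝ}

lemma of_le (hF : MatContDiffOn m F U) {k : ℕ} (h : k ≤ m) : MatContDiffOn k F U :=
  fun i j => (hF i j).of_le (by exact_mod_cast h)

lemma add (hF : MatContDiffOn m F U) (hH : MatContDiffOn m H U) :
    MatContDiffOn m (fun y => F y + H y) U := fun i j => (hF i j).add (hH i j)

lemma sub (hF : MatContDiffOn m F U) (hH : MatContDiffOn m H U) :
    MatContDiffOn m (fun y => F y - H y) U := fun i j => (hF i j).sub (hH i j)

lemma mul (hF : MatContDiffOn m F U) (hH : MatContDiffOn m H U) :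
    MatContDiffOn m (fun y => F y * H y) U := fun i j => by
  simp only [Matrix.mul_apply]
  exact ContDiffOn.sum fun k _ => (hF i k).mul (hH k j)

lemma transpose (hF : MatContDiffOn m F U) : MatContDiffOn m (fun y => (F y)ᵀ) U :=
  fun i j => hF j i

lemma matPd (hU : IsOpen U) (hF : MatContDiffOn (m + 1) F U) (a : Fin n) :
    MatContDiffOn m (matPd a F) U := fun i j => contDiffOn_pd hU (by exact_mod_cast hF i j) a

lemma differentiableAt (hU : IsOpen U) (hF : MatContDiffOn (m + 1) F U) {x : Pt n} (hx : x ∈ U)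
    (i j : Fin n) : DifferentiableAt ℝ (fun y => F y i j) x :=
  differentiableAt_of_contDiffOn hU (m := m) (by exact_mod_cast hF i j) hx

end MatContDiffOn

variable {F H : Pt n → Matrix (Fin n) (Fin n) ℝ} {x : Pt n}

lemma matPd_congr (hU : IsOpen U) (he : ∀ y ∈ U, F y = H y) (a : Fin n) (hx : x ∈ U) :
    matPd a F x = matPd a H x := by
  ext i j
  exact pd_congr hU (fun y hy => by rw [he y hy]) a hx

lemma matPd_add (hU : IsOpen U) (hF : MatContDiffOn 1 F U) (hH : MatContDiffOn 1 H U) (a : Fin n)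
    (hx : x ∈ U) : matPd a (fun y => F y + H y) x = matPd a F x + matPd a H x := by
  ext i j
  exact pd_add (hF.differentiableAt (m := 0) hU hx i j) (hH.differentiableAt (m := 0) hU hx i j) a

lemma matPd_sub (hU : IsOpen U) (hF : MatContDiffOn 1 F U) (hH : MatContDiffOn 1 H U) (a : Fin n)
    (hx : x ∈ U) : matPd a (fun y => F y - H y) x = matPd a F x - matPd a H x := by
  ext i j
  exact pd_sub (hF.differentiableAt (m := 0) hU hx i j) (hH.differentiableAt (m := 0) hU hx i j) a

lemma matPd_mul (hU : IsOpen U) (hF : MatContDiffOn 1 F U) (hH : MatContDiffOn 1 H U) (a : Fin n)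
    (hx : x ∈ U) : matPd a (fun y => F y * H y) x = matPd a F x * H x + F x * matPd a H x := by
  ext i j
  have dF := hF.differentiableAt (m := 0) hU hx
  have dH := hH.differentiableAt (m := 0) hU hx
  simp only [matPd, Matrix.mul_apply, Matrix.add_apply, Matrix.of_apply]
  rw [pd_sum _ (fun k _ => (dF i k).fun_mul (dH k j)), ← Finset.sum_add_distrib]
  exact Finset.sum_congr rfl fun k _ => pd_mul (dF i k) (dH k j) a

lemma matPd_transpose (F : Pt n → Matrix (Fin n) (Fin n) ℝ) (a : Fin n) (x : Pt n) :
    matPd a (fun y => (F y)ᵀ) x = (matPd a F x)ᵀ := rfl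

lemma matPd_comm (hU : IsOpen U) (hF : MatContDiffOn 2 F U) (a b : Fin n) (hx : x ∈ U) :
    matPd a (matPd b F) x = matPd b (matPd a F) x := by
  ext i j
  exact pd_pd_comm hU (hF i j) a b hx

end MatrixCalculus

section Curvature

variable {n : ℕ} {U : Set (Pt n)} {g : Met n} {x : Pt n}

lemma contDiffOn_det {m : ℕ} {F : Pt n → Matrix (Fin n) (Fin n) ℝ} (hF : MatContDiffOn m F U) :
    ContDiffOn ℝ m (fun y => (F y).det) U := by
  simp only [Matrix.det_apply']
  exact ContDiffOn.sum fun σ _ => contDiffOn_const.mul (contDiffOn_prod fun i _ => hF _ _)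

lemma IsMetricOn.det_ne_zero (hg : IsMetricOn g U) (hx : x ∈ U) : (g x).det ≠ 0 :=
  (hg x hx).2.det_pos.ne'

lemma IsMetricOn.symm (hg : IsMetricOn g U) (hx : x ∈ U) (a b : Fin n) : g x a b = g x b a :=
  (hg x hx).1.apply b a

lemma IsMetricOn.inv_symm (hg : IsMetricOn g U) (hx : x ∈ U) (a b : Fin n) :
    (g x)⁻¹ a b = (g x)⁻¹ b a :=
  ((hg x hx).1.inv).apply b a

lemma IsMetricOn.inv_mul (hg : IsMetricOn g U) (hx : x ∈ U) : (g x)⁻¹ * g x = 1 :=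
  Matrix.nonsing_inv_mul _ (hg.det_ne_zero hx).isUnit

lemma IsMetricOn.mul_inv (hg : IsMetricOn g U) (hx : x ∈ U) : g x * (g x)⁻¹ = 1 :=
  Matrix.mul_nonsing_inv _ (hg.det_ne_zero hx).isUnit

lemma MatContDiffOn.inv (hg : IsMetricOn g U) {m : ℕ} (hr : MatContDiffOn m g U) :
    MatContDiffOn m (fun y => (g y)⁻¹) U := fun i j => by
  simp only [Matrix.inv_def, Matrix.smul_apply, Ring.inverse_eq_inv', smul_eq_mul,
    Matrix.adjugate_apply]
  refine ((contDiffOn_det hr).inv fun y hy => hg.det_ne_zero hy).mul (contDiffOn_det fun k l => ?_)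
  by_cases hk : k = j
  · simp only [Matrix.updateRow_apply, hk, if_true]
    exact contDiffOn_const
  · simp only [Matrix.updateRow_apply, hk, if_false]
    exact hr k l

/-- The connection matrices `(A_a)_{cd} = Γ^d_{ac}`. -/
def conn (g : Met n) (a : Fin n) (x : Pt n) : Matrix (Fin n) (Fin n) ℝ :=
  Matrix.of fun c d => christoffel g d a c x

/-- The curvature matrices `(F_{ab})_{cd} = R_{abc}{}^d`. -/
def curv (g : Met n) (a b : Fin n) (x : Pt n) : Matrix (Fin n) (Fin n) ℝ :=
  Matrix.of fun c d => riemannUp g a b c d x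

lemma curv_eq (g : Met n) (a b : Fin n) (x : Pt n) :
    curv g a b x = matPd a (conn g b) x - matPd b (conn g a) x + conn g b x * conn g a x
      - conn g a x * conn g b x := by
  ext c d
  simp [curv, riemannUp, matPd, conn, Matrix.mul_apply]

lemma matContDiffOn_conn (hU : IsOpen U) (hg : IsMetricOn g U) {m : ℕ}
    (hr : MatContDiffOn (m + 1) g U) (a : Fin n) : MatContDiffOn m (conn g a) U := fun c d => by
  have hi := (hr.of_le (Nat.le_succ m)).inv hg
  have hp := fun i j e => hr.matPd hU (m := m) e i j
  refine contDiffOn_const.mul (ContDiffOn.sum fun e _ => (hi d e).mul ?_)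
  exact ((hp c e a).add (hp a e c)).sub (hp a c e)

lemma matContDiffOn_curv (hU : IsOpen U) (hg : IsMetricOn g U) {m : ℕ}
    (hr : MatContDiffOn (m + 2) g U) (a b : Fin n) : MatContDiffOn m (curv g a b) U := by
  have h := matContDiffOn_conn hU hg (m := m + 1) hr
  have h' := fun a => (h a).of_le (Nat.le_succ m)
  have e : curv g a b = fun x => matPd a (conn g b) x - matPd b (conn g a) x
      + conn g b x * conn g a x - conn g a x * conn g b x := funext fun x => curv_eq g a b x
  rw [e]
  exact ((((h b).matPd hU a).sub ((h a).matPd hU b)).add ((h' b).mul (h' a))).sub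
    ((h' a).mul (h' b))

lemma IsMetricOn.pd_symm (hU : IsOpen U) (hg : IsMetricOn g U) (hx : x ∈ U) (a b c : Fin n) :
    pd c (fun y => g y a b) x = pd c (fun y => g y b a) x :=
  pd_congr hU (fun _ hy => hg.symm hy a b) c hx

lemma christoffel_symm (hU : IsOpen U) (hg : IsMetricOn g U) (hx : x ∈ U) (a b c : Fin n) :
    christoffel g c a b x = christoffel g c b a x := by
  unfold christoffel
  congr 1
  refine Finset.sum_congr rfl fun d _ => ?_
  rw [hg.pd_symm hU hx a b d]
  ring

lemma sum_christoffel_mul (hg : IsMetricOn g U) (hx : x ∈ U) (a b c : Fin n) :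
    ∑ d, christoffel g d a b x * g x d c = 1 / 2 *
      (pd a (fun y => g y b c) x + pd b (fun y => g y a c) x - pd c (fun y => g y a b) x) := by
  obtain ⟨T, hT⟩ : ∃ T : Fin n → ℝ, ∀ d, T d =
      pd a (fun y => g y b d) x + pd b (fun y => g y a d) x - pd d (fun y => g y a b) x :=
    ⟨_, fun _ => rfl⟩
  simp only [christoffel, ← hT]
  have h : ∀ d, ∑ e, (g x)⁻¹ e d * g x e c = (1 : Matrix (Fin n) (Fin n) ℝ) d c := fun d => by
    rw [← hg.inv_mul hx, Matrix.mul_apply]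
    exact Finset.sum_congr rfl fun e _ => by rw [hg.inv_symm hx]
  calc ∑ d, 1 / 2 * (∑ e, (g x)⁻¹ d e * T e) * g x d c
      = 1 / 2 * ∑ e, T e * ∑ d, (g x)⁻¹ d e * g x d c := by
        simp only [Finset.mul_sum, Finset.sum_mul]
        rw [Finset.sum_comm]
        iterate 2 refine Finset.sum_congr rfl fun _ _ => ?_
        ring
    _ = _ := by simp [h, Matrix.one_apply]

/-- Metric compatibility of the Levi-Civita connection. -/
lemma matPd_metric (hU : IsOpen U) (hg : IsMetricOn g U) (hx : x ∈ U) (c : Fin n) :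
    matPd c g x = conn g c x * g x + g x * (conn g c x)ᵀ := by
  ext a b
  have h1 := sum_christoffel_mul hg hx c a b
  have h2 := sum_christoffel_mul hg hx c b a
  have h3 : ∑ d, g x a d * christoffel g d c b x = ∑ d, christoffel g d c b x * g x d a :=
    Finset.sum_congr rfl fun d _ => by rw [hg.symm hx a d, mul_comm]
  have e1 := hg.pd_symm hU hx a b c
  have e2 := hg.pd_symm hU hx c b a
  have e3 := hg.pd_symm hU hx c a b
  simp only [matPd, conn, Matrix.add_apply, Matrix.mul_apply, Matrix.of_apply,
    Matrix.transpose_apply]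
  rw [h3, h1, h2]
  linarith

/-- The second Bianchi identity for the curvature matrices. -/
lemma bianchi_curv (hU : IsOpen U) (hg : IsMetricOn g U) (hr : MatContDiffOn 3 g U) (hx : x ∈ U)
    (a b e : Fin n) :
    matPd e (curv g a b) x + matPd a (curv g b e) x + matPd b (curv g e a) x =
      (conn g e x * curv g a b x - curv g a b x * conn g e x)
      + (conn g a x * curv g b e x - curv g b e x * conn g a x)
      + (conn g b x * curv g e a x - curv g e a x * conn g b x) := by
  have h2 := matContDiffOn_conn hU hg (m := 2) hr
  have h1 := fun a => (h2 a).of_le (k := 1) (by norm_num)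
  have hp := fun a b => (h2 b).matPd (m := 1) hU a
  have hd : ∀ a b e, matPd e (curv g a b) x = matPd e (matPd a (conn g b)) x
      - matPd e (matPd b (conn g a)) x
      + (matPd e (conn g b) x * conn g a x + conn g b x * matPd e (conn g a) x)
      - (matPd e (conn g a) x * conn g b x + conn g a x * matPd e (conn g b) x) := fun a b e => by
    have : curv g a b = fun x => matPd a (conn g b) x - matPd b (conn g a) x
      + conn g b x * conn g a x - conn g a x * conn g b x := funext fun x => curv_eq g a b x
    rw [this, matPd_sub hU (((hp a b).sub (hp b a)).add ((h1 b).mul (h1 a)))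
      ((h1 a).mul (h1 b)) e hx, matPd_add hU ((hp a b).sub (hp b a)) ((h1 b).mul (h1 a)) e hx,
      matPd_sub hU (hp a b) (hp b a) e hx, matPd_mul hU (h1 b) (h1 a) e hx,
      matPd_mul hU (h1 a) (h1 b) e hx]
  simp only [hd, curv_eq]
  rw [matPd_comm hU (h2 b) e a hx, matPd_comm hU (h2 a) e b hx, matPd_comm hU (h2 e) a b hx]
  noncomm_ring

/-- The lowered curvature matrices `(F_{ab} g)_{cd} = R_{abcd}`. -/
lemma curv_mul_apply (g : Met n) (a b c d : Fin n) (x : Pt n) :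
    (curv g a b x * g x) c d = riemannLow g a b c d x := by
  simp [Matrix.mul_apply, curv, riemannLow]

lemma curv_mul_antisymm (hU : IsOpen U) (hg : IsMetricOn g U) (hr : MatContDiffOn 2 g U)
    (hx : x ∈ U) (a b : Fin n) : curv g a b x * g x + g x * (curv g a b x)ᵀ = 0 := by
  have hg1 := hr.of_le (k := 1) (by norm_num)
  have h1 := matContDiffOn_conn hU hg (m := 1) hr
  have hd : ∀ a b, matPd a (matPd b g) x = (matPd a (conn g b) x * g x + conn g b x *
      (conn g a x * g x + g x * (conn g a x)ᵀ)) + ((conn g a x * g x + g x * (conn g a x)ᵀ) *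
      (conn g b x)ᵀ + g x * (matPd a (conn g b) x)ᵀ) := fun a b => by
    rw [matPd_congr hU (fun y hy => matPd_metric hU hg hy b) a hx,
      matPd_add hU ((h1 b).mul hg1) (hg1.mul (h1 b).transpose) a hx,
      matPd_mul hU (h1 b) hg1 a hx, matPd_mul hU hg1 (h1 b).transpose a hx,
      matPd_transpose, matPd_metric hU hg hx a]
  have h := matPd_comm hU hr a b hx
  rw [hd, hd, ← sub_eq_zero] at h
  rw [← h, curv_eq]
  simp only [Matrix.transpose_sub, Matrix.transpose_add, Matrix.transpose_mul]
  noncomm_ring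

lemma riemannLow_antisymm_left (g : Met n) (a b c d : Fin n) (x : Pt n) :
    riemannLow g a b c d x = -riemannLow g b a c d x := by
  have h : curv g a b x = -curv g b a x := by
    rw [curv_eq, curv_eq]
    noncomm_ring
  rw [← curv_mul_apply, ← curv_mul_apply, h, neg_mul, Matrix.neg_apply]

lemma riemannLow_antisymm_right (hU : IsOpen U) (hg : IsMetricOn g U) (hr : MatContDiffOn 2 g U)
    (hx : x ∈ U) (a b c d : Fin n) : riemannLow g a b c d x = -riemannLow g a b d c x := by
  have h := congrFun (congrFun (curv_mul_antisymm hU hg hr hx a b) c) d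
  have e : g x * (curv g a b x)ᵀ = (curv g a b x * g x)ᵀ := by
    rw [Matrix.transpose_mul, (hg x hx).1.eq]
  rw [e, Matrix.add_apply, Matrix.transpose_apply, curv_mul_apply, curv_mul_apply] at h
  simp only [Matrix.zero_apply] at h
  linarith

lemma riemannUp_cyclic (hU : IsOpen U) (hg : IsMetricOn g U) (hx : x ∈ U) (a b c d : Fin n) :
    riemannUp g a b c d x + riemannUp g b c a d x + riemannUp g c a b d x = 0 := by
  have hs := fun a b c => christoffel_symm hU hg hx a b c
  have hp : ∀ a b c e, pd e (christoffel g c a b) x = pd e (christoffel g c b a) x :=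
    fun a b c e => pd_congr hU (fun y hy => christoffel_symm hU hg hy a b c) e hx
  unfold riemannUp
  rw [hp c b d a, hp c a d b, hp b a d c]
  simp only [hs c b, hs c a, hs b a]
  ring

lemma riemannLow_cyclic (hU : IsOpen U) (hg : IsMetricOn g U) (hx : x ∈ U) (a b c d : Fin n) :
    riemannLow g a b c d x + riemannLow g b c a d x + riemannLow g c a b d x = 0 := by
  simp only [riemannLow, ← Finset.sum_add_distrib, ← add_mul, riemannUp_cyclic hU hg hx,
    zero_mul, Finset.sum_const_zero]

lemma riemannLow_pair (hU : IsOpen U) (hg : IsMetricOn g U) (hr : MatContDiffOn 2 g U)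
    (hx : x ∈ U) (a b c d : Fin n) : riemannLow g a b c d x = riemannLow g c d a b x := by
  have l := fun a b c d => riemannLow_antisymm_left g a b c d x
  have r := riemannLow_antisymm_right hU hg hr hx
  have y := riemannLow_cyclic hU hg hx
  linarith [y a b c d, y b c d a, y c d a b, y d a b c, l a b c d, l b c a d, l c a b d, l b c d a,
    l c d b a, l d b c a, l c d a b, l d a c b, l a c d b, l d a b c, l a b d c, l b d a c,
    r a b c d, r b c a d, r c a b d, r b c d a, r c d b a, r d b c a, r c d a b, r d a c b,
    r a c d b, r d a b c, r a b d c, r b d a c]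

lemma ricci_eq (g : Met n) (a b : Fin n) (x : Pt n) :
    ricci g a b x = ∑ c, riemannUp g c a b c x := by
  simp only [ricci, riemannUp, Finset.sum_add_distrib, Finset.sum_sub_distrib]
  congr 2
  exact Finset.sum_comm

lemma riemannUp_eq (hg : IsMetricOn g U) (hx : x ∈ U) (a b c d : Fin n) :
    riemannUp g a b c d x = ∑ e, riemannLow g a b c e x * (g x)⁻¹ e d := by
  have h : (curv g a b x * g x) * (g x)⁻¹ = curv g a b x := by
    rw [Matrix.mul_assoc, hg.mul_inv hx, Matrix.mul_one]
  have := congrFun (congrFun h c) d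
  rw [Matrix.mul_apply] at this
  simp only [curv_mul_apply] at this
  exact this.symm

lemma ricci_eq_sum_low (hg : IsMetricOn g U) (hx : x ∈ U) (a b : Fin n) :
    ricci g a b x = ∑ c, ∑ d, (g x)⁻¹ c d * riemannLow g c a b d x := by
  rw [ricci_eq]
  refine Finset.sum_congr rfl fun c _ => ?_
  rw [riemannUp_eq hg hx]
  exact Finset.sum_congr rfl fun d _ => by rw [hg.inv_symm hx d c, mul_comm]

lemma ricci_symm (hU : IsOpen U) (hg : IsMetricOn g U) (hr : MatContDiffOn 2 g U) (hx : x ∈ U)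
    (a b : Fin n) : ricci g a b x = ricci g b a x := by
  rw [ricci_eq_sum_low hg hx, ricci_eq_sum_low hg hx, Finset.sum_comm]
  iterate 2 refine Finset.sum_congr rfl fun _ _ => ?_
  rw [hg.inv_symm hx, riemannLow_pair hU hg hr hx, riemannLow_antisymm_left,
    riemannLow_antisymm_right hU hg hr hx, neg_neg]

lemma schouten_symm (hU : IsOpen U) (hg : IsMetricOn g U) (hr : MatContDiffOn 2 g U) (hx : x ∈ U)
    (a b : Fin n) : schouten g a b x = schouten g b a x := by
  unfold schouten
  rw [ricci_symm hU hg hr hx a b, hg.symm hx a b]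

end Curvature

section WeylCotton

variable {n : ℕ} {U : Set (Pt n)} {g : Met n} {x : Pt n}

/-- Kulkarni–Nomizu type product of two bilinear forms. -/
def kulk (p q : Fin n → Fin n → ℝ) (a b c d : Fin n) : ℝ :=
  p a c * q b d - p b c * q a d + p b d * q a c - p a d * q b c

lemma weyl_eq (g : Met n) (a b c d : Fin n) (x : Pt n) :
    weyl g a b c d x = riemannLow g a b c d x +
      kulk (fun i j => schouten g i j x) (g x) a b c d := by
  unfold weyl kulk
  ring

lemma IsMetricOn.sum_inv_mul (hg : IsMetricOn g U) (hx : x ∈ U) (a b : Fin n) :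
    ∑ d, (g x)⁻¹ a d * g x d b = if a = b then 1 else 0 := by
  rw [← Matrix.mul_apply, hg.inv_mul hx, Matrix.one_apply]

lemma IsMetricOn.sum_inv_mul_left (hg : IsMetricOn g U) (hx : x ∈ U) (f : Fin n → ℝ) (b : Fin n) :
    ∑ e, ∑ d, (g x)⁻¹ e d * (f e * g x b d) = f b := by
  have h : ∀ e, ∑ d, (g x)⁻¹ e d * (f e * g x b d) = f e * if e = b then 1 else 0 := fun e => by
    rw [← hg.sum_inv_mul hx, Finset.mul_sum]
    exact Finset.sum_congr rfl fun d _ => by rw [hg.symm hx b d]; ring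
  simp [h]

lemma IsMetricOn.sum_inv_mul_right (hg : IsMetricOn g U) (hx : x ∈ U) (f : Fin n → ℝ)
    (b : Fin n) : ∑ e, ∑ d, (g x)⁻¹ e d * (f d * g x e b) = f b := by
  rw [Finset.sum_comm, ← hg.sum_inv_mul_left hx f b]
  iterate 2 refine Finset.sum_congr rfl fun _ _ => ?_
  rw [hg.inv_symm hx, hg.symm hx b]

lemma IsMetricOn.sum_inv_mul_self (hg : IsMetricOn g U) (hx : x ∈ U) :
    ∑ e, ∑ d, (g x)⁻¹ e d * g x e d = n := by
  have h : ∀ e, ∑ d, (g x)⁻¹ e d * g x e d = 1 := fun e => by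
    have := hg.sum_inv_mul hx e e
    rw [if_pos rfl] at this
    rw [← this]
    exact Finset.sum_congr rfl fun d _ => by rw [hg.symm hx]
  simp [h]

lemma weyl_antisymm_left (g : Met n) (a b c d : Fin n) (x : Pt n) :
    weyl g a b c d x = -weyl g b a c d x := by
  rw [weyl_eq, weyl_eq, riemannLow_antisymm_left]
  unfold kulk
  ring

lemma weyl_pair (hU : IsOpen U) (hg : IsMetricOn g U) (hr : MatContDiffOn 2 g U) (hx : x ∈ U)
    (a b c d : Fin n) : weyl g a b c d x = weyl g c d a b x := by
  have p := schouten_symm hU hg hr hx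
  have s := hg.symm hx
  rw [weyl_eq, weyl_eq, riemannLow_pair hU hg hr hx]
  simp only [kulk]
  rw [p c a, p d a, p d b, p c b, s d b, s c b, s c a, s d a]
  ring

lemma sum_inv_mul_schouten (hn : 3 ≤ n) (hg : IsMetricOn g U) (hx : x ∈ U) :
    ∑ e, ∑ d, (g x)⁻¹ e d * schouten g e d x = scalarCurv g x / (2 * ((n : ℝ) - 1)) := by
  have hn' : (3 : ℝ) ≤ n := by exact_mod_cast hn
  have h1 : (n : ℝ) - 1 ≠ 0 := by linarith
  have h2 : (n : ℝ) - 2 ≠ 0 := by linarith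
  have e : ∑ e, ∑ d, (g x)⁻¹ e d * schouten g e d x = 1 / ((n : ℝ) - 2) *
      ((∑ e, ∑ d, (g x)⁻¹ e d * ricci g e d x) -
        scalarCurv g x / (2 * ((n : ℝ) - 1)) * ∑ e, ∑ d, (g x)⁻¹ e d * g x e d) := by
    simp only [Finset.mul_sum, ← Finset.sum_sub_distrib]
    iterate 2 refine Finset.sum_congr rfl fun _ _ => ?_
    unfold schouten
    ring
  have e' : ∑ e, ∑ d, (g x)⁻¹ e d * ricci g e d x = scalarCurv g x := rfl
  rw [e, hg.sum_inv_mul_self hx, e']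
  field_simp
  ring

/-- The Weyl tensor is trace-free. -/
lemma weyl_trace (hn : 3 ≤ n) (hg : IsMetricOn g U) (hx : x ∈ U) (b c : Fin n) :
    ∑ e, ∑ d, (g x)⁻¹ e d * weyl g b e c d x = 0 := by
  have hn' : (3 : ℝ) ≤ n := by exact_mod_cast hn
  have h1 : (n : ℝ) - 1 ≠ 0 := by linarith
  have h2 : (n : ℝ) - 2 ≠ 0 := by linarith
  have e : ∑ e, ∑ d, (g x)⁻¹ e d * weyl g b e c d x =
      -(∑ e, ∑ d, (g x)⁻¹ e d * riemannLow g e b c d x)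
      + schouten g b c x * (∑ e, ∑ d, (g x)⁻¹ e d * g x e d)
      - (∑ e, ∑ d, (g x)⁻¹ e d * (schouten g e c x * g x b d))
      + g x b c * (∑ e, ∑ d, (g x)⁻¹ e d * schouten g e d x)
      - ∑ e, ∑ d, (g x)⁻¹ e d * (schouten g b d x * g x e c) := by
    simp only [Finset.mul_sum, ← Finset.sum_sub_distrib, ← Finset.sum_add_distrib,
      ← Finset.sum_neg_distrib]
    iterate 2 refine Finset.sum_congr rfl fun _ _ => ?_
    rw [weyl_eq, riemannLow_antisymm_left]
    unfold kulk
    ring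
  rw [e, ← ricci_eq_sum_low hg hx, hg.sum_inv_mul_self hx,
    hg.sum_inv_mul_left hx (fun e => schouten g e c x),
    hg.sum_inv_mul_right hx (fun d => schouten g b d x), sum_inv_mul_schouten hn hg hx]
  unfold schouten
  field_simp
  ring

lemma contDiffOn_ricci (hU : IsOpen U) (hg : IsMetricOn g U) {m : ℕ}
    (hr : MatContDiffOn (m + 2) g U) (a b : Fin n) : ContDiffOn ℝ m (ricci g a b) U := by
  have : ricci g a b = fun y => ∑ c, riemannUp g c a b c y := funext fun y => ricci_eq g a b y
  rw [this]
  exact ContDiffOn.sum fun c _ => matContDiffOn_curv hU hg hr c a b c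

lemma contDiffOn_schouten (hU : IsOpen U) (hg : IsMetricOn g U) {m : ℕ}
    (hr : MatContDiffOn (m + 2) g U) (a b : Fin n) : ContDiffOn ℝ m (schouten g a b) U := by
  have h0 := hr.of_le (Nat.le_add_right m 2)
  have hi := h0.inv hg
  have hs : ContDiffOn ℝ m (scalarCurv g) U :=
    ContDiffOn.sum fun a _ => ContDiffOn.sum fun b _ => (hi a b).mul (contDiffOn_ricci hU hg hr a b)
  exact contDiffOn_const.mul ((contDiffOn_ricci hU hg hr a b).sub
    ((hs.div_const _).mul (h0 a b)))

lemma contDiffOn_riemannLow (hU : IsOpen U) (hg : IsMetricOn g U) {m : ℕ}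
    (hr : MatContDiffOn (m + 2) g U) (a b c d : Fin n) : ContDiffOn ℝ m (riemannLow g a b c d) U :=
  ContDiffOn.sum fun e _ => (matContDiffOn_curv hU hg hr a b c e).mul
    (hr.of_le (Nat.le_add_right m 2) e d)

lemma contDiffOn_kulk (hU : IsOpen U) (hg : IsMetricOn g U) {m : ℕ}
    (hr : MatContDiffOn (m + 2) g U) (a b c d : Fin n) :
    ContDiffOn ℝ m (fun y => kulk (fun i j => schouten g i j y) (g y) a b c d) U := by
  have h0 := hr.of_le (Nat.le_add_right m 2)
  have hp := contDiffOn_schouten hU hg hr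
  exact ((((hp a c).mul (h0 b d)).sub ((hp b c).mul (h0 a d))).add ((hp b d).mul (h0 a c))).sub
    ((hp a d).mul (h0 b c))

lemma contDiffOn_weyl (hU : IsOpen U) (hg : IsMetricOn g U) {m : ℕ}
    (hr : MatContDiffOn (m + 2) g U) (a b c d : Fin n) : ContDiffOn ℝ m (weyl g a b c d) U := by
  have : weyl g a b c d = fun y => riemannLow g a b c d y +
      kulk (fun i j => schouten g i j y) (g y) a b c d := funext fun y => weyl_eq g a b c d y
  rw [this]
  exact (contDiffOn_riemannLow hU hg hr a b c d).add (contDiffOn_kulk hU hg hr a b c d)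

lemma contDiffOn_cov2_schouten (hU : IsOpen U) (hg : IsMetricOn g U) {m : ℕ}
    (hr : MatContDiffOn (m + 3) g U) (c a b : Fin n) :
    ContDiffOn ℝ m (cov2 g (schouten g) c a b) U := by
  have hp := contDiffOn_schouten hU hg (m := m + 1) hr
  have hp' := fun a b => (hp a b).of_le (m := m) (by exact_mod_cast Nat.le_succ m)
  have hc := matContDiffOn_conn hU hg (m := m) (hr.of_le (by omega))
  refine ((contDiffOn_pd hU (by exact_mod_cast hp a b) c).sub
    (ContDiffOn.sum fun d _ => (hc c a d).mul (hp' d b))).sub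
    (ContDiffOn.sum fun d _ => (hc c b d).mul (hp' a d))

lemma contDiffOn_cotton (hU : IsOpen U) (hg : IsMetricOn g U) {m : ℕ}
    (hr : MatContDiffOn (m + 3) g U) (a b c : Fin n) : ContDiffOn ℝ m (cotton g a b c) U :=
  (contDiffOn_cov2_schouten hU hg hr a b c).sub (contDiffOn_cov2_schouten hU hg hr b a c)

lemma cotton_antisymm (g : Met n) (a b c : Fin n) (x : Pt n) :
    cotton g a b c x = -cotton g b a c x := by
  unfold cotton
  ring

lemma pd_riemannLow_cyclic (hU : IsOpen U) (hg : IsMetricOn g U) (hr : MatContDiffOn 3 g U)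
    (hx : x ∈ U) (a b c d e : Fin n) :
    pd e (riemannLow g a b c d) x + pd a (riemannLow g b e c d) x + pd b (riemannLow g e a c d) x =
      (∑ f, (christoffel g f e c x * riemannLow g a b f d x +
        christoffel g f e d x * riemannLow g a b c f x))
      + (∑ f, (christoffel g f a c x * riemannLow g b e f d x +
        christoffel g f a d x * riemannLow g b e c f x))
      + ∑ f, (christoffel g f b c x * riemannLow g e a f d x +
        christoffel g f b d x * riemannLow g e a c f x) := by
  have hc := matContDiffOn_curv hU hg (m := 1) hr
  have hg1 := hr.of_le (k := 1) (by norm_num)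
  have h := congrArg (· * g x) (bianchi_curv hU hg hr hx a b e)
  have hd : ∀ a b e, matPd e (fun y => curv g a b y * g y) x = matPd e (curv g a b) x * g x +
      curv g a b x * (conn g e x * g x + g x * (conn g e x)ᵀ) := fun a b e => by
    rw [matPd_mul hU (hc a b) hg1 e hx, matPd_metric hU hg hx e]
  have hl : ∀ a b e, matPd e (fun y => curv g a b y * g y) x c d =
      pd e (riemannLow g a b c d) x := fun a b e => by
    simp only [matPd, curv_mul_apply, Matrix.of_apply]
  have hs : ∀ a b e, ∑ f, (christoffel g f e c x * riemannLow g a b f d x +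
        christoffel g f e d x * riemannLow g a b c f x) =
      (conn g e x * (curv g a b x * g x) + curv g a b x * g x * (conn g e x)ᵀ) c d :=
    fun a b e => by
      simp only [Matrix.add_apply, Matrix.mul_apply (M := conn g e x),
        Matrix.mul_apply (M := curv g a b x * g x), curv_mul_apply, ← Finset.sum_add_distrib]
      refine Finset.sum_congr rfl fun f _ => ?_
      simp only [conn, Matrix.of_apply, Matrix.transpose_apply]
      ring
  rw [hs, hs, hs, ← hl, ← hl, ← hl, ← Matrix.add_apply, ← Matrix.add_apply, ← Matrix.add_apply,
    ← Matrix.add_apply, hd, hd, hd]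
  refine congrArg (fun M : Matrix (Fin n) (Fin n) ℝ => M c d) ?_
  simp only [add_mul, sub_mul] at h
  rw [← sub_eq_zero] at h ⊢
  rw [← h]
  noncomm_ring

lemma pd_schouten_eq (g : Met n) (a b c : Fin n) (x : Pt n) :
    pd c (schouten g a b) x = cov2 g (schouten g) c a b x
      + (∑ f, christoffel g f c a x * schouten g f b x)
      + ∑ f, christoffel g f c b x * schouten g a f x := by
  unfold cov2
  ring

lemma pd_metric_eq (hU : IsOpen U) (hg : IsMetricOn g U) (hx : x ∈ U) (a b c : Fin n) :
    pd c (fun y => g y a b) x = (∑ f, christoffel g f c a x * g x f b)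
      + ∑ f, christoffel g f c b x * g x a f := by
  have h := congrFun (congrFun (matPd_metric hU hg hx c) a) b
  simp only [matPd, Matrix.of_apply, Matrix.add_apply, Matrix.mul_apply, conn,
    Matrix.transpose_apply] at h
  rw [h]
  congr 1
  exact Finset.sum_congr rfl fun f _ => mul_comm _ _

lemma pd_kulk (hU : IsOpen U) (hg : IsMetricOn g U) (hr : MatContDiffOn 3 g U)
    (hx : x ∈ U) (a b c d e : Fin n) :
    pd e (fun y => kulk (fun i j => schouten g i j y) (g y) a b c d) x =
      (∑ f, (christoffel g f e c x * kulk (fun i j => schouten g i j x) (g x) a b f d +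
        christoffel g f e d x * kulk (fun i j => schouten g i j x) (g x) a b c f))
      + (∑ f, (christoffel g f e a x * kulk (fun i j => schouten g i j x) (g x) f b c d +
        christoffel g f e b x * kulk (fun i j => schouten g i j x) (g x) a f c d))
      + (cov2 g (schouten g) e a c x * g x b d - cov2 g (schouten g) e b c x * g x a d
        + cov2 g (schouten g) e b d x * g x a c - cov2 g (schouten g) e a d x * g x b c) := by
  have dP : ∀ i j, DifferentiableAt ℝ (schouten g i j) x := fun i j =>
    differentiableAt_of_contDiffOn hU (m := 0) (contDiffOn_schouten hU hg (m := 1) hr i j) hx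
  have dg : ∀ i j, DifferentiableAt ℝ (fun y => g y i j) x := fun i j =>
    hr.differentiableAt hU (m := 2) hx i j
  have hm : ∀ i j k l, pd e (fun y => schouten g i j y * g y k l) x =
      (cov2 g (schouten g) e i j x + (∑ f, christoffel g f e i x * schouten g f j x)
      + ∑ f, christoffel g f e j x * schouten g i f x) * g x k l + schouten g i j x *
      ((∑ f, christoffel g f e k x * g x f l) + ∑ f, christoffel g f e l x * g x k f) :=
    fun i j k l => by
      rw [← pd_schouten_eq, ← pd_metric_eq hU hg hx]
      exact pd_mul (dP i j) (dg k l) e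
  have hd := fun i j k l => (dP i j).fun_mul (dg k l)
  have hl : ∀ (Γ h : Fin n → ℝ) (k : ℝ), ∑ f, Γ f * (k * h f) = k * ∑ f, Γ f * h f :=
    fun Γ h k => by
      rw [Finset.mul_sum]
      exact Finset.sum_congr rfl fun f _ => by ring
  have hr : ∀ (Γ h : Fin n → ℝ) (k : ℝ), ∑ f, Γ f * (h f * k) = (∑ f, Γ f * h f) * k :=
    fun Γ h k => by
      rw [Finset.sum_mul]
      exact Finset.sum_congr rfl fun f _ => by ring
  simp only [kulk]
  rw [pd_sub (((hd _ _ _ _).fun_sub (hd _ _ _ _)).fun_add (hd _ _ _ _)) (hd _ _ _ _),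
    pd_add ((hd _ _ _ _).fun_sub (hd _ _ _ _)) (hd _ _ _ _), pd_sub (hd _ _ _ _) (hd _ _ _ _),
    hm, hm, hm, hm]
  simp only [mul_add, mul_sub, Finset.sum_add_distrib, Finset.sum_sub_distrib, hl, hr]
  ring

/-- The second Bianchi identity in terms of the Weyl and Cotton tensors. -/
lemma pd_weyl_cyclic (hU : IsOpen U) (hg : IsMetricOn g U) (hr : MatContDiffOn 3 g U)
    (hx : x ∈ U) (a b c d e : Fin n) :
    pd e (weyl g a b c d) x + pd a (weyl g b e c d) x + pd b (weyl g e a c d) x =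
      (∑ f, (christoffel g f e c x * weyl g a b f d x + christoffel g f e d x * weyl g a b c f x))
      + (∑ f, (christoffel g f a c x * weyl g b e f d x +
        christoffel g f a d x * weyl g b e c f x))
      + (∑ f, (christoffel g f b c x * weyl g e a f d x +
        christoffel g f b d x * weyl g e a c f x))
      + (cotton g e a c x * g x b d - cotton g e a d x * g x b c
        + cotton g a b c x * g x e d - cotton g a b d x * g x e c
        + cotton g b e c x * g x a d - cotton g b e d x * g x a c) := by
  have hd : ∀ a b e, pd e (weyl g a b c d) x = pd e (riemannLow g a b c d) x +
      pd e (fun y => kulk (fun i j => schouten g i j y) (g y) a b c d) x := fun a b e => by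
    rw [← pd_add (differentiableAt_of_contDiffOn hU (m := 0)
        (contDiffOn_riemannLow hU hg (m := 1) hr a b c d) hx)
      (differentiableAt_of_contDiffOn hU (m := 0)
        (contDiffOn_kulk hU hg (m := 1) hr a b c d) hx)]
    exact congrArg (fun F => pd e F x) (funext fun y => weyl_eq g a b c d y)
  have h := pd_riemannLow_cyclic hU hg hr hx a b c d e
  have hk : ∀ a b c d, weyl g a b c d x = riemannLow g a b c d x +
    kulk (fun i j => schouten g i j x) (g x) a b c d := fun a b c d => weyl_eq g a b c d x
  have hz : (∑ f, (christoffel g f e a x * kulk (fun i j => schouten g i j x) (g x) f b c d +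
        christoffel g f e b x * kulk (fun i j => schouten g i j x) (g x) a f c d))
      + (∑ f, (christoffel g f a b x * kulk (fun i j => schouten g i j x) (g x) f e c d +
        christoffel g f a e x * kulk (fun i j => schouten g i j x) (g x) b f c d))
      + (∑ f, (christoffel g f b e x * kulk (fun i j => schouten g i j x) (g x) f a c d +
        christoffel g f b a x * kulk (fun i j => schouten g i j x) (g x) e f c d)) = 0 := by
    simp only [← Finset.sum_add_distrib]
    refine Finset.sum_eq_zero fun f _ => ?_
    rw [christoffel_symm hU hg hx a e f, christoffel_symm hU hg hx b e f,
      christoffel_symm hU hg hx b a f]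
    simp only [kulk]
    ring
  rw [hd, hd, hd, pd_kulk hU hg hr hx, pd_kulk hU hg hr hx, pd_kulk hU hg hr hx]
  simp only [hk, cotton, mul_add, Finset.sum_add_distrib] at h hz ⊢
  linear_combination h + hz

/-- The Schouten covectors, as matrices with constant rows. -/
def schoutenCol (g : Met n) (b : Fin n) (x : Pt n) : Matrix (Fin n) (Fin n) ℝ :=
  Matrix.of fun c _ => schouten g b c x

/-- The Cotton two-forms, as matrices with constant rows. -/
def cottonCol (g : Met n) (a b : Fin n) (x : Pt n) : Matrix (Fin n) (Fin n) ℝ :=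
  Matrix.of fun c _ => cotton g a b c x

lemma cottonCol_eq (hU : IsOpen U) (hg : IsMetricOn g U) (hx : x ∈ U) (a b : Fin n) :
    cottonCol g a b x = matPd a (schoutenCol g b) x - matPd b (schoutenCol g a) x
      - conn g a x * schoutenCol g b x + conn g b x * schoutenCol g a x := by
  ext c j
  simp only [cottonCol, cotton, cov2, matPd, schoutenCol, conn, Matrix.of_apply, Matrix.sub_apply,
    Matrix.add_apply, Matrix.mul_apply]
  simp only [christoffel_symm hU hg hx b a]
  change pd a (schouten g b c) x - _ - _ - (pd b (schouten g a c) x - _ - _) =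
    pd a (schouten g b c) x - pd b (schouten g a c) x - _ + _
  ring

/-- The differential identity for the Cotton two-forms. -/
lemma matPd_cottonCol_cyclic (hU : IsOpen U) (hg : IsMetricOn g U) (hr : MatContDiffOn 4 g U)
    (hx : x ∈ U) (a b e : Fin n) :
    matPd e (cottonCol g a b) x + matPd a (cottonCol g b e) x + matPd b (cottonCol g e a) x =
      conn g e x * cottonCol g a b x + conn g a x * cottonCol g b e x
        + conn g b x * cottonCol g e a x
        - (curv g e a x * schoutenCol g b x + curv g a b x * schoutenCol g e x
          + curv g b e x * schoutenCol g a x) := by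
  have hA := fun a => matContDiffOn_conn hU hg (m := 1) (hr.of_le (by norm_num)) a
  have hS2 : ∀ b, MatContDiffOn 2 (schoutenCol g b) U := fun b c j =>
    contDiffOn_schouten hU hg (m := 2) hr b c
  have hS := fun b => (hS2 b).of_le (k := 1) (by norm_num)
  have hp := fun a b => (hS2 b).matPd (m := 1) hU a
  have hd : ∀ a b e, matPd e (cottonCol g a b) x = matPd e (matPd a (schoutenCol g b)) x
      - matPd e (matPd b (schoutenCol g a)) x
      - (matPd e (conn g a) x * schoutenCol g b x + conn g a x * matPd e (schoutenCol g b) x)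
      + (matPd e (conn g b) x * schoutenCol g a x + conn g b x * matPd e (schoutenCol g a) x) :=
    fun a b e => by
      rw [matPd_congr hU (fun y hy => cottonCol_eq hU hg hy a b) e hx,
        matPd_add hU (((hp a b).sub (hp b a)).sub ((hA a).mul (hS b))) ((hA b).mul (hS a)) e hx,
        matPd_sub hU ((hp a b).sub (hp b a)) ((hA a).mul (hS b)) e hx,
        matPd_sub hU (hp a b) (hp b a) e hx, matPd_mul hU (hA a) (hS b) e hx,
        matPd_mul hU (hA b) (hS a) e hx]
  simp only [hd, curv_eq, cottonCol_eq hU hg hx]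
  rw [matPd_comm hU (hS2 b) e a hx, matPd_comm hU (hS2 a) e b hx, matPd_comm hU (hS2 e) a b hx]
  noncomm_ring

end WeylCotton

section BachSystem

variable {n : ℕ} {U : Set (Pt n)} {g : Met n} {x : Pt n}

/-- The Weyl and Cotton tensors, viewed as families of two-forms in their first two indices. -/
def weylCotton (g : Met n) : (Fin n × Fin n) ⊕ Fin n → Fin n → Fin n → Pt n → ℝ
  | .inl p, a, b => weyl g a b p.1 p.2
  | .inr c, a, b => cotton g a b c

/-- Local linear boundedness by the components of the Weyl and Cotton tensors. -/
abbrev WeylCottonBound (g : Met n) (U : Set (Pt n)) (f : Pt n → ℝ) : Prop :=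
  LinBound U (fun t : ((Fin n × Fin n) ⊕ Fin n) × Fin n × Fin n =>
    weylCotton g t.1 t.2.1 t.2.2) f

lemma weylCottonBound_weyl (a b c d : Fin n) : WeylCottonBound g U (weyl g a b c d) :=
  LinBound.of_mem (u := fun t : ((Fin n × Fin n) ⊕ Fin n) × Fin n × Fin n =>
    weylCotton g t.1 t.2.1 t.2.2) (Sum.inl (c, d), a, b)

lemma weylCottonBound_cotton (a b c : Fin n) : WeylCottonBound g U (cotton g a b c) :=
  LinBound.of_mem (u := fun t : ((Fin n × Fin n) ⊕ Fin n) × Fin n × Fin n =>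
    weylCotton g t.1 t.2.1 t.2.2) (Sum.inr c, a, b)

lemma weylCotton_antisymm (g : Met n) (k : (Fin n × Fin n) ⊕ Fin n) (a b : Fin n) (x : Pt n) :
    weylCotton g k a b x = -weylCotton g k b a x := by
  cases k with
  | inl p => exact weyl_antisymm_left g a b p.1 p.2 x
  | inr c => exact cotton_antisymm g a b c x

lemma contDiffOn_weylCotton (hU : IsOpen U) (hg : IsMetricOn g U) (hr : MatContDiffOn 4 g U)
    (k : (Fin n × Fin n) ⊕ Fin n) (a b : Fin n) : ContDiffOn ℝ 1 (weylCotton g k a b) U := by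
  cases k with
  | inl p => exact_mod_cast contDiffOn_weyl hU hg (m := 1) (hr.of_le (by norm_num)) a b p.1 p.2
  | inr c => exact_mod_cast contDiffOn_cotton hU hg (m := 1) hr a b c

lemma continuousOn_christoffel (hU : IsOpen U) (hg : IsMetricOn g U) (hr : MatContDiffOn 1 g U)
    (a b c : Fin n) : ContinuousOn (christoffel g c a b) U :=
  (matContDiffOn_conn hU hg (m := 0) hr a b c).continuousOn

lemma weylCottonBound_pd_weyl_cyclic (hU : IsOpen U) (hg : IsMetricOn g U)
    (hr : MatContDiffOn 3 g U) (a b c d e : Fin n) :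
    WeylCottonBound g U fun x =>
      pd e (weyl g a b c d) x + pd a (weyl g b e c d) x + pd b (weyl g e a c d) x := by
  refine LinBound.congr hU ?_ fun x hx => pd_weyl_cyclic hU hg hr hx a b c d e
  have hΓ := continuousOn_christoffel hU hg (hr.of_le (by norm_num))
  have hgc : ∀ i j, ContinuousOn (fun y => g y i j) U := fun i j => (hr i j).continuousOn
  have hW : ∀ i j a b c d, WeylCottonBound g U
      fun x => ∑ f, (christoffel g f i c x * weyl g a b f d x +
        christoffel g f j d x * weyl g a b c f x) := fun i j a b c d =>
    LinBound.sum _ fun f _ => ((weylCottonBound_weyl _ _ _ _).mul_left hU (hΓ _ _ _)).add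
      ((weylCottonBound_weyl _ _ _ _).mul_left hU (hΓ _ _ _))
  have hC : ∀ a b c i j, WeylCottonBound g U fun x => cotton g a b c x * g x i j :=
    fun a b c i j => (weylCottonBound_cotton a b c).mul_right hU (hgc i j)
  exact (((hW _ _ _ _ _ _).add (hW _ _ _ _ _ _)).add (hW _ _ _ _ _ _)).add
    ((((((hC _ _ _ _ _).sub (hC _ _ _ _ _)).add (hC _ _ _ _ _)).sub (hC _ _ _ _ _)).add
      (hC _ _ _ _ _)).sub (hC _ _ _ _ _))

lemma weylCottonBound_trace_pd_weyl (hn : 3 ≤ n) (hU : IsOpen U) (hg : IsMetricOn g U)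
    (hr : MatContDiffOn 3 g U) (b c i : Fin n) :
    WeylCottonBound g U fun x => ∑ d, ∑ e, (g x)⁻¹ d e * pd i (weyl g b e c d) x := by
  have hi := (hr.of_le (k := 1) (by norm_num)).inv hg
  have hi' := hi.matPd (m := 0) hU i
  refine LinBound.congr (f := fun x => -∑ e, ∑ d, pd i (fun y => (g y)⁻¹ e d) x *
    weyl g b e c d x) hU ?_ fun x hx => ?_
  · exact (LinBound.sum _ fun e _ => LinBound.sum _ fun d _ =>
      (weylCottonBound_weyl b e c d).mul_left hU (hi' e d).continuousOn).neg
  have dW : ∀ e d, DifferentiableAt ℝ (weyl g b e c d) x := fun e d =>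
    differentiableAt_of_contDiffOn hU (m := 0) (contDiffOn_weyl hU hg (m := 1) hr b e c d) hx
  have dg := hi.differentiableAt (m := 0) hU hx
  have h : pd i (fun y => ∑ e, ∑ d, (g y)⁻¹ e d * weyl g b e c d y) x = 0 := by
    rw [pd_congr hU (fun y hy => weyl_trace hn hg hy b c) i hx, pd_const]
  rw [pd_sum _ fun e _ => DifferentiableAt.fun_sum fun d _ => (dg e d).fun_mul (dW e d)] at h
  have h' : ∑ e, ∑ d, (pd i (fun y => (g y)⁻¹ e d) x * weyl g b e c d x +
      (g x)⁻¹ e d * pd i (weyl g b e c d) x) = 0 := by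
    rw [← h]
    refine Finset.sum_congr rfl fun e _ => ?_
    rw [pd_sum _ fun d _ => (dg e d).fun_mul (dW e d)]
    exact Finset.sum_congr rfl fun d _ => (pd_mul (dg e d) (dW e d) i).symm
  simp only [Finset.sum_add_distrib] at h'
  rw [← eq_neg_of_add_eq_zero_right h', Finset.sum_comm]
  iterate 2 refine Finset.sum_congr rfl fun _ _ => ?_
  rw [hg.inv_symm hx]

lemma weylCottonBound_div_weyl (hn : 3 ≤ n) (hU : IsOpen U) (hg : IsMetricOn g U)
    (hr : MatContDiffOn 3 g U) (b c d : Fin n) :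
    WeylCottonBound g U fun x => ∑ a, ∑ e, (g x)⁻¹ a e * pd e (weyl g a b c d) x := by
  have hi : ∀ i j, ContinuousOn (fun y => (g y)⁻¹ i j) U := fun i j =>
    ((hr.inv hg) i j).continuousOn
  have h1 := weylCottonBound_trace_pd_weyl hn hU hg hr d b c
  have h2 := weylCottonBound_trace_pd_weyl hn hU hg hr c b d
  have h3 : WeylCottonBound g U fun x => ∑ a, ∑ e, (g x)⁻¹ a e *
      (pd e (weyl g c d b a) x + pd c (weyl g d e b a) x + pd d (weyl g e c b a) x) :=
    LinBound.sum _ fun a _ => LinBound.sum _ fun e _ =>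
      (weylCottonBound_pd_weyl_cyclic hU hg hr c d b a e).mul_left hU (hi a e)
  refine LinBound.congr hU ((h1.sub h2).sub h3) fun x hx => ?_
  simp only [← Finset.sum_sub_distrib]
  iterate 2 refine Finset.sum_congr rfl fun _ _ => ?_
  have hA : ∀ a e, pd e (weyl g a b c d) x = -pd e (weyl g c d b a) x := fun a e => by
    rw [← pd_neg]
    exact pd_congr hU (fun y hy => by
      rw [weyl_antisymm_left, weyl_pair hU hg (hr.of_le (by norm_num)) hy]) e hx
  have hB : ∀ a e, pd d (weyl g e c b a) x = -pd d (weyl g c e b a) x := fun a e => by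
    rw [← pd_neg]
    exact pd_congr hU (fun y _ => weyl_antisymm_left g e c b a y) d hx
  rw [hA, hB]
  ring

/-- Contraction of the Kulkarni–Nomizu part of the curvature with the Schouten tensor. -/
lemma kulk_contract (hg : IsMetricOn g U) (hx : x ∈ U) (p : Fin n → Fin n → ℝ) (a b c e : Fin n) :
    ∑ f, ∑ d, (g x)⁻¹ f d * (kulk p (g x) e a c f * p b d) =
      p e c * p b a - p a c * p b e
      + g x e c * (∑ f, ∑ d, (g x)⁻¹ f d * (p a f * p b d))
      - g x a c * ∑ f, ∑ d, (g x)⁻¹ f d * (p e f * p b d) := by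
  rw [← hg.sum_inv_mul_right hx (p b) a, ← hg.sum_inv_mul_right hx (p b) e]
  simp only [Finset.mul_sum, ← Finset.sum_sub_distrib, ← Finset.sum_add_distrib]
  iterate 2 refine Finset.sum_congr rfl fun _ _ => ?_
  rw [hg.symm hx _ a, hg.symm hx _ e]
  unfold kulk
  ring

lemma kulk_contract_cyclic (hU : IsOpen U) (hg : IsMetricOn g U) (hr : MatContDiffOn 2 g U)
    (hx : x ∈ U) (a b c e : Fin n) :
    (∑ f, ∑ d, (g x)⁻¹ f d * (kulk (fun i j => schouten g i j x) (g x) e a c f * schouten g b d x))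
      + (∑ f, ∑ d, (g x)⁻¹ f d *
        (kulk (fun i j => schouten g i j x) (g x) a b c f * schouten g e d x))
      + ∑ f, ∑ d, (g x)⁻¹ f d *
        (kulk (fun i j => schouten g i j x) (g x) b e c f * schouten g a d x) = 0 := by
  have p := schouten_symm hU hg hr hx
  have q : ∀ a b, ∑ f, ∑ d, (g x)⁻¹ f d * (schouten g a f x * schouten g b d x) =
      ∑ f, ∑ d, (g x)⁻¹ f d * (schouten g b f x * schouten g a d x) := fun a b => by
    rw [Finset.sum_comm]
    iterate 2 refine Finset.sum_congr rfl fun _ _ => ?_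
    rw [hg.inv_symm hx]
    ring
  rw [kulk_contract hg hx (fun i j => schouten g i j x),
    kulk_contract hg hx (fun i j => schouten g i j x),
    kulk_contract hg hx (fun i j => schouten g i j x)]
  simp only [q b a, q e b, q a e, p b a, p b e, p e a]
  ring

lemma sum_riemannUp_mul_schouten (hg : IsMetricOn g U) (hx : x ∈ U) (a b c e : Fin n) :
    ∑ d, riemannUp g e a c d x * schouten g b d x =
      (∑ f, ∑ d, ((g x)⁻¹ f d * schouten g b d x) * weyl g e a c f x)
      - ∑ f, ∑ d, (g x)⁻¹ f d *
        (kulk (fun i j => schouten g i j x) (g x) e a c f * schouten g b d x) := by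
  simp only [riemannUp_eq hg hx, Finset.sum_mul, ← Finset.sum_sub_distrib]
  rw [Finset.sum_comm]
  iterate 2 refine Finset.sum_congr rfl fun _ _ => ?_
  rw [weyl_eq]
  ring

lemma weylCottonBound_pd_cotton_cyclic (hU : IsOpen U) (hg : IsMetricOn g U)
    (hr : MatContDiffOn 4 g U) (a b c e : Fin n) :
    WeylCottonBound g U fun x =>
      pd e (cotton g a b c) x + pd a (cotton g b e c) x + pd b (cotton g e a c) x := by
  have hΓ := continuousOn_christoffel hU hg (hr.of_le (by norm_num))
  have hi : ∀ i j, ContinuousOn (fun y => (g y)⁻¹ i j) U := fun i j =>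
    ((hr.inv hg) i j).continuousOn
  have hP : ∀ i j, ContinuousOn (schouten g i j) U := fun i j =>
    (contDiffOn_schouten hU hg (m := 2) hr i j).continuousOn
  have hC : ∀ i a b, WeylCottonBound g U fun x => ∑ d, christoffel g d i c x * cotton g a b d x :=
    fun i a b => LinBound.sum _ fun d _ => (weylCottonBound_cotton a b d).mul_left hU (hΓ _ _ _)
  have hW : ∀ e a b, WeylCottonBound g U fun x =>
      ∑ f, ∑ d, ((g x)⁻¹ f d * schouten g b d x) * weyl g e a c f x := fun e a b =>
    LinBound.sum _ fun f _ => LinBound.sum _ fun d _ =>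
      (weylCottonBound_weyl e a c f).mul_left hU ((hi f d).mul (hP b d))
  refine LinBound.congr hU ((((hC e a b).add (hC a b e)).add (hC b e a)).sub
    (((hW e a b).add (hW a b e)).add (hW b e a))) fun x hx => ?_
  have h := congrFun (congrFun (matPd_cottonCol_cyclic hU hg hr hx a b e) c) c
  have hl : ∀ i a b, matPd i (cottonCol g a b) x c c = pd i (cotton g a b c) x :=
    fun _ _ _ => rfl
  simp only [Matrix.add_apply, Matrix.sub_apply, Matrix.mul_apply, hl] at h
  rw [h]
  have hR : ∀ e a b, ∑ d, curv g e a x c d * schoutenCol g b x d c =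
      (∑ f, ∑ d, ((g x)⁻¹ f d * schouten g b d x) * weyl g e a c f x)
      - ∑ f, ∑ d, (g x)⁻¹ f d *
        (kulk (fun i j => schouten g i j x) (g x) e a c f * schouten g b d x) :=
    fun e a b => sum_riemannUp_mul_schouten hg hx a b c e
  have hK : ∀ i a b, ∑ d, conn g i x c d * cottonCol g a b x d c =
      ∑ d, christoffel g d i c x * cotton g a b d x := fun _ _ _ => rfl
  simp only [hR, hK]
  linear_combination kulk_contract_cyclic hU hg (hr.of_le (by norm_num)) hx a b c e

lemma cov2_schouten_symm (hU : IsOpen U) (hg : IsMetricOn g U) (hr : MatContDiffOn 2 g U)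
    (hx : x ∈ U) (a b c : Fin n) :
    cov2 g (schouten g) a b c x = cov2 g (schouten g) a c b x := by
  have p := fun y hy => schouten_symm hU hg hr (x := y) hy
  unfold cov2
  rw [pd_congr hU (fun y hy => p y hy b c) a hx]
  simp only [p x hx b, p x hx c]
  rw [sub_right_comm]

lemma cov3_cov2_schouten_sub (hU : IsOpen U) (hg : IsMetricOn g U) (hr : MatContDiffOn 4 g U)
    (hx : x ∈ U) (a b c d : Fin n) :
    cov3 g (cov2 g (schouten g)) d a b c x - cov3 g (cov2 g (schouten g)) d c a b x =
      cov3 g (cotton g) d a c b x := by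
  have hs : ∀ a b c, ∀ y ∈ U, cov2 g (schouten g) a b c y = cov2 g (schouten g) a c b y :=
    fun a b c y hy => cov2_schouten_symm hU hg (hr.of_le (by norm_num)) hy a b c
  have hN : ∀ a b c, DifferentiableAt ℝ (cov2 g (schouten g) a b c) x := fun a b c =>
    differentiableAt_of_contDiffOn hU (m := 0)
      (by exact_mod_cast contDiffOn_cov2_schouten hU hg (m := 1) hr a b c) hx
  have h : pd d (cotton g a c b) x = _ := pd_sub (hN a c b) (hN c a b) d
  have h' := pd_congr hU (hs a b c) d hx
  unfold cov3
  simp only [h, h', hs _ b c x hx, hs a b _ x hx, hs a _ c x hx, cotton, mul_sub,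
    Finset.sum_sub_distrib]
  ring

lemma weylCottonBound_div_cotton (hU : IsOpen U) (hg : IsMetricOn g U)
    (hr : MatContDiffOn 4 g U) (hB : ∀ a b, ∀ x ∈ U, bach g a b x = 0) (a b : Fin n) :
    WeylCottonBound g U fun x => ∑ c, ∑ d, (g x)⁻¹ c d * pd d (cotton g c a b) x := by
  have hΓ := continuousOn_christoffel hU hg (hr.of_le (by norm_num))
  have hi : ∀ i j, ContinuousOn (fun y => (g y)⁻¹ i j) U := fun i j =>
    ((hr.inv hg) i j).continuousOn
  have hP : ∀ i j, ContinuousOn (schouten g i j) U := fun i j =>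
    (contDiffOn_schouten hU hg (m := 2) hr i j).continuousOn
  have hC : ∀ a b c i j k, WeylCottonBound g U fun x => christoffel g i j k x * cotton g a b c x :=
    fun a b c i j k => (weylCottonBound_cotton a b c).mul_left hU (hΓ j k i)
  have hS : WeylCottonBound g U fun x => ∑ c, ∑ d, ∑ e, ∑ f,
      (g x)⁻¹ c e * (g x)⁻¹ d f * schouten g e f x * weyl g a c d b x := by
    iterate 4 refine LinBound.sum _ fun _ _ => ?_
    exact (weylCottonBound_weyl _ _ _ _).mul_left hU (((hi _ _).mul (hi _ _)).mul (hP _ _))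
  have hT : WeylCottonBound g U fun x => ∑ c, ∑ d, (g x)⁻¹ c d *
      ((∑ e, christoffel g e d a x * cotton g e c b x)
      + (∑ e, christoffel g e d c x * cotton g a e b x)
      + ∑ e, christoffel g e d b x * cotton g a c e x) := by
    iterate 2 refine LinBound.sum _ fun _ _ => ?_
    refine LinBound.mul_left hU (hi _ _) ((LinBound.add ?_ ?_).add ?_) <;>
      exact LinBound.sum _ fun _ _ => hC _ _ _ _ _ _
  refine LinBound.congr hU (hS.sub hT) fun x hx => ?_
  have h := hB a b x hx
  unfold bach at h
  simp only [cov3_cov2_schouten_sub hU hg hr hx] at h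
  have h' : ∑ c, ∑ d, (g x)⁻¹ c d * pd d (cotton g c a b) x =
      -(∑ c, ∑ d, (g x)⁻¹ c d * cov3 g (cotton g) d a c b x) - ∑ c, ∑ d, (g x)⁻¹ c d *
      ((∑ e, christoffel g e d a x * cotton g e c b x)
      + (∑ e, christoffel g e d c x * cotton g a e b x)
      + ∑ e, christoffel g e d b x * cotton g a c e x) := by
    simp only [← Finset.sum_sub_distrib, ← Finset.sum_neg_distrib]
    iterate 2 refine Finset.sum_congr rfl fun _ _ => ?_
    rw [pd_congr hU (fun y _ => cotton_antisymm g _ a b y) _ hx, pd_neg]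
    unfold cov3
    ring
  rw [h']
  linear_combination -h

/-- In dimension at least four the Cotton tensor of a conformally flat metric vanishes. -/
lemma cotton_eq_zero_of_weyl_eq_zero (hn : 4 ≤ n) (hU : IsOpen U) (hg : IsMetricOn g U)
    (hr : MatContDiffOn 3 g U) (hW : ∀ a b c d, ∀ x ∈ U, weyl g a b c d x = 0) (hx : x ∈ U)
    (a b c : Fin n) : cotton g a b c x = 0 := by
  have hn' : (4 : ℝ) ≤ n := by exact_mod_cast hn
  have h : ∀ a b c d e, cotton g e a c x * g x b d - cotton g e a d x * g x b c
        + cotton g a b c x * g x e d - cotton g a b d x * g x e c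
        + cotton g b e c x * g x a d - cotton g b e d x * g x a c = 0 := fun a b c d e => by
    have h := pd_weyl_cyclic hU hg hr hx a b c d e
    have hd : ∀ a b c d e, pd e (weyl g a b c d) x = 0 := fun a b c d e => by
      rw [pd_congr hU (hW a b c d) e hx, pd_const]
    simpa [hd, fun a b c d => hW a b c d x hx] using h.symm
  obtain ⟨t, ht⟩ : ∃ t : Fin n → ℝ, ∀ a, t a = ∑ e, ∑ d, (g x)⁻¹ e d * cotton g e a d x :=
    ⟨_, fun _ => rfl⟩
  have h1 : ∀ a b c, ((n : ℝ) - 3) * cotton g a b c x = t a * g x b c - t b * g x a c :=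
    fun a b c => by
      have e : ∑ e, ∑ d, (g x)⁻¹ e d * (cotton g e a c x * g x b d - cotton g e a d x * g x b c
          + cotton g a b c x * g x e d - cotton g a b d x * g x e c
          + cotton g b e c x * g x a d - cotton g b e d x * g x a c) =
          (∑ e, ∑ d, (g x)⁻¹ e d * (cotton g e a c x * g x b d))
          - (∑ e, ∑ d, (g x)⁻¹ e d * cotton g e a d x) * g x b c
          + cotton g a b c x * (∑ e, ∑ d, (g x)⁻¹ e d * g x e d)
          - (∑ e, ∑ d, (g x)⁻¹ e d * (cotton g a b d x * g x e c))
          + (∑ e, ∑ d, (g x)⁻¹ e d * (cotton g b e c x * g x a d))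
          + (∑ e, ∑ d, (g x)⁻¹ e d * cotton g e b d x) * g x a c := by
        simp only [Finset.mul_sum, Finset.sum_mul, ← Finset.sum_sub_distrib,
          ← Finset.sum_add_distrib]
        iterate 2 refine Finset.sum_congr rfl fun _ _ => ?_
        rw [cotton_antisymm g b _ _]
        rw [cotton_antisymm g b _ _]
        ring
      simp only [h, mul_zero, Finset.sum_const_zero] at e
      rw [hg.sum_inv_mul_left hx (fun e => cotton g e a c x),
        hg.sum_inv_mul_right hx (fun d => cotton g a b d x),
        hg.sum_inv_mul_left hx (fun e => cotton g b e c x), hg.sum_inv_mul_self hx, ← ht, ← ht,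
        cotton_antisymm g b a] at e
      linear_combination -e
  have h2 : ∀ b, t b = 0 := fun b => by
    have e : ((n : ℝ) - 3) * ∑ a, ∑ c, (g x)⁻¹ a c * cotton g a b c x =
        (∑ a, ∑ c, (g x)⁻¹ a c * (t a * g x b c)) -
          t b * ∑ a, ∑ c, (g x)⁻¹ a c * g x a c := by
      simp only [Finset.mul_sum, ← Finset.sum_sub_distrib]
      refine Finset.sum_congr rfl fun a _ => Finset.sum_congr rfl fun c _ => ?_
      linear_combination (g x)⁻¹ a c * h1 a b c
    rw [hg.sum_inv_mul_self hx, hg.sum_inv_mul_left hx t, ← ht] at e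
    have e' : (2 * (n : ℝ) - 4) * t b = 0 := by linear_combination e
    exact (mul_eq_zero.1 e').resolve_left (by linarith)
  have h3 := h1 a b c
  rw [h2, h2, zero_mul, zero_mul, sub_zero] at h3
  exact (mul_eq_zero.1 h3).resolve_left (by linarith)

/-- Unique continuation of conformal flatness for Bach-flat metrics of class `C⁴`. -/
theorem weyl_eq_zero_of_bach_eq_zero (hn : 4 ≤ n) (hU : IsOpen U) (hUc : IsPreconnected U)
    (hg : IsMetricOn g U) (hr : MatContDiffOn 4 g U) (hB : ∀ a b, ∀ x ∈ U, bach g a b x = 0)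
    {O : Set (Pt n)} (hO : IsOpen O) (hOne : O.Nonempty) (hOU : O ⊆ U)
    (hW : ∀ a b c d, ∀ x ∈ O, weyl g a b c d x = 0) (a b c d : Fin n) (hx : x ∈ U) :
    weyl g a b c d x = 0 := by
  have : NeZero n := ⟨by omega⟩
  have hr3 := hr.of_le (k := 3) (by norm_num)
  refine eq_zero_of_linBound hU hUc (G := fun a e x => (g x)⁻¹ a e)
    (fun a b => by exact_mod_cast (hr.of_le (k := 1) (by norm_num)).inv hg a b)
    (fun a b y hy => hg.inv_symm hy a b) (fun y hy v hv => ?_) (ω := weylCotton g)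
    (contDiffOn_weylCotton hU hg hr) (fun k b c y _ => weylCotton_antisymm g k b c y)
    (fun k a b c => ?_) (fun k b => ?_) hO hOne hOU (fun y hy k b c => ?_) x hx (.inl (c, d)) a b
  · have := (hg y hy).2.inv.dotProduct_mulVec_pos hv
    simp only [dotProduct, mulVec, Finset.mul_sum, star_trivial] at this
    refine this.trans_eq ?_
    iterate 2 refine Finset.sum_congr rfl fun _ _ => ?_
    ring
  · cases k with
    | inl p => exact weylCottonBound_pd_weyl_cyclic hU hg hr3 b c p.1 p.2 a
    | inr i => exact weylCottonBound_pd_cotton_cyclic hU hg hr b c i a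
  · cases k with
    | inl p => exact weylCottonBound_div_weyl (by omega) hU hg hr3 b p.1 p.2
    | inr i => exact weylCottonBound_div_cotton hU hg hr hB b i
  · cases k with
    | inl p => exact hW b c p.1 p.2 y hy
    | inr i =>
      exact cotton_eq_zero_of_weyl_eq_zero hn hO (fun z hz => hg z (hOU hz))
        (fun i j => (hr3 i j).mono hOU) hW hy b c i

end BachSystem

/-- Theorem 3.10, dimension 4: unique continuation of local conformal flatness
for Bach-flat metrics. -/
theorem bach_flat_unique_continuation_of_conformal_flatness
    (U : Set (Pt 4)) (hU : IsOpen U) (hUconn : IsConnected U)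
    (k : ℕ) (hk : 4 ≤ k) (α : ℝ) (hα : α ∈ Set.Ioo (0 : ℝ) 1)
    (g : Met 4) (hgm : IsMetricOn g U) (hgr : MetCHolderOn k α U g)
    (hbach : ∀ a b : Fin 4, ∀ x ∈ U, bach g a b x = 0)
    (O : Set (Pt 4)) (hO : IsOpen O) (hOne : O.Nonempty) (hOU : O ⊆ U)
    (hweyl : ∀ a b c d : Fin 4, ∀ x ∈ O, weyl g a b c d x = 0) :
    ∀ a b c d : Fin 4, ∀ x ∈ U, weyl g a b c d x = 0 := by
  have hr : MatContDiffOn 4 g U := MatContDiffOn.of_le (fun i j => (hgr i j).1) hk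
  exact fun a b c d x hx => weyl_eq_zero_of_bach_eq_zero le_rfl hU hUconn.isPreconnected hgm hr
    hbach hO hOne hOU hweyl a b c d hx
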